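/- Let d ≥ 2, α ∈ (0,2), and let ℓ be a regular global modulus of continuity. Then there exist constants λ₁' > 0 and C > 1 such that for every R ∈ (0,1], every nonnegative function h that is α-harmonic in D_ℓ ∩ B(0,R) and vanishes continuously on B(0,R) \ D_ℓ, and every r ∈ (0, R/2]: h(r·e_d) ≤ C (r/R)^{α/2} exp(−λ₁' ∫_r^R ℓ(u)/u du) · h((R/2)·e_d). -/

import Mathlib

open Metric MeasureTheory

/-- `gEll ℓ t = t·ℓ(t)` for `t > 0`, and `0` for `t ≤ 0`. -/
noncomputable def gEll (ℓ : ℝ → ℝ) (t : ℝ) : ℝ := if 0 < t then t * ℓ t else 0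

/-- The special open set `D_ℓ = {x : x_d > Γ_ℓ(x̃)}`. -/
noncomputable def Dp (d : ℕ) (h0 : 0 < d) (ℓ : ℝ → ℝ) : Set (EuclideanSpace ℝ (Fin d)) :=
  {x | gEll ℓ (x ⟨0, h0⟩) < x ⟨d - 1, Nat.sub_lt h0 Nat.one_pos⟩}

/-- `h` is `α`-harmonic in `U`: the Poisson-kernel mean value property holds on every ball
whose closure is contained in `U`. -/
def AlphaHarmonicOn (d : ℕ) (α : ℝ) (h : EuclideanSpace ℝ (Fin d) → ℝ)
    (U : Set (EuclideanSpace ℝ (Fin d))) : Prop :=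
  ∀ x₀ : EuclideanSpace ℝ (Fin d), ∀ ρ : ℝ, 0 < ρ → closedBall x₀ ρ ⊆ U →
    ∀ x ∈ ball x₀ ρ,
      IntegrableOn
        (fun y : EuclideanSpace ℝ (Fin d) =>
          ((ρ ^ 2 - dist x x₀ ^ 2) / (dist y x₀ ^ 2 - ρ ^ 2)) ^ (α / 2) *
            dist x y ^ (-(d : ℝ)) * h y)
        {y : EuclideanSpace ℝ (Fin d) | ρ < dist y x₀} ∧
      h x = Real.Gamma ((d : ℝ) / 2) * Real.pi ^ (-(d : ℝ) / 2 - 1) *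
          Real.sin (Real.pi * α / 2) *
        ∫ y in {y : EuclideanSpace ℝ (Fin d) | ρ < dist y x₀},
          ((ρ ^ 2 - dist x x₀ ^ 2) / (dist y x₀ ^ 2 - ρ ^ 2)) ^ (α / 2) *
            dist x y ^ (-(d : ℝ)) * h y

theorem hasDerivAt_halfLine_primitive {a : ℝ} (ha : 0 < a) {s : ℝ} (hs : 0 < s) :
    HasDerivAt (fun s : ℝ => 1 / (2 * a) * (s ^ (-(2 * a)) * ((1 + s) ^ a - 1) ^ 2))
      (((1 + s) ^ a - 1) * (1 - (1 + s) ^ (a - 1)) * s ^ (-(2 * a) - 1)) s := by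
  have h1 : HasDerivAt (fun s : ℝ => s ^ (-(2 * a))) (-(2 * a) * s ^ (-(2 * a) - 1)) s :=
    Real.hasDerivAt_rpow_const (Or.inl hs.ne')
  have h2 : HasDerivAt (fun s : ℝ => (1 + s) ^ a - 1) (a * (1 + s) ^ (a - 1)) s := by
    have := ((hasDerivAt_id s).const_add 1).rpow_const (p := a) (Or.inl (by simp; linarith))
    simpa using this.sub_const 1
  have h3 := (h1.mul (h2.pow 2)).const_mul (1 / (2 * a))
  refine h3.congr_deriv ?_
  have e1 : s ^ (-(2 * a)) = s ^ (-(2 * a) - 1) * s := by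
    rw [← Real.rpow_add_one hs.ne']; ring_nf
  have e2 : (1 + s) ^ a = (1 + s) ^ (a - 1) * (1 + s) := by
    rw [← Real.rpow_add_one (by linarith)]; ring_nf
  simp only [Pi.pow_apply]
  rw [e1, e2]
  field_simp
  ring

theorem halfLine_diff_nonneg {a : ℝ} (ha : 0 < a) (ha1 : a < 1) {s : ℝ} (hs : 0 < s) :
    0 ≤ ((1 + s) ^ a - 1) * (1 - (1 + s) ^ (a - 1)) * s ^ (-(2 * a) - 1) := by
  have h1 : 1 ≤ (1 + s) ^ a := Real.one_le_rpow (by linarith) ha.le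
  have h2 : (1 + s) ^ (a - 1) ≤ 1 := Real.rpow_le_one_of_one_le_of_nonpos (by linarith) (by linarith)
  have h3 : 0 < s ^ (-(2 * a) - 1) := Real.rpow_pos_of_pos hs _
  have := mul_nonneg (sub_nonneg.2 h1) (sub_nonneg.2 h2)
  positivity

theorem tendsto_halfLine_primitive {a : ℝ} (ha : 0 < a) :
    Filter.Tendsto (fun s : ℝ => 1 / (2 * a) * (s ^ (-(2 * a)) * ((1 + s) ^ a - 1) ^ 2))
      Filter.atTop (nhds (1 / (2 * a))) := by
  have h1 : Filter.Tendsto (fun s : ℝ => (s⁻¹ + 1) ^ a - s ^ (-a)) Filter.atTop (nhds 1) := by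
    have h2 : Filter.Tendsto (fun s : ℝ => (s⁻¹ + 1) ^ a) Filter.atTop (nhds 1) := by
      have := (tendsto_inv_atTop_zero (𝕜 := ℝ)).add_const 1
      have := this.rpow_const (p := a) (Or.inr ha.le)
      simpa using this
    simpa using h2.sub (tendsto_rpow_neg_atTop ha)
  have h3 := (h1.pow 2).const_mul (1 / (2 * a))
  simp only [one_pow, mul_one] at h3
  refine h3.congr' ?_
  filter_upwards [Filter.eventually_gt_atTop 0] with s hs
  have e : (s⁻¹ + 1) ^ a = s ^ (-a) * (1 + s) ^ a := by
    rw [Real.rpow_neg hs.le, ← Real.inv_rpow hs.le, ← Real.mul_rpow (by positivity) (by positivity)]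
    congr 1; field_simp
  have e2 : s ^ (-(2 * a)) = (s ^ (-a)) ^ 2 := by
    rw [← Real.rpow_natCast, ← Real.rpow_mul hs.le]; congr 1; push_cast; ring
  rw [e, e2]; ring

theorem integral_halfLine_diff_le {a : ℝ} (ha : 0 < a) (ha1 : a < 1) {η : ℝ} (hη : 0 < η) :
    IntegrableOn (fun s : ℝ => ((1 + s) ^ a - 1) * (1 - (1 + s) ^ (a - 1)) * s ^ (-(2 * a) - 1))
      (Set.Ioi η) ∧
    ∫ s in Set.Ioi η, ((1 + s) ^ a - 1) * (1 - (1 + s) ^ (a - 1)) * s ^ (-(2 * a) - 1)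
      ≤ 1 / (2 * a) := by
  have hd : ∀ x ∈ Set.Ici η, _ := fun x hx => hasDerivAt_halfLine_primitive ha (lt_of_lt_of_le hη hx)
  have hn : ∀ x ∈ Set.Ioi η, _ := fun x hx => halfLine_diff_nonneg ha ha1 (lt_trans hη hx)
  refine ⟨integrableOn_Ioi_deriv_of_nonneg' hd hn (tendsto_halfLine_primitive ha), ?_⟩
  rw [integral_Ioi_of_hasDerivAt_of_nonneg' hd hn (tendsto_halfLine_primitive ha)]
  have : 0 ≤ 1 / (2 * a) * (η ^ (-(2 * a)) * ((1 + η) ^ a - 1) ^ 2) := by positivity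
  linarith

theorem integrableOn_ray_right {a : ℝ} (ha : 0 < a) (ha1 : a < 1) {η : ℝ} (hη : 0 < η) :
    IntegrableOn (fun t : ℝ => ((1 + t) ^ a - 1) * t ^ (-(2 * a) - 1)) (Set.Ioi η) := by
  refine Integrable.mono' (integrableOn_Ioi_rpow_of_lt (a := -a - 1) (by linarith) hη)
    (by fun_prop) ?_
  filter_upwards [ae_restrict_mem measurableSet_Ioi] with t ht
  have ht0 : 0 < t := lt_trans hη ht
  have h1 : 1 ≤ (1 + t) ^ a := Real.one_le_rpow (by linarith) ha.le
  have h2 : (1 + t) ^ a ≤ 1 + t ^ a := by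
    have := Real.rpow_add_le_add_rpow (zero_le_one) ht0.le ha.le ha1.le
    simpa using this
  have h3 : 0 < t ^ (-(2 * a) - 1) := Real.rpow_pos_of_pos ht0 _
  rw [Real.norm_eq_abs, abs_of_nonneg (mul_nonneg (by linarith) h3.le)]
  calc _ ≤ t ^ a * t ^ (-(2 * a) - 1) := by gcongr; linarith
    _ = t ^ (-a - 1) := by rw [← Real.rpow_add ht0]; ring_nf

theorem integrableOn_ray_left {a : ℝ} (ha : 0 < a) {η : ℝ} (hη : 0 < η) :
    IntegrableOn (fun t : ℝ => (max (1 - t) 0 ^ a - 1) * t ^ (-(2 * a) - 1)) (Set.Ioi η) := by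
  refine Integrable.mono' (integrableOn_Ioi_rpow_of_lt (a := -(2 * a) - 1) (by linarith) hη)
    (by fun_prop) ?_
  filter_upwards [ae_restrict_mem measurableSet_Ioi] with t ht
  have ht0 : 0 < t := lt_trans hη ht
  have h1 : max (1 - t) 0 ^ a ≤ 1 :=
    Real.rpow_le_one (le_max_right _ _) (max_le (by linarith) zero_le_one) ha.le
  have h2 : 0 ≤ max (1 - t) 0 ^ a := by positivity
  have h3 : 0 < t ^ (-(2 * a) - 1) := Real.rpow_pos_of_pos ht0 _
  rw [Real.norm_eq_abs, abs_mul, abs_of_pos h3, abs_of_nonpos (by linarith)]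
  nlinarith

theorem image_div_one_add_Ioi {η : ℝ} (hη : 0 < η) (hη1 : η < 1) :
    (fun s : ℝ => s / (1 + s)) '' Set.Ioi (η / (1 - η)) = Set.Ioo η 1 := by
  have h0 : 0 < 1 - η := by linarith
  ext t
  simp only [Set.mem_image, Set.mem_Ioi, Set.mem_Ioo]
  constructor
  · rintro ⟨s, hs, rfl⟩
    have hs0 : 0 < s := lt_trans (by positivity) hs
    rw [div_lt_iff₀ h0] at hs
    constructor
    · rw [lt_div_iff₀ (by linarith)]; linarith
    · rw [div_lt_one (by linarith)]; linarith
  · rintro ⟨h1, h2⟩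
    have h3 : 0 < 1 - t := by linarith
    refine ⟨t / (1 - t), ?_, ?_⟩
    · gcongr
      linarith
    · field_simp; ring

theorem integral_ray_left_near {a η : ℝ} (hη : 0 < η) (hη1 : η < 1) :
    ∫ t in Set.Ioo η 1, (max (1 - t) 0 ^ a - 1) * t ^ (-(2 * a) - 1) =
    ∫ s in Set.Ioi (η / (1 - η)),
      ((1 + s) ^ (-a) - 1) * (1 + s) ^ (2 * a - 1) * s ^ (-(2 * a) - 1) := by
  have h0 : 0 < 1 - η := by linarith
  rw [← image_div_one_add_Ioi hη hη1]
  have hder : ∀ s ∈ Set.Ioi (η / (1 - η)), HasDerivWithinAt (fun s : ℝ => s / (1 + s))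
      (((1 + s) ^ 2)⁻¹) (Set.Ioi (η / (1 - η))) s := by
    intro s hs
    have hs0 : 0 < s := lt_trans (by positivity) hs
    have := (hasDerivAt_id s).div ((hasDerivAt_id s).const_add 1) (by simp; linarith)
    refine (this.congr_deriv ?_).hasDerivWithinAt
    simp
  have hinj : Set.InjOn (fun s : ℝ => s / (1 + s)) (Set.Ioi (η / (1 - η))) := by
    intro x hx y hy hxy
    have hx0 : 0 < x := lt_trans (by positivity) hx
    have hy0 : 0 < y := lt_trans (by positivity) hy
    simp only at hxy
    rw [div_eq_div_iff (by linarith) (by linarith)] at hxy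
    linarith
  rw [integral_image_eq_integral_abs_deriv_smul measurableSet_Ioi hder hinj]
  refine setIntegral_congr_fun measurableSet_Ioi fun s hs => ?_
  have hs0 : 0 < s := lt_trans (by positivity) hs
  have h1 : 0 < 1 + s := by linarith
  have e1 : max (1 - s / (1 + s)) 0 = (1 + s)⁻¹ := by
    rw [max_eq_left]
    · field_simp; ring
    · rw [sub_nonneg, div_le_one h1]; linarith
  simp only [smul_eq_mul]
  rw [e1, abs_of_pos (by positivity), Real.inv_rpow h1.le, ← Real.rpow_neg h1.le,
    Real.div_rpow hs0.le h1.le]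
  have e2 : (1 + s) ^ (2 * a - 1) = (((1 + s) ^ 2)⁻¹) / (1 + s) ^ (-(2 * a) - 1) := by
    rw [eq_div_iff (by positivity), ← Real.rpow_add h1, ← Real.rpow_natCast, ← Real.rpow_neg h1.le]
    congr 1; push_cast; ring
  rw [e2]; ring

theorem integral_ray_le {a : ℝ} (ha : 0 < a) (ha1 : a < 1) {η : ℝ} (hη : 0 < η) (hη1 : η ≤ 1 / 2) :
    IntegrableOn (fun t : ℝ => ((1 + t) ^ a + max (1 - t) 0 ^ a - 2) * t ^ (-(2 * a) - 1))
      (Set.Ioi η) ∧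
    ∫ t in Set.Ioi η, ((1 + t) ^ a + max (1 - t) 0 ^ a - 2) * t ^ (-(2 * a) - 1)
      ≤ 2 * η ^ (2 - 2 * a) := by
  set η' := η / (1 - η) with hη'
  have h0 : 0 < 1 - η := by linarith
  have hη'0 : 0 < η' := by positivity
  have hle : η ≤ η' := by rw [hη', le_div_iff₀ h0]; nlinarith
  have i1 := integrableOn_ray_right ha ha1 hη
  have i1' := integrableOn_ray_right ha ha1 hη'0
  have i2 := integrableOn_ray_left ha hη
  obtain ⟨i3, h3⟩ := integral_halfLine_diff_le ha ha1 hη'0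
  have hsplit : ∀ t : ℝ, ((1 + t) ^ a + max (1 - t) 0 ^ a - 2) * t ^ (-(2 * a) - 1) =
      ((1 + t) ^ a - 1) * t ^ (-(2 * a) - 1) + (max (1 - t) 0 ^ a - 1) * t ^ (-(2 * a) - 1) := by
    intro t; ring
  simp only [hsplit]
  refine ⟨i1.add i2, ?_⟩
  rw [integral_add i1 i2]
  have s1 : ∫ t in Set.Ioi η, ((1 + t) ^ a - 1) * t ^ (-(2 * a) - 1) =
      (∫ t in Set.Ioc η η', ((1 + t) ^ a - 1) * t ^ (-(2 * a) - 1)) +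
      ∫ t in Set.Ioi η', ((1 + t) ^ a - 1) * t ^ (-(2 * a) - 1) := by
    rw [← setIntegral_union (Set.Ioc_disjoint_Ioi le_rfl) measurableSet_Ioi
      (i1.mono_set Set.Ioc_subset_Ioi_self) i1', Set.Ioc_union_Ioi_eq_Ioi hle]
  have s2 : ∫ t in Set.Ioi η, (max (1 - t) 0 ^ a - 1) * t ^ (-(2 * a) - 1) =
      (∫ t in Set.Ioo η 1, (max (1 - t) 0 ^ a - 1) * t ^ (-(2 * a) - 1)) +
      ∫ t in Set.Ici 1, (max (1 - t) 0 ^ a - 1) * t ^ (-(2 * a) - 1) := by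
    rw [← setIntegral_union _ measurableSet_Ici
      (i2.mono_set Set.Ioo_subset_Ioi_self)
      (i2.mono_set fun t ht => lt_of_lt_of_le (by linarith) (Set.mem_Ici.1 ht)),
      Set.Ioo_union_Ici_eq_Ioi (by linarith)]
    exact Set.disjoint_left.2 fun t h1 h2 => not_lt.2 (Set.mem_Ici.1 h2) h1.2
  have s3 : ∫ t in Set.Ici (1 : ℝ), (max (1 - t) 0 ^ a - 1) * t ^ (-(2 * a) - 1) = -(1 / (2 * a)) := by
    rw [setIntegral_congr_fun (g := fun t : ℝ => -(t ^ (-(2 * a) - 1))) measurableSet_Ici,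
      integral_neg, integral_Ici_eq_integral_Ioi, integral_Ioi_rpow_of_lt (by linarith) one_pos]
    · simp
    · intro t ht
      have : max (1 - t) 0 = 0 := max_eq_right (by linarith [Set.mem_Ici.1 ht])
      simp only [this, Real.zero_rpow ha.ne']; ring
  have hF : ∀ s ∈ Set.Ioi η', ((1 + s) ^ (-a) - 1) * (1 + s) ^ (2 * a - 1) * s ^ (-(2 * a) - 1) =
      ((1 + s) ^ a - 1) * (1 - (1 + s) ^ (a - 1)) * s ^ (-(2 * a) - 1) -
      ((1 + s) ^ a - 1) * s ^ (-(2 * a) - 1) := by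
    intro s hs
    have h1 : 0 < 1 + s := by linarith [lt_trans hη'0 (Set.mem_Ioi.1 hs)]
    have e1 : (1 + s) ^ (-a) * (1 + s) ^ (2 * a - 1) = (1 + s) ^ (a - 1) := by
      rw [← Real.rpow_add h1]; ring_nf
    have e2 : (1 + s) ^ a * (1 + s) ^ (a - 1) = (1 + s) ^ (2 * a - 1) := by
      rw [← Real.rpow_add h1]; ring_nf
    rw [sub_mul, e1, ← e2]; ring
  have s4 := integral_ray_left_near (a := a) hη (by linarith : η < 1)
  rw [setIntegral_congr_fun measurableSet_Ioi hF, integral_sub i3 i1'] at s4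
  have s5 : ∫ t in Set.Ioc η η', ((1 + t) ^ a - 1) * t ^ (-(2 * a) - 1) ≤ 2 * η ^ (2 - 2 * a) := by
    have hb : ∀ t ∈ Set.Ioc η η', ((1 + t) ^ a - 1) * t ^ (-(2 * a) - 1) ≤ η ^ (-(2 * a)) := by
      intro t ht
      have ht0 : 0 < t := lt_trans hη ht.1
      have h1 : (1 + t) ^ a ≤ 1 + t := by
        have := Real.rpow_le_rpow_of_exponent_le (by linarith : 1 ≤ 1 + t) ha1.le
        simpa using this
      calc _ ≤ t * t ^ (-(2 * a) - 1) := by gcongr; linarith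
        _ = t ^ (-(2 * a)) := by rw [mul_comm, ← Real.rpow_add_one ht0.ne']; ring_nf
        _ ≤ _ := Real.rpow_le_rpow_of_nonpos hη ht.1.le (by linarith)
    calc _ ≤ ∫ t in Set.Ioc η η', η ^ (-(2 * a)) :=
          setIntegral_mono_on (i1.mono_set Set.Ioc_subset_Ioi_self) (by simp) measurableSet_Ioc hb
      _ = (η' - η) * η ^ (-(2 * a)) := by simp [Measure.real, hle]
      _ ≤ (2 * η ^ 2) * η ^ (-(2 * a)) := by
          gcongr
          rw [hη', sub_le_iff_le_add, div_le_iff₀ h0]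
          nlinarith [sq_nonneg η]
      _ = 2 * η ^ (2 - 2 * a) := by
          rw [sub_eq_add_neg, Real.rpow_add hη]; norm_num; ring
  rw [s1, s2, s3, s4]
  linarith

theorem integral_ray_scaled_le {a : ℝ} (ha : 0 < a) (ha1 : a < 1) {p k η : ℝ} (hp : 0 < p)
    (hη : 0 < η) (hk : |k| * η ≤ p / 2) :
    IntegrableOn (fun t : ℝ => (max (p + t * k) 0 ^ a + max (p - t * k) 0 ^ a - 2 * p ^ a) *
      t ^ (-(2 * a) - 1)) (Set.Ioi η) ∧
    ∫ t in Set.Ioi η, (max (p + t * k) 0 ^ a + max (p - t * k) 0 ^ a - 2 * p ^ a) *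
      t ^ (-(2 * a) - 1) ≤ 2 * p ^ (a - 2) * k ^ 2 * η ^ (2 - 2 * a) := by
  wlog hk0 : 0 ≤ k generalizing k
  · have := this (k := -k) (by rwa [abs_neg]) (by linarith)
    simp only [mul_neg, sub_neg_eq_add, ← sub_eq_add_neg, neg_sq] at this
    have e : ∀ t : ℝ, max (p + t * k) 0 ^ a + max (p - t * k) 0 ^ a =
      max (p - t * k) 0 ^ a + max (p + t * k) 0 ^ a := fun t => add_comm _ _
    simp only [e]
    exact this
  rcases hk0.eq_or_lt with rfl | hk0
  · have : ∀ t : ℝ, (max (p + t * 0) 0 ^ a + max (p - t * 0) 0 ^ a - 2 * p ^ a) *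
      t ^ (-(2 * a) - 1) = 0 := by intro t; simp [hp.le]; left; ring
    simp only [this]
    simp
  rw [abs_of_pos hk0] at hk
  set m := k / p with hm
  have hm0 : 0 < m := by positivity
  have hmη : m * η ≤ 1 / 2 := by rw [hm, div_mul_eq_mul_div, div_le_iff₀ hp]; linarith
  obtain ⟨i, h⟩ := integral_ray_le ha ha1 (mul_pos hm0 hη) hmη
  have e : ∀ t ∈ Set.Ioi η, (max (p + t * k) 0 ^ a + max (p - t * k) 0 ^ a - 2 * p ^ a) *
      t ^ (-(2 * a) - 1) = (p ^ a * m ^ (2 * a + 1)) *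
      (((1 + m * t) ^ a + max (1 - m * t) 0 ^ a - 2) * (m * t) ^ (-(2 * a) - 1)) := by
    intro t ht
    have ht0 : 0 < t := lt_trans hη ht
    have e1 : max (p + t * k) 0 = p * (1 + m * t) := by
      rw [max_eq_left (by positivity), hm]; field_simp
    have e2 : max (p - t * k) 0 = p * max (1 - m * t) 0 := by
      rw [mul_max_of_nonneg _ _ hp.le, hm]; congr 1
      · field_simp
      · simp
    rw [e1, e2, Real.mul_rpow hp.le (by positivity), Real.mul_rpow hp.le (by positivity),
      Real.mul_rpow hm0.le ht0.le]
    have e3 : m ^ (2 * a + 1) * m ^ (-(2 * a) - 1) = 1 := by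
      rw [← Real.rpow_add hm0]; ring_nf; simp
    linear_combination (-(p ^ a * ((1 + m * t) ^ a + max (1 - m * t) 0 ^ a - 2) *
      t ^ (-(2 * a) - 1))) * e3
  have i' := (integrableOn_Ioi_comp_mul_left_iff _ η hm0).2 i
  refine ⟨(integrableOn_congr_fun e measurableSet_Ioi).2 (i'.const_mul _), ?_⟩
  rw [setIntegral_congr_fun measurableSet_Ioi e, integral_const_mul,
    integral_comp_mul_left_Ioi (fun s => ((1 + s) ^ a + max (1 - s) 0 ^ a - 2) *
      s ^ (-(2 * a) - 1)) η hm0, smul_eq_mul]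
  calc _ ≤ p ^ a * m ^ (2 * a + 1) * (m⁻¹ * (2 * (m * η) ^ (2 - 2 * a))) := by gcongr
    _ = _ := by
      rw [Real.mul_rpow hm0.le hη.le, Real.rpow_add_one hm0.ne']
      have e1 : m ^ (2 * a) * m ^ (2 - 2 * a) = m ^ 2 := by
        rw [← Real.rpow_add hm0]; norm_num
      have e2 : p ^ (a - 2) = p ^ a / p ^ 2 := by
        rw [Real.rpow_sub hp]; norm_num
      rw [e2]
      calc _ = 2 * p ^ a * η ^ (2 - 2 * a) * (m * m⁻¹) * (m ^ (2 * a) * m ^ (2 - 2 * a)) := by ring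
        _ = _ := by rw [e1, mul_inv_cancel₀ hm0.ne', hm]; field_simp

/-- The surface area of the unit sphere of `ℝ^d`. -/
noncomputable def sphereArea (d : ℕ) : ℝ :=
  d * volume.real (ball (0 : EuclideanSpace ℝ (Fin d)) 1)

theorem sphereArea_pos (d : ℕ) [NeZero d] : 0 < sphereArea d := by
  have h : 0 < volume.real (ball (0 : EuclideanSpace ℝ (Fin d)) 1) :=
    ENNReal.toReal_pos (measure_ball_pos _ _ one_pos).ne' measure_ball_lt_top.ne
  have h2 : (0 : ℝ) < d := Nat.cast_pos.2 (NeZero.pos d)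
  exact mul_pos h2 h

theorem integral_polar {d : ℕ} [NeZero d] {f : EuclideanSpace ℝ (Fin d) → ℝ} (hf : Integrable f) :
    ∫ y, f y = ∫ θ : sphere (0 : EuclideanSpace ℝ (Fin d)) 1,
      (∫ t in Set.Ioi (0 : ℝ), t ^ (d - 1) * f (t • (θ : EuclideanSpace ℝ (Fin d))))
        ∂(volume : Measure (EuclideanSpace ℝ (Fin d))).toSphere := by
  set μ : Measure (EuclideanSpace ℝ (Fin d)) := volume
  have hmp := μ.measurePreserving_homeomorphUnitSphereProd
  have hemb := Homeomorph.measurableEmbedding (homeomorphUnitSphereProd (EuclideanSpace ℝ (Fin d)))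
  let g : sphere (0 : EuclideanSpace ℝ (Fin d)) 1 × Set.Ioi (0 : ℝ) → ℝ := fun x => f (x.2.1 • x.1.1)
  have hg : ∀ y : ({0}ᶜ : Set (EuclideanSpace ℝ (Fin d))),
      g (homeomorphUnitSphereProd _ y) = f y := by
    intro y
    have hy : ‖(y : EuclideanSpace ℝ (Fin d))‖ ≠ 0 := norm_ne_zero_iff.2 y.2
    simp [g, smul_smul, hy]
  have hint : Integrable g (μ.toSphere.prod (Measure.volumeIoiPow (d - 1))) := by
    have h1 := hmp.integrable_comp_emb (g := g) hemb
    have hfin : Module.finrank ℝ (EuclideanSpace ℝ (Fin d)) = d := by simp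
    rw [hfin] at h1
    rw [← h1]
    have h2 : (g ∘ (homeomorphUnitSphereProd (EuclideanSpace ℝ (Fin d)))) =
        f ∘ Subtype.val := by
      ext y; exact hg y
    rw [h2]
    exact (integrableOn_iff_comap_subtypeVal (measurableSet_singleton 0).compl).1 hf.integrableOn
  calc ∫ y, f y ∂μ = ∫ y : ({0}ᶜ : Set (EuclideanSpace ℝ (Fin d))), f y ∂(μ.comap (↑)) := by
        rw [integral_subtype_comap (measurableSet_singleton _).compl f, restrict_compl_singleton]
    _ = ∫ x, g x ∂μ.toSphere.prod (.volumeIoiPow (d - 1)) := by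
        have h1 := hmp.integral_comp hemb g
        simp only [hg] at h1
        rw [h1]; simp
    _ = ∫ θ, ∫ t, g (θ, t) ∂(.volumeIoiPow (d - 1)) ∂μ.toSphere := integral_prod _ hint
    _ = _ := by
        refine integral_congr_ae (Filter.Eventually.of_forall fun θ => ?_)
        simp only [Measure.volumeIoiPow, ENNReal.ofReal]
        rw [integral_withDensity_eq_integral_smul,
          integral_subtype_comap measurableSet_Ioi
            fun t => Real.toNNReal (t ^ (d - 1)) • f (t • (θ : EuclideanSpace ℝ (Fin d))),
          setIntegral_congr_fun measurableSet_Ioi fun x hx => ?_]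
        · rw [NNReal.smul_def, Real.coe_toNNReal _ (pow_nonneg hx.out.le _), smul_eq_mul]
        · exact (measurable_subtype_coe.pow_const _).real_toNNReal

theorem radial_integral {d : ℕ} [NeZero d] (f : ℝ → ℝ) {S : Set ℝ} (hS : MeasurableSet S)
    (hS0 : S ⊆ Set.Ioi 0) :
    (IntegrableOn (fun z : EuclideanSpace ℝ (Fin d) => ‖z‖ ^ (-(d : ℝ)) * f ‖z‖) {z | ‖z‖ ∈ S} ↔
      IntegrableOn (fun t => t⁻¹ * f t) S) ∧
    ∫ z in {z : EuclideanSpace ℝ (Fin d) | ‖z‖ ∈ S}, ‖z‖ ^ (-(d : ℝ)) * f ‖z‖ =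
      sphereArea d * ∫ t in S, t⁻¹ * f t := by
  have hmeas : MeasurableSet {z : EuclideanSpace ℝ (Fin d) | ‖z‖ ∈ S} := measurable_norm hS
  let F : ℝ → ℝ := S.indicator fun t => t ^ (-(d : ℝ)) * f t
  have hF : ({z : EuclideanSpace ℝ (Fin d) | ‖z‖ ∈ S}.indicator
      fun z => ‖z‖ ^ (-(d : ℝ)) * f ‖z‖) = fun z => F ‖z‖ := by
    ext z
    by_cases hz : ‖z‖ ∈ S <;> simp [F, Set.indicator, hz]
  have hd : d ≠ 0 := NeZero.ne d
  have hG : ∀ t, t ^ (d - 1) * F t = S.indicator (fun t => t⁻¹ * f t) t := by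
    intro t
    by_cases ht : t ∈ S
    · have ht0 : 0 < t := hS0 ht
      simp only [F, Set.indicator_of_mem ht]
      rw [← mul_assoc, ← Real.rpow_natCast, ← Real.rpow_add ht0, Nat.cast_sub (NeZero.one_le)]
      congr 1
      rw [← Real.rpow_neg_one]; congr 1; push_cast; ring
    · simp [F, ht]
  have hfin : Module.finrank ℝ (EuclideanSpace ℝ (Fin d)) = d := by simp
  constructor
  · rw [← integrable_indicator_iff hmeas, hF, integrable_fun_norm_addHaar, hfin]
    simp only [smul_eq_mul, hG]
    rw [integrableOn_indicator_iff hS, Set.inter_eq_self_of_subset_left hS0]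
  · rw [← integral_indicator hmeas, hF, integral_fun_norm_addHaar, hfin]
    simp only [smul_eq_mul, hG, nsmul_eq_mul]
    rw [setIntegral_indicator hS, Set.inter_eq_self_of_subset_right hS0, sphereArea, mul_assoc]

theorem radial_integral_far {d : ℕ} [NeZero d] {q η : ℝ} (hq : 0 < q) (hη : 0 < η) :
    IntegrableOn (fun z : EuclideanSpace ℝ (Fin d) => ‖z‖ ^ (-(d : ℝ) - q)) {z | η ≤ ‖z‖} ∧
    ∫ z in {z : EuclideanSpace ℝ (Fin d) | η ≤ ‖z‖}, ‖z‖ ^ (-(d : ℝ) - q) =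
      sphereArea d * (η ^ (-q) / q) := by
  have hm : MeasurableSet {z : EuclideanSpace ℝ (Fin d) | η ≤ ‖z‖} :=
    measurableSet_le measurable_const measurable_norm
  have h := radial_integral (d := d) (fun t => t ^ (-q)) (S := Set.Ici η) measurableSet_Ici
    (fun t ht => lt_of_lt_of_le hη ht)
  have e : ∀ z ∈ {z : EuclideanSpace ℝ (Fin d) | η ≤ ‖z‖},
      ‖z‖ ^ (-(d : ℝ) - q) = ‖z‖ ^ (-(d : ℝ)) * ‖z‖ ^ (-q) := by
    intro z hz
    rw [← Real.rpow_add (lt_of_lt_of_le hη hz), sub_eq_add_neg]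
  have e2 : ∀ t ∈ Set.Ici η, t⁻¹ * t ^ (-q) = t ^ (-q - 1) := by
    intro t ht
    have ht0 : 0 < t := lt_of_lt_of_le hη ht
    rw [Real.rpow_sub_one ht0.ne']; field_simp
  rw [integrableOn_congr_fun e hm, setIntegral_congr_fun hm e]
  simp only [Set.mem_Ici] at h
  rw [h.1, h.2, setIntegral_congr_fun measurableSet_Ici e2, integrableOn_congr_fun e2
    measurableSet_Ici, integrableOn_Ici_iff_integrableOn_Ioi, integral_Ici_eq_integral_Ioi]
  refine ⟨integrableOn_Ioi_rpow_of_lt (by linarith) hη, ?_⟩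
  rw [integral_Ioi_rpow_of_lt (by linarith) hη]
  congr 1
  have : -q - 1 + 1 = -q := by ring
  rw [this]; field_simp

theorem radial_integral_near {d : ℕ} [NeZero d] {q η : ℝ} (hq : 0 < q) (hη : 0 < η) :
    IntegrableOn (fun z : EuclideanSpace ℝ (Fin d) => ‖z‖ ^ (-(d : ℝ) + q))
      {z | ‖z‖ ∈ Set.Ioo 0 η} ∧
    ∫ z in {z : EuclideanSpace ℝ (Fin d) | ‖z‖ ∈ Set.Ioo 0 η}, ‖z‖ ^ (-(d : ℝ) + q) =
      sphereArea d * (η ^ q / q) := by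
  have hm : MeasurableSet {z : EuclideanSpace ℝ (Fin d) | ‖z‖ ∈ Set.Ioo 0 η} :=
    measurable_norm measurableSet_Ioo
  have h := radial_integral (d := d) (fun t => t ^ q) (S := Set.Ioo 0 η) measurableSet_Ioo
    (fun t ht => ht.1)
  have e : ∀ z ∈ {z : EuclideanSpace ℝ (Fin d) | ‖z‖ ∈ Set.Ioo 0 η},
      ‖z‖ ^ (-(d : ℝ) + q) = ‖z‖ ^ (-(d : ℝ)) * ‖z‖ ^ q := by
    intro z hz
    rw [← Real.rpow_add hz.1]
  have e2 : ∀ t ∈ Set.Ioo 0 η, t⁻¹ * t ^ q = t ^ (q - 1) := by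
    intro t ht
    rw [Real.rpow_sub_one ht.1.ne']; field_simp
  rw [integrableOn_congr_fun e hm, setIntegral_congr_fun hm e, h.1, h.2,
    setIntegral_congr_fun measurableSet_Ioo e2, integrableOn_congr_fun e2 measurableSet_Ioo]
  constructor
  · rw [← integrableOn_Ioc_iff_integrableOn_Ioo, ← intervalIntegrable_iff_integrableOn_Ioc_of_le hη.le]
    exact intervalIntegral.intervalIntegrable_rpow' (by linarith)
  · rw [← integral_Ioc_eq_integral_Ioo, ← intervalIntegral.integral_of_le hη.le,
      integral_rpow (Or.inl (by linarith))]
    congr 1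
    simp [Real.zero_rpow hq.ne']

theorem integral_beta_kernel {a : ℝ} (ha : 0 < a) (ha1 : a < 1) :
    IntegrableOn (fun u : ℝ => u ^ (a - 1) * (1 - u) ^ (-a)) (Set.Ioo 0 1) ∧
    ∫ u in Set.Ioo (0 : ℝ) 1, u ^ (a - 1) * (1 - u) ^ (-a) = Real.pi / Real.sin (Real.pi * a) := by
  have hb : 0 < ProbabilityTheory.beta a (1 - a) := ProbabilityTheory.beta_pos ha (by linarith)
  have hbv : ProbabilityTheory.beta a (1 - a) = Real.pi / Real.sin (Real.pi * a) := by
    rw [ProbabilityTheory.beta, Real.Gamma_mul_Gamma_one_sub]; simp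
  have h1 := ProbabilityTheory.lintegral_betaPDF_eq_one ha (sub_pos.2 ha1)
  rw [ProbabilityTheory.lintegral_betaPDF] at h1
  set f : ℝ → ℝ := fun x => 1 / ProbabilityTheory.beta a (1 - a) * x ^ (a - 1) *
    (1 - x) ^ (1 - a - 1) with hf
  have hfm : Measurable f := by fun_prop
  have hf0 : 0 ≤ᵐ[volume.restrict (Set.Ioo (0 : ℝ) 1)] f := by
    filter_upwards [ae_restrict_mem measurableSet_Ioo] with x hx
    have := hx.1; have : 0 < 1 - x := by linarith [hx.2]
    simp only [hf, Pi.zero_apply]; positivity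
  have hfi : IntegrableOn f (Set.Ioo 0 1) := by
    refine ⟨hfm.aestronglyMeasurable, ?_⟩
    rw [hasFiniteIntegral_iff_ofReal hf0, h1]; exact ENNReal.one_lt_top
  have hfe : ∫ x in Set.Ioo (0 : ℝ) 1, f x = 1 := by
    rw [integral_eq_lintegral_of_nonneg_ae hf0 hfm.aestronglyMeasurable, h1]; simp
  have he : (fun u : ℝ => u ^ (a - 1) * (1 - u) ^ (-a)) =
      fun u => ProbabilityTheory.beta a (1 - a) * f u := by
    ext u
    have : 1 - a - 1 = -a := by ring
    simp only [hf, this]; field_simp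
  rw [he]
  refine ⟨hfi.const_mul _, ?_⟩
  rw [integral_const_mul, hfe, mul_one, hbv]

theorem image_mul_rpow_neg_half {ρ : ℝ} (hρ : 0 < ρ) :
    (fun u : ℝ => ρ * u ^ (-(1 / 2) : ℝ)) '' Set.Ioo 0 1 = Set.Ioi ρ := by
  ext t
  simp only [Set.mem_image, Set.mem_Ioo, Set.mem_Ioi]
  constructor
  · rintro ⟨u, ⟨h0, h1⟩, rfl⟩
    have := Real.one_lt_rpow_of_pos_of_lt_one_of_neg h0 h1 (z := (-(1 / 2) : ℝ)) (by norm_num)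
    nlinarith
  · intro ht
    have ht0 : 0 < t := hρ.trans ht
    refine ⟨(t / ρ) ^ (-2 : ℝ), ⟨by positivity, ?_⟩, ?_⟩
    · exact Real.rpow_lt_one_of_one_lt_of_neg ((one_lt_div hρ).2 ht) (by norm_num)
    · rw [← Real.rpow_mul (by positivity)]; norm_num; field_simp

theorem integral_poisson_radial {a : ℝ} (ha : 0 < a) (ha1 : a < 1) {ρ : ℝ} (hρ : 0 < ρ) :
    IntegrableOn (fun t : ℝ => t⁻¹ * (t ^ 2 - ρ ^ 2) ^ (-a)) (Set.Ioi ρ) ∧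
    ∫ t in Set.Ioi ρ, t⁻¹ * (t ^ 2 - ρ ^ 2) ^ (-a) =
      ρ ^ (-(2 * a)) / 2 * (Real.pi / Real.sin (Real.pi * a)) := by
  have hder : ∀ u ∈ Set.Ioo (0 : ℝ) 1, HasDerivWithinAt (fun u : ℝ => ρ * u ^ (-(1 / 2) : ℝ))
      (ρ * (-(1 / 2) * u ^ (-(1 / 2) - 1 : ℝ))) (Set.Ioo 0 1) u := fun u hu =>
    ((Real.hasDerivAt_rpow_const (Or.inl hu.1.ne')).const_mul ρ).hasDerivWithinAt
  have hinj : Set.InjOn (fun u : ℝ => ρ * u ^ (-(1 / 2) : ℝ)) (Set.Ioo 0 1) := by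
    intro u hu v hv h
    have h := mul_left_cancel₀ hρ.ne' h
    exact (Real.rpow_left_inj hu.1.le hv.1.le (by norm_num)).1 h
  have he : Set.EqOn (fun u : ℝ => |ρ * (-(1 / 2) * u ^ (-(1 / 2) - 1 : ℝ))| •
      ((ρ * u ^ (-(1 / 2) : ℝ))⁻¹ * ((ρ * u ^ (-(1 / 2) : ℝ)) ^ 2 - ρ ^ 2) ^ (-a)))
      (fun u => ρ ^ (-(2 * a)) / 2 * (u ^ (a - 1) * (1 - u) ^ (-a))) (Set.Ioo 0 1) := by
    intro u hu
    have h0 := hu.1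
    have h1 : 0 < 1 - u := by linarith [hu.2]
    have e1 : |ρ * (-(1 / 2) * u ^ (-(1 / 2) - 1 : ℝ))| = ρ / 2 * u ^ (-(1 / 2) - 1 : ℝ) := by
      rw [abs_mul, abs_mul, abs_of_pos hρ, abs_of_pos (Real.rpow_pos_of_pos h0 _)]; norm_num; ring
    have e2 : (ρ * u ^ (-(1 / 2) : ℝ)) ^ 2 - ρ ^ 2 = ρ ^ 2 * ((1 - u) * u⁻¹) := by
      rw [mul_pow, ← Real.rpow_mul_natCast h0.le]
      norm_num [Real.rpow_neg_one]; field_simp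
    simp only [smul_eq_mul]
    rw [e1, e2, Real.mul_rpow (by positivity) (by positivity), Real.mul_rpow h1.le (by positivity),
      Real.rpow_sub_one h0.ne', Real.rpow_sub_one h0.ne', Real.inv_rpow h0.le, Real.rpow_neg h0.le a,
      ← Real.rpow_natCast ρ 2, ← Real.rpow_mul hρ.le]
    have : ((2 : ℕ) : ℝ) * -a = -(2 * a) := by push_cast; ring
    rw [this]; field_simp
  rw [← image_mul_rpow_neg_half hρ,
    integrableOn_image_iff_integrableOn_abs_deriv_smul measurableSet_Ioo hder hinj,
    integral_image_eq_integral_abs_deriv_smul measurableSet_Ioo hder hinj,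
    integrableOn_congr_fun he measurableSet_Ioo, setIntegral_congr_fun measurableSet_Ioo he,
    integral_const_mul, (integral_beta_kernel ha ha1).2]
  exact ⟨(integral_beta_kernel ha ha1).1.const_mul _, rfl⟩

theorem poisson_normalization {d : ℕ} [NeZero d] {a : ℝ} (ha : 0 < a) (ha1 : a < 1) {ρ : ℝ}
    (hρ : 0 < ρ) :
    IntegrableOn (fun z : EuclideanSpace ℝ (Fin d) =>
      ‖z‖ ^ (-(d : ℝ)) * (‖z‖ ^ 2 - ρ ^ 2) ^ (-a)) {z | ρ < ‖z‖} ∧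
    Real.Gamma ((d : ℝ) / 2) * Real.pi ^ (-(d : ℝ) / 2 - 1) * Real.sin (Real.pi * a) *
      ∫ z in {z : EuclideanSpace ℝ (Fin d) | ρ < ‖z‖},
        ‖z‖ ^ (-(d : ℝ)) * (‖z‖ ^ 2 - ρ ^ 2) ^ (-a) = ρ ^ (-(2 * a)) := by
  have h := radial_integral (d := d) (fun t => (t ^ 2 - ρ ^ 2) ^ (-a)) (S := Set.Ioi ρ)
    measurableSet_Ioi (fun t ht => hρ.trans ht)
  obtain ⟨h1, h2⟩ := integral_poisson_radial ha ha1 hρ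
  simp only [Set.mem_Ioi] at h
  refine ⟨h.1.2 h1, ?_⟩
  rw [h.2, h2]
  have hd : (0 : ℝ) < d := Nat.cast_pos.2 (NeZero.pos d)
  have hs : 0 < Real.sin (Real.pi * a) :=
    Real.sin_pos_of_pos_of_lt_pi (by positivity) (by nlinarith [Real.pi_pos])
  have hG : 0 < Real.Gamma ((d : ℝ) / 2) := Real.Gamma_pos_of_pos (by positivity)
  have hv : volume.real (ball (0 : EuclideanSpace ℝ (Fin d)) 1) =
      Real.pi ^ ((d : ℝ) / 2) / (d / 2 * Real.Gamma ((d : ℝ) / 2)) := by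
    have : Nonempty (Fin d) := ⟨⟨0, NeZero.pos d⟩⟩
    rw [Measure.real, EuclideanSpace.volume_ball, Real.Gamma_add_one (by positivity)]
    simp only [Fintype.card_fin, ENNReal.ofReal_one, one_pow, one_mul]
    rw [ENNReal.toReal_ofReal (by positivity), Real.sqrt_eq_rpow, ← Real.rpow_mul_natCast Real.pi_pos.le]
    congr 2; ring
  have hp : Real.pi ^ (-(d : ℝ) / 2 - 1) = (Real.pi ^ ((d : ℝ) / 2))⁻¹ * Real.pi⁻¹ := by
    rw [Real.rpow_sub_one Real.pi_ne_zero, neg_div, Real.rpow_neg Real.pi_pos.le]; rfl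
  have hpp : 0 < Real.pi ^ ((d : ℝ) / 2) := by positivity
  rw [sphereArea, hv, hp]
  have := Real.pi_pos
  field_simp

theorem integral_sq_sub_rpow {d : ℕ} [NeZero d] {a : ℝ} (ha1 : a < 1) {ρ η : ℝ}
    (hρ : 0 < ρ) (hη : ρ < η) :
    IntegrableOn (fun z : EuclideanSpace ℝ (Fin d) =>
      ‖z‖ ^ (-(d : ℝ)) * (‖z‖ ^ 2 * (‖z‖ ^ 2 - ρ ^ 2) ^ (-a))) {z | ‖z‖ ∈ Set.Ioo ρ η} ∧
    ∫ z in {z : EuclideanSpace ℝ (Fin d) | ‖z‖ ∈ Set.Ioo ρ η},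
      ‖z‖ ^ (-(d : ℝ)) * (‖z‖ ^ 2 * (‖z‖ ^ 2 - ρ ^ 2) ^ (-a)) =
        sphereArea d * ((η ^ 2 - ρ ^ 2) ^ (1 - a) / (2 * (1 - a))) := by
  have h := radial_integral (d := d) (fun t => t ^ 2 * (t ^ 2 - ρ ^ 2) ^ (-a)) (S := Set.Ioo ρ η)
    measurableSet_Ioo (fun t ht => hρ.trans ht.1)
  have e : Set.EqOn (fun t : ℝ => t⁻¹ * (t ^ 2 * (t ^ 2 - ρ ^ 2) ^ (-a)))
      (fun t => t * (t ^ 2 - ρ ^ 2) ^ (-a)) (Set.Ioo ρ η) := by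
    intro t ht
    have : t ≠ 0 := (hρ.trans ht.1).ne'
    simp only; field_simp
  have hc : ContinuousOn (fun t : ℝ => (t ^ 2 - ρ ^ 2) ^ (1 - a) / (2 * (1 - a)))
      (Set.Icc ρ η) := by
    refine ContinuousOn.div_const (ContinuousOn.rpow_const (by fun_prop) fun x hx => ?_) _
    right; linarith
  have hder : ∀ t ∈ Set.Ioo ρ η, HasDerivAt (fun t : ℝ => (t ^ 2 - ρ ^ 2) ^ (1 - a) / (2 * (1 - a)))
      (t * (t ^ 2 - ρ ^ 2) ^ (-a)) t := by
    intro t ht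
    have hp : 0 < t ^ 2 - ρ ^ 2 := by nlinarith [ht.1]
    have h1 := (((hasDerivAt_pow 2 t).sub_const (ρ ^ 2)).rpow_const (p := 1 - a)
      (Or.inl hp.ne')).div_const (2 * (1 - a))
    refine h1.congr_deriv ?_
    have h2 : 1 - a ≠ 0 := by linarith
    have h3 : 1 - a - 1 = -a := by ring
    rw [h3]; field_simp; norm_num; ring
  have hnn : ∀ t ∈ Set.Ioo ρ η, 0 ≤ t * (t ^ 2 - ρ ^ 2) ^ (-a) := by
    intro t ht
    have hp : 0 < t ^ 2 - ρ ^ 2 := by nlinarith [ht.1]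
    have := hρ.trans ht.1
    positivity
  have hi := intervalIntegral.integrableOn_deriv_of_nonneg hc hder hnn
  rw [h.1, h.2, integrableOn_congr_fun e measurableSet_Ioo, setIntegral_congr_fun measurableSet_Ioo e]
  refine ⟨hi.mono_set Set.Ioo_subset_Ioc_self, ?_⟩
  rw [← integral_Ioc_eq_integral_Ioo, ← intervalIntegral.integral_of_le hη.le,
    intervalIntegral.integral_eq_sub_of_hasDerivAt_of_le hη.le hc hder
      ((intervalIntegrable_iff_integrableOn_Ioc_of_le hη.le).2 hi)]
  have h2 : 1 - a ≠ 0 := by linarith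
  simp [Real.zero_rpow h2]

theorem abs_rpow_sub_rpow_le {a : ℝ} (ha : 0 < a) (ha1 : a ≤ 1) {u v : ℝ} (hu : 0 ≤ u) (hv : 0 ≤ v) :
    |u ^ a - v ^ a| ≤ |u - v| ^ a := by
  wlog h : v ≤ u generalizing u v
  · rw [abs_sub_comm, abs_sub_comm u]; exact this hv hu (le_of_not_ge h)
  have h1 := Real.rpow_add_le_add_rpow (sub_nonneg.2 h) hv ha.le ha1
  rw [sub_add_cancel] at h1
  rw [abs_of_nonneg (sub_nonneg.2 (Real.rpow_le_rpow hv h ha.le)), abs_of_nonneg (sub_nonneg.2 h)]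
  linarith

theorem abs_max_rpow_sub_le {a : ℝ} (ha : 0 < a) (ha1 : a ≤ 1) {u v : ℝ} :
    |max u 0 ^ a - max v 0 ^ a| ≤ |u - v| ^ a :=
  (abs_rpow_sub_rpow_le ha ha1 (le_max_right _ _) (le_max_right _ _)).trans
    (Real.rpow_le_rpow (abs_nonneg _) (abs_max_sub_max_le_abs u v 0) ha.le)

theorem measurableSet_le_norm {d : ℕ} {η : ℝ} :
    MeasurableSet {z : EuclideanSpace ℝ (Fin d) | η ≤ ‖z‖} :=
  measurableSet_le measurable_const measurable_norm

theorem integral_halfSpace_le {d : ℕ} [NeZero d] {a : ℝ} (ha : 0 < a) (ha1 : a < 1) {p : ℝ}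
    (hp : 0 < p) (b : EuclideanSpace ℝ (Fin d)) {η : ℝ} (hη : 0 < η) (hb : ‖b‖ * η ≤ p / 2) :
    IntegrableOn (fun z : EuclideanSpace ℝ (Fin d) =>
      (max (p + inner ℝ b z) 0 ^ a - p ^ a) * ‖z‖ ^ (-(d : ℝ) - 2 * a)) {z | η ≤ ‖z‖} ∧
    ∫ z in {z : EuclideanSpace ℝ (Fin d) | η ≤ ‖z‖},
      (max (p + inner ℝ b z) 0 ^ a - p ^ a) * ‖z‖ ^ (-(d : ℝ) - 2 * a) ≤
      p ^ (a - 2) * ‖b‖ ^ 2 * η ^ (2 - 2 * a) *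
        (volume : Measure (EuclideanSpace ℝ (Fin d))).toSphere.real Set.univ := by
  set F : EuclideanSpace ℝ (Fin d) → ℝ := fun z =>
    (max (p + inner ℝ b z) 0 ^ a - p ^ a) * ‖z‖ ^ (-(d : ℝ) - 2 * a) with hF
  set A : Set (EuclideanSpace ℝ (Fin d)) := {z | η ≤ ‖z‖} with hA
  have hAm : MeasurableSet A := measurableSet_le_norm
  have hFi : IntegrableOn F A := by
    refine Integrable.mono' ((radial_integral_far (d := d) ha hη).1.const_mul (‖b‖ ^ a))
      (by fun_prop) ?_
    filter_upwards [ae_restrict_mem hAm] with z hz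
    have hz0 : 0 < ‖z‖ := lt_of_lt_of_le hη hz
    have h1 : |max (p + inner ℝ b z) 0 ^ a - p ^ a| ≤ ‖b‖ ^ a * ‖z‖ ^ a := by
      have h2 := abs_max_rpow_sub_le ha ha1.le (u := p + inner ℝ b z) (v := p)
      rw [max_eq_left hp.le] at h2
      refine h2.trans ?_
      rw [add_sub_cancel_left, ← Real.mul_rpow (norm_nonneg _) (norm_nonneg _)]
      exact Real.rpow_le_rpow (abs_nonneg _) (abs_real_inner_le_norm b z) ha.le
    have h3 : ‖z‖ ^ (-(d : ℝ) - a) = ‖z‖ ^ a * ‖z‖ ^ (-(d : ℝ) - 2 * a) := by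
      rw [← Real.rpow_add hz0]; congr 1; ring
    rw [hF, norm_mul, Real.norm_eq_abs, Real.norm_eq_abs, abs_of_nonneg (Real.rpow_nonneg hz0.le _),
      h3, ← mul_assoc]
    exact mul_le_mul_of_nonneg_right h1 (Real.rpow_nonneg hz0.le _)
  refine ⟨hFi, ?_⟩
  have hind : Integrable (A.indicator F) := (integrable_indicator_iff hAm).2 hFi
  have hneg : ∫ z, A.indicator F (-z) = ∫ z, A.indicator F z :=
    integral_neg_eq_self (A.indicator F) volume
  have hsum : 2 * ∫ z in A, F z = ∫ z, (A.indicator F z + A.indicator F (-z)) := by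
    rw [integral_add hind hind.comp_neg, hneg, integral_indicator hAm]; ring
  have hpol := integral_polar (hind.add hind.comp_neg)
  simp only [Pi.add_apply] at hpol
  rw [hpol] at hsum
  set σ := (volume : Measure (EuclideanSpace ℝ (Fin d))).toSphere
  have hbound : ∀ θ : sphere (0 : EuclideanSpace ℝ (Fin d)) 1,
      (∫ t in Set.Ioi (0 : ℝ), t ^ (d - 1) * (A.indicator F (t • (θ : EuclideanSpace ℝ (Fin d))) +
        A.indicator F (-(t • (θ : EuclideanSpace ℝ (Fin d)))))) ≤ 2 * (p ^ (a - 2) * ‖b‖ ^ 2 * η ^ (2 - 2 * a)) := by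
    intro θ
    have hθ : ‖(θ : EuclideanSpace ℝ (Fin d))‖ = 1 := norm_eq_of_mem_sphere θ
    set k : ℝ := inner ℝ b (θ : EuclideanSpace ℝ (Fin d))
    have hk : |k| ≤ ‖b‖ := by simpa [hθ] using abs_real_inner_le_norm b (θ : EuclideanSpace ℝ (Fin d))
    have e : Set.EqOn (fun t : ℝ => t ^ (d - 1) * (A.indicator F (t • (θ : EuclideanSpace ℝ (Fin d))) +
        A.indicator F (-(t • (θ : EuclideanSpace ℝ (Fin d)))))) ((Set.Ici η).indicator fun t =>
        (max (p + t * k) 0 ^ a + max (p - t * k) 0 ^ a - 2 * p ^ a) * t ^ (-(2 * a) - 1))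
        (Set.Ioi 0) := by
      intro t ht
      have ht0 : 0 < t := ht
      have hn : ‖t • (θ : EuclideanSpace ℝ (Fin d))‖ = t := by
        rw [norm_smul, hθ, mul_one, Real.norm_of_nonneg ht0.le]
      beta_reduce
      by_cases h : η ≤ t
      · have m1 : t • (θ : EuclideanSpace ℝ (Fin d)) ∈ A := by simpa [hA, hn] using h
        have m2 : -(t • (θ : EuclideanSpace ℝ (Fin d))) ∈ A := by simpa only [hA, Set.mem_ofPred_eq, norm_neg, hn] using h
        rw [Set.indicator_of_mem m1, Set.indicator_of_mem m2, Set.indicator_of_mem (Set.mem_Ici.2 h)]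
        simp only [hF, norm_neg, hn, inner_neg_right, inner_smul_right]
        have e3 : t ^ (-(2 * a) - 1) = t ^ (d - 1) * t ^ (-(d : ℝ) - 2 * a) := by
          rw [← Real.rpow_natCast, ← Real.rpow_add ht0, Nat.cast_sub NeZero.one_le]
          congr 1; push_cast; ring
        rw [e3, ← sub_eq_add_neg]; ring
      · have m1 : t • (θ : EuclideanSpace ℝ (Fin d)) ∉ A := by simpa [hA, hn] using h
        have m2 : -(t • (θ : EuclideanSpace ℝ (Fin d))) ∉ A := by simpa only [hA, Set.mem_ofPred_eq, norm_neg, hn] using h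
        rw [Set.indicator_of_notMem m1, Set.indicator_of_notMem m2,
          Set.indicator_of_notMem (by simpa using h)]
        simp
    rw [setIntegral_congr_fun measurableSet_Ioi e, setIntegral_indicator measurableSet_Ici,
      Set.inter_eq_self_of_subset_right (Set.Ici_subset_Ioi.2 hη),
      integral_Ici_eq_integral_Ioi]
    refine (integral_ray_scaled_le ha ha1 hp hη
      ((mul_le_mul_of_nonneg_right hk hη.le).trans hb)).2.trans ?_
    have hk2 : k ^ 2 ≤ ‖b‖ ^ 2 := by
      rw [← sq_abs]; exact pow_le_pow_left₀ (abs_nonneg _) hk 2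
    have : 0 < p ^ (a - 2) := by positivity
    have : 0 < η ^ (2 - 2 * a) := by positivity
    have := mul_le_mul_of_nonneg_left hk2 (by positivity : 0 ≤ 2 * p ^ (a - 2) * η ^ (2 - 2 * a))
    linarith
  have hfin : (∫ θ : sphere (0 : EuclideanSpace ℝ (Fin d)) 1,
      (∫ t in Set.Ioi (0 : ℝ), t ^ (d - 1) * (A.indicator F (t • (θ : EuclideanSpace ℝ (Fin d))) +
        A.indicator F (-(t • (θ : EuclideanSpace ℝ (Fin d)))))) ∂σ) ≤
      σ.real Set.univ * (2 * (p ^ (a - 2) * ‖b‖ ^ 2 * η ^ (2 - 2 * a))) := by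
    by_cases hi : Integrable (fun θ : sphere (0 : EuclideanSpace ℝ (Fin d)) 1 =>
      (∫ t in Set.Ioi (0 : ℝ), t ^ (d - 1) * (A.indicator F (t • (θ : EuclideanSpace ℝ (Fin d))) +
        A.indicator F (-(t • (θ : EuclideanSpace ℝ (Fin d))))))) σ
    · refine (integral_mono hi (integrable_const _) hbound).trans ?_
      rw [integral_const, smul_eq_mul]
    · rw [integral_undef hi]; positivity
  linarith

/-- A closed cone whose points have `j`-th coordinate at least `‖z‖/2` and `i`-th coordinate of
size at least `‖z‖/4`. -/
def coordCone {d : ℕ} (i j : Fin d) : Set (EuclideanSpace ℝ (Fin d)) :=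
  {z | ‖z‖ / 2 ≤ z j ∧ ‖z‖ / 4 ≤ |z i|}

theorem measurableSet_coordCone {d : ℕ} (i j : Fin d) : MeasurableSet (coordCone i j) :=
  (measurableSet_le (f := fun z : EuclideanSpace ℝ (Fin d) => ‖z‖ / 2) (g := fun z => z j)
    (by fun_prop) (by fun_prop)).inter
    (measurableSet_le (f := fun z : EuclideanSpace ℝ (Fin d) => ‖z‖ / 4) (g := fun z => |z i|)
      (by fun_prop) (by fun_prop))

theorem exists_integral_coordCone {d : ℕ} [NeZero d] {i j : Fin d} (hij : i ≠ j) :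
    ∃ κ : ℝ, 0 < κ ∧ ∀ (S : Set ℝ) (f : ℝ → ℝ), MeasurableSet S → S ⊆ Set.Ioi 0 →
      IntegrableOn (fun t => t⁻¹ * f t) S →
      IntegrableOn (fun z : EuclideanSpace ℝ (Fin d) => ‖z‖ ^ (-(d : ℝ)) * f ‖z‖)
        (coordCone i j ∩ {z | ‖z‖ ∈ S}) ∧
      ∫ z in coordCone i j ∩ {z | ‖z‖ ∈ S}, ‖z‖ ^ (-(d : ℝ)) * f ‖z‖ =
        κ * ∫ t in S, t⁻¹ * f t := by
  set μ := (volume : Measure (EuclideanSpace ℝ (Fin d))).toSphere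
  set B : Set (sphere (0 : EuclideanSpace ℝ (Fin d)) 1) := {θ | (θ : EuclideanSpace ℝ (Fin d)) ∈ coordCone i j}
  have hB : MeasurableSet B := measurable_subtype_coe (measurableSet_coordCone i j)
  refine ⟨μ.real B, ?_, ?_⟩
  · have hU : IsOpen {θ : sphere (0 : EuclideanSpace ℝ (Fin d)) 1 |
        ‖(θ : EuclideanSpace ℝ (Fin d))‖ / 2 < (θ : EuclideanSpace ℝ (Fin d)) j ∧
        ‖(θ : EuclideanSpace ℝ (Fin d))‖ / 4 < |(θ : EuclideanSpace ℝ (Fin d)) i|} :=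
      (isOpen_lt (f := fun θ : sphere (0 : EuclideanSpace ℝ (Fin d)) 1 =>
        ‖(θ : EuclideanSpace ℝ (Fin d))‖ / 2) (g := fun θ => (θ : EuclideanSpace ℝ (Fin d)) j)
        (by fun_prop) (by fun_prop)).inter
      (isOpen_lt (f := fun θ : sphere (0 : EuclideanSpace ℝ (Fin d)) 1 =>
        ‖(θ : EuclideanSpace ℝ (Fin d))‖ / 4) (g := fun θ => |(θ : EuclideanSpace ℝ (Fin d)) i|)
        (by fun_prop) (by fun_prop))
    let v : EuclideanSpace ℝ (Fin d) := EuclideanSpace.single i (3 / 5) + EuclideanSpace.single j (4 / 5)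
    have hvi : v i = 3 / 5 := by simp [v, hij]
    have hvj : v j = 4 / 5 := by simp [v, hij.symm]
    have hv : ‖v‖ = 1 := by
      have h2 : ‖v‖ ^ 2 = 1 := by
        have h0 : inner ℝ (EuclideanSpace.single i (3 / 5) : EuclideanSpace ℝ (Fin d))
            (EuclideanSpace.single j (4 / 5)) = 0 := by
          simp [EuclideanSpace.inner_single_left, hij]
        rw [norm_add_sq_real, h0]; simp; norm_num
      nlinarith [norm_nonneg v]
    have hne : (μ {θ : sphere (0 : EuclideanSpace ℝ (Fin d)) 1 |
        ‖(θ : EuclideanSpace ℝ (Fin d))‖ / 2 < (θ : EuclideanSpace ℝ (Fin d)) j ∧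
        ‖(θ : EuclideanSpace ℝ (Fin d))‖ / 4 < |(θ : EuclideanSpace ℝ (Fin d)) i|}) ≠ 0 := by
      refine (hU.measure_pos μ ⟨⟨v, by simp [hv]⟩, ?_⟩).ne'
      simp only [Set.mem_ofPred_eq, hvi, hvj, hv]; norm_num [abs_of_pos]
    refine ENNReal.toReal_pos (fun h => hne (measure_mono_null ?_ h)) (measure_ne_top _ _)
    exact fun θ hθ => ⟨hθ.1.le, hθ.2.le⟩
  · intro S f hS hS0 hf
    have hmS : MeasurableSet {z : EuclideanSpace ℝ (Fin d) | ‖z‖ ∈ S} := measurable_norm hS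
    have hm : MeasurableSet (coordCone i j ∩ {z : EuclideanSpace ℝ (Fin d) | ‖z‖ ∈ S}) :=
      (measurableSet_coordCone i j).inter hmS
    have hi : IntegrableOn (fun z : EuclideanSpace ℝ (Fin d) => ‖z‖ ^ (-(d : ℝ)) * f ‖z‖)
        (coordCone i j ∩ {z | ‖z‖ ∈ S}) :=
      ((radial_integral f hS hS0).1.2 hf).mono_set Set.inter_subset_right
    refine ⟨hi, ?_⟩
    rw [← integral_indicator hm, integral_polar ((integrable_indicator_iff hm).2 hi)]
    have hθ : ∀ θ : sphere (0 : EuclideanSpace ℝ (Fin d)) 1,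
        (∫ t in Set.Ioi (0 : ℝ), t ^ (d - 1) * (coordCone i j ∩ {z | ‖z‖ ∈ S}).indicator
          (fun z => ‖z‖ ^ (-(d : ℝ)) * f ‖z‖) (t • (θ : EuclideanSpace ℝ (Fin d)))) =
        B.indicator (fun _ => ∫ t in S, t⁻¹ * f t) θ := by
      intro θ
      have hθ : ‖(θ : EuclideanSpace ℝ (Fin d))‖ = 1 := norm_eq_of_mem_sphere θ
      have hn : ∀ t : ℝ, 0 < t → ‖t • (θ : EuclideanSpace ℝ (Fin d))‖ = t := fun t ht0 => by
        rw [norm_smul, hθ, mul_one, Real.norm_of_nonneg ht0.le]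
      have hc : ∀ t : ℝ, 0 < t → (t • (θ : EuclideanSpace ℝ (Fin d)) ∈ coordCone i j ↔ θ ∈ B) := by
        intro t ht
        simp only [B, coordCone, Set.mem_ofPred_eq, hn t ht, hθ, PiLp.smul_apply, smul_eq_mul, abs_mul,
          abs_of_pos ht]
        rw [← mul_one_div, ← mul_one_div t 4, mul_le_mul_iff_right₀ ht, mul_le_mul_iff_right₀ ht]
      by_cases hb : θ ∈ B
      · rw [Set.indicator_of_mem hb]
        have e : Set.EqOn (fun t : ℝ => t ^ (d - 1) * (coordCone i j ∩ {z | ‖z‖ ∈ S}).indicator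
          (fun z => ‖z‖ ^ (-(d : ℝ)) * f ‖z‖) (t • (θ : EuclideanSpace ℝ (Fin d))))
          (S.indicator fun t => t⁻¹ * f t) (Set.Ioi 0) := by
          intro t ht
          have ht0 : 0 < t := ht
          by_cases hs : t ∈ S
          · have m : t • (θ : EuclideanSpace ℝ (Fin d)) ∈ coordCone i j ∩ {z | ‖z‖ ∈ S} :=
              ⟨(hc t ht).2 hb, by simpa only [Set.mem_ofPred_eq, hn t ht] using hs⟩
            simp only [Set.indicator_of_mem m, Set.indicator_of_mem hs, hn t ht]
            rw [← mul_assoc, ← Real.rpow_natCast, ← Real.rpow_add ht0, Nat.cast_sub NeZero.one_le]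
            congr 1
            rw [← Real.rpow_neg_one]; congr 1; push_cast; ring
          · have m : t • (θ : EuclideanSpace ℝ (Fin d)) ∉ coordCone i j ∩ {z | ‖z‖ ∈ S} :=
              fun h => hs (by simpa only [Set.mem_ofPred_eq, hn t ht] using h.2)
            simp only [Set.indicator_of_notMem m, Set.indicator_of_notMem hs, mul_zero]
        rw [setIntegral_congr_fun measurableSet_Ioi e, setIntegral_indicator hS,
          Set.inter_eq_self_of_subset_right hS0]
      · rw [Set.indicator_of_notMem hb]
        refine setIntegral_eq_zero_of_forall_eq_zero fun t ht => ?_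
        have m : t • (θ : EuclideanSpace ℝ (Fin d)) ∉ coordCone i j ∩ {z | ‖z‖ ∈ S} :=
          fun h => hb ((hc t ht).1 h.1)
        rw [Set.indicator_of_notMem m, mul_zero]
    simp only [hθ]
    rw [integral_indicator hB, setIntegral_const, smul_eq_mul]

theorem poisson_kernel_antitone {ρ ρ' a t : ℝ} (ha : 0 < a) (h0 : 0 ≤ ρ) (h : ρ ≤ ρ') (ht : ρ' < t) :
    (t ^ 2 - ρ ^ 2) ^ (-a) ≤ (t ^ 2 - ρ' ^ 2) ^ (-a) :=
  Real.rpow_le_rpow_of_nonpos (by nlinarith) (by nlinarith) (by linarith)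

theorem integral_odd_near {d : ℕ} [NeZero d] {a : ℝ} (ha1 : a < 1) (b : EuclideanSpace ℝ (Fin d))
    {ρ η : ℝ} (hρ : 0 < ρ) (hη : ρ < η) :
    IntegrableOn (fun z : EuclideanSpace ℝ (Fin d) =>
      ‖z‖ ^ (-(d : ℝ)) * (‖z‖ ^ 2 - ρ ^ 2) ^ (-a) * inner ℝ b z) {z | ‖z‖ ∈ Set.Ioo ρ η} ∧
    ∫ z in {z : EuclideanSpace ℝ (Fin d) | ‖z‖ ∈ Set.Ioo ρ η},
      ‖z‖ ^ (-(d : ℝ)) * (‖z‖ ^ 2 - ρ ^ 2) ^ (-a) * inner ℝ b z = 0 := by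
  have hm : MeasurableSet {z : EuclideanSpace ℝ (Fin d) | ‖z‖ ∈ Set.Ioo ρ η} :=
    measurable_norm measurableSet_Ioo
  constructor
  · refine Integrable.mono' ((integral_sq_sub_rpow (d := d) ha1 hρ hη).1.const_mul (‖b‖ / ρ))
      (by fun_prop) ?_
    filter_upwards [ae_restrict_mem hm] with z hz
    have hz1 : ρ < ‖z‖ := hz.1
    have hp : 0 < ‖z‖ ^ 2 - ρ ^ 2 := by nlinarith
    have hk : 0 ≤ ‖z‖ ^ (-(d : ℝ)) * (‖z‖ ^ 2 - ρ ^ 2) ^ (-a) := by positivity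
    rw [norm_mul, Real.norm_of_nonneg hk]
    have h1 : ‖inner ℝ b z‖ ≤ ‖b‖ / ρ * ‖z‖ ^ 2 := by
      refine (norm_inner_le_norm b z).trans ?_
      rw [div_mul_eq_mul_div, le_div_iff₀ hρ]
      have := mul_le_mul_of_nonneg_left hz1.le (mul_nonneg (norm_nonneg b) (norm_nonneg z))
      nlinarith
    calc _ ≤ ‖z‖ ^ (-(d : ℝ)) * (‖z‖ ^ 2 - ρ ^ 2) ^ (-a) * (‖b‖ / ρ * ‖z‖ ^ 2) :=
          mul_le_mul_of_nonneg_left h1 hk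
      _ = _ := by ring
  · set f : EuclideanSpace ℝ (Fin d) → ℝ := {z | ‖z‖ ∈ Set.Ioo ρ η}.indicator
      fun z => ‖z‖ ^ (-(d : ℝ)) * (‖z‖ ^ 2 - ρ ^ 2) ^ (-a) * inner ℝ b z with hf
    rw [← integral_indicator hm]
    have h1 : ∫ z, f (-z) = ∫ z, f z := integral_neg_eq_self f volume
    have h2 : ∀ z, f (-z) = - f z := by
      intro z
      by_cases hz : ‖z‖ ∈ Set.Ioo ρ η
      · simp [hf, hz, -Set.mem_Ioo]
      · simp [hf, hz, -Set.mem_Ioo]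
    simp only [h2, integral_neg] at h1
    linarith

/-- If the averages of `u - u 0` against the exterior Poisson kernels of small balls vanish and `u`
is touched from above at the origin by a quadratic polynomial, then the truncated fractional
Laplacian of `u` at `0` is bounded from below. -/
theorem truncated_fractional_laplacian_ge {d : ℕ} [NeZero d] {a : ℝ} (ha : 0 < a) (ha1 : a < 1)
    {u : EuclideanSpace ℝ (Fin d) → ℝ} (hu : ∀ z, 0 ≤ u z) {ρ₀ : ℝ} (hρ₀ : 0 < ρ₀)
    (hm : ∀ ρ ∈ Set.Ioo 0 ρ₀, IntegrableOn (fun z : EuclideanSpace ℝ (Fin d) =>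
        ‖z‖ ^ (-(d : ℝ)) * (‖z‖ ^ 2 - ρ ^ 2) ^ (-a) * u z) {z | ρ < ‖z‖} ∧
      ∫ z in {z : EuclideanSpace ℝ (Fin d) | ρ < ‖z‖},
        ‖z‖ ^ (-(d : ℝ)) * (‖z‖ ^ 2 - ρ ^ 2) ^ (-a) * (u z - u 0) = 0)
    {η₀ A : ℝ} (hA : 0 ≤ A) (b : EuclideanSpace ℝ (Fin d))
    (hb : ∀ z : EuclideanSpace ℝ (Fin d), ‖z‖ < η₀ → u z - u 0 ≤ inner ℝ b z + A * ‖z‖ ^ 2)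
    {η : ℝ} (hη : 0 < η) (hη₀ : η < η₀) :
    IntegrableOn (fun z : EuclideanSpace ℝ (Fin d) => u z * ‖z‖ ^ (-(d : ℝ) - 2 * a))
      {z | η ≤ ‖z‖} ∧
    -(A * sphereArea d * η ^ (2 - 2 * a) / (2 - 2 * a)) ≤
      ∫ z in {z : EuclideanSpace ℝ (Fin d) | η ≤ ‖z‖},
        (u z - u 0) * ‖z‖ ^ (-(d : ℝ) - 2 * a) := by
  set k : ℝ → EuclideanSpace ℝ (Fin d) → ℝ := fun ρ z =>
    ‖z‖ ^ (-(d : ℝ)) * (‖z‖ ^ 2 - ρ ^ 2) ^ (-a) with hk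
  have hms : ∀ ρ : ℝ, MeasurableSet {z : EuclideanSpace ℝ (Fin d) | ρ < ‖z‖} := fun ρ =>
    measurableSet_lt measurable_const measurable_norm
  have hmη : MeasurableSet {z : EuclideanSpace ℝ (Fin d) | η ≤ ‖z‖} := measurableSet_le_norm
  have hK0 : ∀ z : EuclideanSpace ℝ (Fin d), η ≤ ‖z‖ → ‖z‖ ^ (-(d : ℝ) - 2 * a) = k 0 z := by
    intro z hz
    have hz0 : 0 < ‖z‖ := hη.trans_le hz
    simp only [hk]
    rw [zero_pow two_ne_zero, sub_zero, ← Real.rpow_natCast, ← Real.rpow_mul hz0.le,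
      ← Real.rpow_add hz0]
    congr 1; push_cast; ring
  have hkm : ∀ {ρ ρ' : ℝ} {z : EuclideanSpace ℝ (Fin d)}, 0 ≤ ρ → ρ ≤ ρ' → ρ' < ‖z‖ →
      k ρ z ≤ k ρ' z := fun h0 h h' =>
    mul_le_mul_of_nonneg_left (poisson_kernel_antitone ha h0 h h') (by positivity)
  have hkp : ∀ {ρ : ℝ} {z : EuclideanSpace ℝ (Fin d)}, 0 ≤ ρ → ρ < ‖z‖ → 0 < k ρ z := by
    intro ρ z h0 h
    have : 0 < ‖z‖ := h0.trans_lt h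
    have : 0 < ‖z‖ ^ 2 - ρ ^ 2 := by nlinarith
    simp only [hk]; positivity
  set ρ₁ := min ρ₀ η / 2 with hρ₁
  have hmin : 0 < min ρ₀ η := lt_min hρ₀ hη
  have hρ₁0 : 0 < ρ₁ := by positivity
  have hρ₁ρ : ρ₁ < ρ₀ := by have := min_le_left ρ₀ η; linarith
  have hρ₁η : ρ₁ < η := by have := min_le_right ρ₀ η; linarith
  have hsub : ∀ ρ, ρ < η → {z : EuclideanSpace ℝ (Fin d) | η ≤ ‖z‖} ⊆ {z | ρ < ‖z‖} :=
    fun ρ h z hz => h.trans_le hz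
  have hI : ∀ ρ ∈ Set.Ioo 0 ρ₀, IntegrableOn (fun z => k ρ z * u z) {z | ρ < ‖z‖} :=
    fun ρ h => (hm ρ h).1
  have hJ : ∀ ρ, 0 < ρ → IntegrableOn (fun z : EuclideanSpace ℝ (Fin d) => k ρ z) {z | ρ < ‖z‖} :=
    fun ρ h => (poisson_normalization ha ha1 h).1
  have hKu : IntegrableOn (fun z => u z * ‖z‖ ^ (-(d : ℝ) - 2 * a)) {z | η ≤ ‖z‖} := by
    have h1 := (hI ρ₁ ⟨hρ₁0, hρ₁ρ⟩).mono_set (hsub ρ₁ hρ₁η)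
    have e : Set.EqOn (fun z => u z * ‖z‖ ^ (-(d : ℝ) - 2 * a))
        (fun z => (k ρ₁ z * u z) * (k 0 z / k ρ₁ z)) {z | η ≤ ‖z‖} := by
      intro z hz
      have := (hkp hρ₁0.le (hρ₁η.trans_le hz)).ne'
      simp only [hK0 z hz]; field_simp
    rw [integrableOn_congr_fun e hmη]
    refine h1.mono' (h1.aestronglyMeasurable.mul
      (Measurable.aestronglyMeasurable (by simp only [hk]; fun_prop))) ?_
    filter_upwards [ae_restrict_mem hmη] with z hz
    have h2 := hkp hρ₁0.le (hρ₁η.trans_le hz)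
    have h3 := hkp le_rfl (hη.trans_le hz)
    have h4 := hkm le_rfl hρ₁0.le (hρ₁η.trans_le hz)
    have h5 : k 0 z / k ρ₁ z ≤ 1 := by rw [div_le_one h2]; exact h4
    have h6 : 0 ≤ k ρ₁ z * u z := mul_nonneg h2.le (hu z)
    rw [Real.norm_of_nonneg (mul_nonneg h6 (by positivity))]
    nlinarith
  refine ⟨hKu, ?_⟩
  have hlim : Filter.Tendsto (fun ρ => ∫ z in {z : EuclideanSpace ℝ (Fin d) | η ≤ ‖z‖},
      k ρ z * (u z - u 0)) (nhdsWithin 0 (Set.Ioi 0))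
      (nhds (∫ z in {z : EuclideanSpace ℝ (Fin d) | η ≤ ‖z‖}, k 0 z * (u z - u 0))) := by
    have hev : ∀ᶠ ρ in nhdsWithin (0 : ℝ) (Set.Ioi 0), ρ ∈ Set.Ioo 0 ρ₁ := Ioo_mem_nhdsGT hρ₁0
    refine tendsto_integral_filter_of_dominated_convergence
      (fun z => k ρ₁ z * u z + k ρ₁ z * |u 0|) ?_ ?_ ?_ ?_
    · filter_upwards [hev] with ρ hρ
      have h1 := (hI ρ ⟨hρ.1, hρ.2.trans hρ₁ρ⟩).mono_set (hsub ρ (hρ.2.trans hρ₁η))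
      have h2 := ((hJ ρ hρ.1).mono_set (hsub ρ (hρ.2.trans hρ₁η))).mul_const (u 0)
      refine (h1.sub h2).aestronglyMeasurable.congr (Filter.Eventually.of_forall fun z => ?_)
      simp only [Pi.sub_apply, mul_sub]
    · filter_upwards [hev] with ρ hρ
      filter_upwards [ae_restrict_mem hmη] with z hz
      have h2 := hkp hρ.1.le ((hρ.2.trans hρ₁η).trans_le hz)
      have h4 := hkm hρ.1.le hρ.2.le (hρ₁η.trans_le hz)
      rw [norm_mul, Real.norm_of_nonneg h2.le, ← mul_add]
      refine mul_le_mul h4 ?_ (norm_nonneg _) (h2.le.trans h4)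
      rw [Real.norm_eq_abs]
      refine (abs_sub _ _).trans ?_
      rw [abs_of_nonneg (hu z)]
    · exact ((hI ρ₁ ⟨hρ₁0, hρ₁ρ⟩).mono_set (hsub ρ₁ hρ₁η)).add
        (((hJ ρ₁ hρ₁0).mono_set (hsub ρ₁ hρ₁η)).mul_const _)
    · filter_upwards [ae_restrict_mem hmη] with z hz
      have hz0 : 0 < ‖z‖ := hη.trans_le hz
      refine Filter.Tendsto.mul_const _ (Filter.Tendsto.mono_left ?_ nhdsWithin_le_nhds)
      have : ContinuousAt (fun ρ : ℝ => k ρ z) 0 := by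
        refine ContinuousAt.mul continuousAt_const (ContinuousAt.rpow_const (by fun_prop) ?_)
        left; simp; exact norm_ne_zero_iff.1 hz0.ne'
      exact this
  have hfin : ∀ᶠ ρ in nhdsWithin (0 : ℝ) (Set.Ioi 0),
      -(A * sphereArea d * η ^ (2 - 2 * a) / (2 - 2 * a)) ≤
        ∫ z in {z : EuclideanSpace ℝ (Fin d) | η ≤ ‖z‖}, k ρ z * (u z - u 0) := by
    have hev : ∀ᶠ ρ in nhdsWithin (0 : ℝ) (Set.Ioi 0), ρ ∈ Set.Ioo 0 ρ₁ := Ioo_mem_nhdsGT hρ₁0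
    filter_upwards [hev] with ρ hρ
    have hρη := hρ.2.trans hρ₁η
    have hmO : MeasurableSet {z : EuclideanSpace ℝ (Fin d) | ‖z‖ ∈ Set.Ioo ρ η} :=
      measurable_norm measurableSet_Ioo
    have hunion : {z : EuclideanSpace ℝ (Fin d) | ρ < ‖z‖} =
        {z | ‖z‖ ∈ Set.Ioo ρ η} ∪ {z | η ≤ ‖z‖} := by
      ext z
      simp only [Set.mem_ofPred_eq, Set.mem_union, Set.mem_Ioo]
      constructor
      · intro h; rcases lt_or_ge ‖z‖ η with h' | h'
        · exact Or.inl ⟨h, h'⟩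
        · exact Or.inr h'
      · rintro (h | h)
        · exact h.1
        · exact hρη.trans_le h
    have hdis : Disjoint {z : EuclideanSpace ℝ (Fin d) | ‖z‖ ∈ Set.Ioo ρ η} {z | η ≤ ‖z‖} := by
      rw [Set.disjoint_left]; intro z h h'; exact absurd h.2 (not_lt.2 h')
    have hint : IntegrableOn (fun z => k ρ z * (u z - u 0)) {z | ρ < ‖z‖} := by
      have h1 := (hI ρ ⟨hρ.1, hρ.2.trans hρ₁ρ⟩).sub ((hJ ρ hρ.1).mul_const (u 0))
      refine h1.congr (Filter.Eventually.of_forall fun z => ?_)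
      simp only [Pi.sub_apply, mul_sub]
    have h0 := (hm ρ ⟨hρ.1, hρ.2.trans hρ₁ρ⟩).2
    rw [hunion] at h0 hint
    rw [setIntegral_union hdis hmη hint.left_of_union hint.right_of_union] at h0
    obtain ⟨o1, o2⟩ := integral_odd_near (a := a) ha1 b hρ.1 hρη
    obtain ⟨q1, q2⟩ := integral_sq_sub_rpow (d := d) (a := a) ha1 hρ.1 hρη
    have hnear : ∫ z in {z : EuclideanSpace ℝ (Fin d) | ‖z‖ ∈ Set.Ioo ρ η},
        k ρ z * (u z - u 0) ≤ A * (sphereArea d * ((η ^ 2 - ρ ^ 2) ^ (1 - a) / (2 * (1 - a)))) := by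
      rw [← q2, ← integral_const_mul]
      refine (setIntegral_mono_on hint.left_of_union (o1.add (q1.const_mul A)) hmO ?_).trans ?_
      · intro z hz
        have h2 := hkp hρ.1.le hz.1
        refine (mul_le_mul_of_nonneg_left (hb z (hz.2.trans hη₀)) h2.le).trans (le_of_eq ?_)
        simp only [hk, Pi.add_apply]; ring
      · rw [integral_add' o1 (q1.const_mul A), o2, zero_add]
    have h3 : (η ^ 2 - ρ ^ 2) ^ (1 - a) ≤ η ^ (2 - 2 * a) := by
      have : η ^ (2 - 2 * a) = (η ^ 2) ^ (1 - a) := by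
        rw [← Real.rpow_natCast, ← Real.rpow_mul hη.le]; congr 1; push_cast; ring
      rw [this]
      exact Real.rpow_le_rpow (by nlinarith [hρ.1]) (by nlinarith [hρ.1]) (by linarith)
    have h4 : A * (sphereArea d * ((η ^ 2 - ρ ^ 2) ^ (1 - a) / (2 * (1 - a)))) ≤
        A * sphereArea d * η ^ (2 - 2 * a) / (2 - 2 * a) := by
      have hs := sphereArea_pos d
      have e1 : (2 : ℝ) - 2 * a = 2 * (1 - a) := by ring
      have e2 : (0 : ℝ) < 2 * (1 - a) := by linarith
      rw [e1] at h3 ⊢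
      rw [← mul_assoc, mul_div_assoc]
      exact mul_le_mul_of_nonneg_left (div_le_div_of_nonneg_right h3 e2.le) (by positivity)
    simp only [hk] at h0 hnear ⊢
    linarith
  have := ge_of_tendsto hlim hfin
  refine this.trans (le_of_eq (setIntegral_congr_fun hmη fun z hz => ?_))
  simp only [hK0 z hz]; ring

/-- The normalizing constant of the Poisson kernel of a ball. -/
noncomputable def poissonConst (d : ℕ) (a : ℝ) : ℝ :=
  Real.Gamma ((d : ℝ) / 2) * Real.pi ^ (-(d : ℝ) / 2 - 1) * Real.sin (Real.pi * a)

theorem poissonConst_pos (d : ℕ) [NeZero d] {a : ℝ} (ha : 0 < a) (ha1 : a < 1) :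
    0 < poissonConst d a := by
  have hd : (0 : ℝ) < d := Nat.cast_pos.2 (NeZero.pos d)
  have hs : 0 < Real.sin (Real.pi * a) :=
    Real.sin_pos_of_pos_of_lt_pi (by positivity) (by nlinarith [Real.pi_pos])
  have hG : 0 < Real.Gamma ((d : ℝ) / 2) := Real.Gamma_pos_of_pos (by positivity)
  have := Real.pi_pos
  unfold poissonConst; positivity

section translate
variable {d : ℕ} (x : EuclideanSpace ℝ (Fin d)) (f : EuclideanSpace ℝ (Fin d) → ℝ)
  (S : Set (EuclideanSpace ℝ (Fin d)))

theorem integrableOn_translate_iff :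
    IntegrableOn (fun z => f (x + z)) S ↔ IntegrableOn f {y | y - x ∈ S} := by
  have h := (measurePreserving_add_left volume x).integrableOn_comp_preimage
    (f := f) (s := {y | y - x ∈ S}) (measurableEmbedding_addLeft x)
  rw [← h]
  have : (fun y => x + y) ⁻¹' {y | y - x ∈ S} = S := by ext z; simp
  rw [this]; rfl

theorem setIntegral_translate :
    ∫ z in S, f (x + z) = ∫ y in {y | y - x ∈ S}, f y := by
  have h := (measurePreserving_add_left volume x).setIntegral_preimage_emb
    (measurableEmbedding_addLeft x) f {y | y - x ∈ S}
  have e : (fun y => x + y) ⁻¹' {y | y - x ∈ S} = S := by ext z; simp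
  rw [e] at h; exact h
end translate

section harmonic
variable {d : ℕ} [NeZero d] {α : ℝ} {h : EuclideanSpace ℝ (Fin d) → ℝ}
  {U : Set (EuclideanSpace ℝ (Fin d))}

omit [NeZero d] in
theorem AlphaHarmonicOn.center (hh : AlphaHarmonicOn d α h U)
    {x : EuclideanSpace ℝ (Fin d)} {ρ : ℝ} (hρ : 0 < ρ) (hU : closedBall x ρ ⊆ U) :
    IntegrableOn (fun z => ‖z‖ ^ (-(d : ℝ)) * (‖z‖ ^ 2 - ρ ^ 2) ^ (-(α / 2)) * h (x + z))
      {z | ρ < ‖z‖} ∧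
    h x = poissonConst d (α / 2) * ρ ^ α *
      ∫ z in {z : EuclideanSpace ℝ (Fin d) | ρ < ‖z‖},
        ‖z‖ ^ (-(d : ℝ)) * (‖z‖ ^ 2 - ρ ^ 2) ^ (-(α / 2)) * h (x + z) := by
  obtain ⟨h1, h2⟩ := hh x ρ hρ hU x (mem_ball_self hρ)
  have hm : MeasurableSet {z : EuclideanSpace ℝ (Fin d) | ρ < ‖z‖} :=
    measurableSet_lt measurable_const measurable_norm
  have hset : {y : EuclideanSpace ℝ (Fin d) | ρ < dist y x} = {y | y - x ∈ {z | ρ < ‖z‖}} := by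
    ext y; simp [dist_eq_norm]
  have e : Set.EqOn (fun z => ((ρ ^ 2 - dist x x ^ 2) / (dist (x + z) x ^ 2 - ρ ^ 2)) ^ (α / 2) *
            dist x (x + z) ^ (-(d : ℝ)) * h (x + z))
      (fun z => ρ ^ α * (‖z‖ ^ (-(d : ℝ)) * (‖z‖ ^ 2 - ρ ^ 2) ^ (-(α / 2)) * h (x + z)))
      {z : EuclideanSpace ℝ (Fin d) | ρ < ‖z‖} := by
    intro z hz
    have hz1 : ρ < ‖z‖ := hz
    have hp : 0 < ‖z‖ ^ 2 - ρ ^ 2 := by nlinarith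
    have e1 : (ρ ^ 2) ^ (α / 2) = ρ ^ α := by
      rw [← Real.rpow_natCast, ← Real.rpow_mul hρ.le]; congr 1; push_cast; ring
    simp only [dist_self_add_left, dist_self_add_right, dist_self]
    rw [zero_pow two_ne_zero, sub_zero, Real.div_rpow (by positivity) hp.le, e1, Real.rpow_neg hp.le]
    ring
  rw [hset] at h1 h2
  rw [← integrableOn_translate_iff x, integrableOn_congr_fun e hm] at h1
  rw [← setIntegral_translate x, setIntegral_congr_fun hm e, integral_const_mul] at h2
  have hc : 0 < ρ ^ α := by positivity
  constructor
  · have := h1.const_mul (ρ ^ α)⁻¹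
    simp only [inv_mul_cancel_left₀ hc.ne'] at this
    exact this
  · rw [poissonConst, ← mul_div_assoc, mul_assoc]; exact h2

theorem AlphaHarmonicOn.integral_sub_eq_zero (hh : AlphaHarmonicOn d α h U) (hα : 0 < α)
    (hα2 : α < 2) {x : EuclideanSpace ℝ (Fin d)} {ρ : ℝ} (hρ : 0 < ρ) (hU : closedBall x ρ ⊆ U) :
    ∫ z in {z : EuclideanSpace ℝ (Fin d) | ρ < ‖z‖},
      ‖z‖ ^ (-(d : ℝ)) * (‖z‖ ^ 2 - ρ ^ 2) ^ (-(α / 2)) * (h (x + z) - h x) = 0 := by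
  obtain ⟨h1, h2⟩ := hh.center hρ hU
  obtain ⟨n1, n2⟩ := poisson_normalization (d := d) (a := α / 2) (by linarith) (by linarith) hρ
  have hc := poissonConst_pos d (a := α / 2) (by linarith) (by linarith)
  have hr : 0 < ρ ^ α := by positivity
  simp only [mul_sub]
  rw [integral_sub h1 (n1.mul_const _), integral_mul_const]
  rw [← poissonConst] at n2
  have e : ρ ^ (-(2 * (α / 2))) = (ρ ^ α)⁻¹ := by
    rw [← Real.rpow_neg hρ.le]; congr 1; ring
  rw [e] at n2
  set I := ∫ z in {z : EuclideanSpace ℝ (Fin d) | ρ < ‖z‖},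
    ‖z‖ ^ (-(d : ℝ)) * (‖z‖ ^ 2 - ρ ^ 2) ^ (-(α / 2)) * h (x + z)
  set N := ∫ z in {z : EuclideanSpace ℝ (Fin d) | ρ < ‖z‖},
    ‖z‖ ^ (-(d : ℝ)) * (‖z‖ ^ 2 - ρ ^ 2) ^ (-(α / 2))
  have hN : N = (poissonConst d (α / 2))⁻¹ * (ρ ^ α)⁻¹ := by
    rw [← n2]; field_simp
  rw [hN, h2]; field_simp; ring

theorem AlphaHarmonicOn.kernel_integral_le (hh : AlphaHarmonicOn d α h U) (hα : 0 < α)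
    (hα2 : α < 2) (h0 : ∀ x, 0 ≤ h x) {x : EuclideanSpace ℝ (Fin d)} {ρ : ℝ} (hρ : 0 < ρ)
    (hU : closedBall x ρ ⊆ U) :
    IntegrableOn (fun z => h (x + z) * ‖z‖ ^ (-(d : ℝ) - α)) {z | ρ < ‖z‖} ∧
    ∫ z in {z : EuclideanSpace ℝ (Fin d) | ρ < ‖z‖}, h (x + z) * ‖z‖ ^ (-(d : ℝ) - α) ≤
      (poissonConst d (α / 2))⁻¹ * ρ ^ (-α) * h x := by
  obtain ⟨h1, h2⟩ := hh.center hρ hU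
  have hm : MeasurableSet {z : EuclideanSpace ℝ (Fin d) | ρ < ‖z‖} :=
    measurableSet_lt measurable_const measurable_norm
  have hc := poissonConst_pos d (a := α / 2) (by linarith) (by linarith)
  have hr : 0 < ρ ^ α := by positivity
  have hp : ∀ z : EuclideanSpace ℝ (Fin d), ρ < ‖z‖ → 0 < ‖z‖ ^ 2 - ρ ^ 2 := fun z hz => by nlinarith
  have hK : ∀ z : EuclideanSpace ℝ (Fin d), ρ < ‖z‖ → ‖z‖ ^ (-(d : ℝ) - α) ≤
      ‖z‖ ^ (-(d : ℝ)) * (‖z‖ ^ 2 - ρ ^ 2) ^ (-(α / 2)) := by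
    intro z hz
    have hz0 : 0 < ‖z‖ := hρ.trans hz
    rw [sub_eq_add_neg, Real.rpow_add hz0]
    refine mul_le_mul_of_nonneg_left ?_ (by positivity)
    have : ‖z‖ ^ (-α) = (‖z‖ ^ 2) ^ (-(α / 2)) := by
      rw [← Real.rpow_natCast, ← Real.rpow_mul hz0.le]; congr 1; push_cast; ring
    rw [this]
    exact Real.rpow_le_rpow_of_nonpos (hp z hz) (by nlinarith) (by linarith)
  have hle : ∀ z : EuclideanSpace ℝ (Fin d), ρ < ‖z‖ → h (x + z) * ‖z‖ ^ (-(d : ℝ) - α) ≤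
      ‖z‖ ^ (-(d : ℝ)) * (‖z‖ ^ 2 - ρ ^ 2) ^ (-(α / 2)) * h (x + z) := fun z hz => by
    rw [mul_comm]; exact mul_le_mul_of_nonneg_right (hK z hz) (h0 _)
  have hi : IntegrableOn (fun z => h (x + z) * ‖z‖ ^ (-(d : ℝ) - α)) {z | ρ < ‖z‖} := by
    have e : Set.EqOn (fun z => h (x + z) * ‖z‖ ^ (-(d : ℝ) - α))
        (fun z => (‖z‖ ^ (-(d : ℝ)) * (‖z‖ ^ 2 - ρ ^ 2) ^ (-(α / 2)) * h (x + z)) *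
          (‖z‖ ^ (-(d : ℝ) - α) / (‖z‖ ^ (-(d : ℝ)) * (‖z‖ ^ 2 - ρ ^ 2) ^ (-(α / 2)))))
        {z | ρ < ‖z‖} := by
      intro z hz
      have := hp z hz
      have : 0 < ‖z‖ := hρ.trans hz
      have : 0 < ‖z‖ ^ (-(d : ℝ)) * (‖z‖ ^ 2 - ρ ^ 2) ^ (-(α / 2)) := by positivity
      beta_reduce
      rw [mul_comm _ (h (x + z)), mul_assoc, mul_div_cancel₀ _ this.ne']
    have hms : AEStronglyMeasurable (fun z => h (x + z) * ‖z‖ ^ (-(d : ℝ) - α))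
        (volume.restrict {z | ρ < ‖z‖}) :=
      (h1.aestronglyMeasurable.mul (Measurable.aestronglyMeasurable (by fun_prop))).congr
        ((ae_restrict_mem hm).mono fun z hz => (e hz).symm)
    refine Integrable.mono' h1 hms ?_
    filter_upwards [ae_restrict_mem hm] with z hz
    rw [Real.norm_of_nonneg (mul_nonneg (h0 _) (by positivity))]
    exact hle z hz
  refine ⟨hi, ?_⟩
  rw [h2, Real.rpow_neg hρ.le]
  refine (setIntegral_mono_on hi h1 hm hle).trans (le_of_eq ?_)
  field_simp

theorem AlphaHarmonicOn.harnack (hh : AlphaHarmonicOn d α h U) (hα : 0 < α)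
    (hα2 : α < 2) (h0 : ∀ x, 0 ≤ h x) {x₀ x : EuclideanSpace ℝ (Fin d)} {ρ : ℝ} (hρ : 0 < ρ)
    (hU : closedBall x₀ ρ ⊆ U) (hx : dist x x₀ ≤ ρ / 2) : h x ≤ 2 ^ d * h x₀ := by
  obtain ⟨h1, h2⟩ := hh x₀ ρ hρ hU x₀ (mem_ball_self hρ)
  obtain ⟨h3, h4⟩ := hh x₀ ρ hρ hU x (mem_ball.2 (by linarith))
  have hm : MeasurableSet {y : EuclideanSpace ℝ (Fin d) | ρ < dist y x₀} :=
    measurableSet_lt measurable_const (by fun_prop)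
  have hc := poissonConst_pos d (a := α / 2) (by linarith) (by linarith)
  rw [poissonConst, ← mul_div_assoc] at hc
  rw [h4, h2]
  rw [mul_left_comm, ← integral_const_mul (2 ^ d : ℝ)]
  refine mul_le_mul_of_nonneg_left (setIntegral_mono_on h3 (h1.const_mul _) hm fun y hy => ?_) hc.le
  have hy1 : ρ < dist y x₀ := hy
  have hp : 0 < dist y x₀ ^ 2 - ρ ^ 2 := by nlinarith
  have hx0 := dist_nonneg (x := x) (y := x₀)
  have e1 : ((ρ ^ 2 - dist x x₀ ^ 2) / (dist y x₀ ^ 2 - ρ ^ 2)) ^ (α / 2) ≤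
      ((ρ ^ 2 - dist x₀ x₀ ^ 2) / (dist y x₀ ^ 2 - ρ ^ 2)) ^ (α / 2) := by
    refine Real.rpow_le_rpow (div_nonneg (by nlinarith) hp.le) ?_ (by linarith)
    refine div_le_div_of_nonneg_right ?_ hp.le
    simp
  have hd1 : dist y x₀ / 2 ≤ dist x y := by
    have := dist_triangle y x x₀
    rw [dist_comm y x] at this; linarith
  have e2 : dist x y ^ (-(d : ℝ)) ≤ 2 ^ d * dist x₀ y ^ (-(d : ℝ)) := by
    have h5 : dist x y ^ (-(d : ℝ)) ≤ (dist y x₀ / 2) ^ (-(d : ℝ)) :=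
      Real.rpow_le_rpow_of_nonpos (by linarith) hd1 (by simp)
    refine h5.trans (le_of_eq ?_)
    rw [Real.div_rpow dist_nonneg zero_le_two, Real.rpow_neg zero_le_two, Real.rpow_natCast,
      dist_comm x₀ y]
    field_simp
  have e3 : 0 ≤ ((ρ ^ 2 - dist x x₀ ^ 2) / (dist y x₀ ^ 2 - ρ ^ 2)) ^ (α / 2) :=
    Real.rpow_nonneg (div_nonneg (by nlinarith) hp.le) _
  calc _ ≤ ((ρ ^ 2 - dist x₀ x₀ ^ 2) / (dist y x₀ ^ 2 - ρ ^ 2)) ^ (α / 2) *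
        (2 ^ d * dist x₀ y ^ (-(d : ℝ))) * h y :=
        mul_le_mul_of_nonneg_right (mul_le_mul e1 e2 (by positivity) (e3.trans e1)) (h0 y)
    _ = _ := by ring

theorem AlphaHarmonicOn.aestronglyMeasurable (hh : AlphaHarmonicOn d α h U) (hα : 0 < α)
    (hα2 : α < 2) (h0 : ∀ x, 0 ≤ h x) {x : EuclideanSpace ℝ (Fin d)} {ρ : ℝ} (hρ : 0 < ρ)
    (hU : closedBall x ρ ⊆ U) : AEStronglyMeasurable h := by
  have hS : ∀ n : ℕ, AEStronglyMeasurable (fun z => h (x + z))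
      (volume.restrict {z : EuclideanSpace ℝ (Fin d) | ρ / (n + 1) < ‖z‖}) := by
    intro n
    have hm : MeasurableSet {z : EuclideanSpace ℝ (Fin d) | ρ / (n + 1) < ‖z‖} :=
      measurableSet_lt measurable_const measurable_norm
    have hn : 0 < ρ / (n + 1) := by positivity
    have h1 := (hh.kernel_integral_le hα hα2 h0 hn ((closedBall_subset_closedBall
      (div_le_self hρ.le (by linarith [n.cast_nonneg (α := ℝ)]))).trans hU)).1
    refine (h1.aestronglyMeasurable.mul (Measurable.aestronglyMeasurable
      (f := fun z => ‖z‖ ^ ((d : ℝ) + α)) (by fun_prop))).congr ?_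
    filter_upwards [ae_restrict_mem hm] with z hz
    have hz0 : 0 < ‖z‖ := hn.trans hz
    simp only [Pi.mul_apply]
    rw [mul_assoc, ← Real.rpow_add hz0]; simp
  have hU := (aestronglyMeasurable_iUnion_iff (μ := (volume : Measure (EuclideanSpace ℝ (Fin d))))
    (s := fun n : ℕ => {z : EuclideanSpace ℝ (Fin d) | ρ / (n + 1) < ‖z‖})).2 hS
  have hun : (⋃ n : ℕ, {z : EuclideanSpace ℝ (Fin d) | ρ / (n + 1) < ‖z‖}) = {0}ᶜ := by
    ext z
    simp only [Set.mem_iUnion, Set.mem_ofPred_eq, Set.mem_compl_iff, Set.mem_singleton_iff]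
    constructor
    · rintro ⟨n, hn⟩ rfl
      simp only [norm_zero] at hn
      exact absurd hn (not_lt.2 (by positivity))
    · intro hz
      have hz0 : 0 < ‖z‖ := norm_pos_iff.2 hz
      obtain ⟨n, hn⟩ := exists_nat_gt (ρ / ‖z‖)
      refine ⟨n, ?_⟩
      rw [div_lt_iff₀ hz0] at hn
      rw [div_lt_iff₀ (by positivity)]
      nlinarith
  rw [hun, restrict_compl_singleton] at hU
  have := hU.comp_measurePreserving (measurePreserving_add_left volume (-x))
  refine this.congr (Filter.Eventually.of_forall fun y => ?_)
  simp
end harmonic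

/-- The constant in the tail estimate. -/
noncomputable def tailConst (d : ℕ) (α : ℝ) : ℝ :=
  2 ^ ((d : ℝ) + α) * 2 ^ α * (poissonConst d (α / 2))⁻¹ + 2 ^ d * (sphereArea d / α)

theorem tailConst_pos (d : ℕ) [NeZero d] {α : ℝ} (hα : 0 < α) (hα2 : α < 2) :
    0 < tailConst d α := by
  have hc := poissonConst_pos d (a := α / 2) (by linarith) (by linarith)
  have hs := sphereArea_pos d
  unfold tailConst; positivity

section harmonic
variable {d : ℕ} [NeZero d] {α : ℝ} {h : EuclideanSpace ℝ (Fin d) → ℝ}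
  {U : Set (EuclideanSpace ℝ (Fin d))}

theorem AlphaHarmonicOn.tail_le (hh : AlphaHarmonicOn d α h U) (hα : 0 < α)
    (hα2 : α < 2) (h0 : ∀ x, 0 ≤ h x) {x₀ x : EuclideanSpace ℝ (Fin d)} {ρ L τ : ℝ} (hρ : 0 < ρ)
    (hU : closedBall x₀ ρ ⊆ U) (hx : ‖x - x₀‖ ≤ L) (hL : ρ ≤ L) (hτ : 0 < τ) (hτL : τ ≤ L) :
    IntegrableOn (fun z => h (x + z) * ‖z‖ ^ (-(d : ℝ) - α)) {z | τ ≤ ‖z‖} ∧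
    ∫ z in {z : EuclideanSpace ℝ (Fin d) | τ ≤ ‖z‖}, h (x + z) * ‖z‖ ^ (-(d : ℝ) - α) ≤
      tailConst d α * (L / τ) ^ ((d : ℝ) + α) * ρ ^ (-α) * h x₀ := by
  have hL0 : 0 < L := hρ.trans_le hL
  have hc := poissonConst_pos d (a := α / 2) (by linarith) (by linarith)
  have hσ := sphereArea_pos d
  have hmτ : MeasurableSet {z : EuclideanSpace ℝ (Fin d) | τ ≤ ‖z‖} := measurableSet_le_norm
  have hm : MeasurableSet {z : EuclideanSpace ℝ (Fin d) | ρ / 2 < ‖z‖} :=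
    measurableSet_lt measurable_const measurable_norm
  obtain ⟨k1, k2⟩ := hh.kernel_integral_le hα hα2 h0 (half_pos hρ)
    ((closedBall_subset_closedBall (by linarith)).trans hU)
  set G₀ : EuclideanSpace ℝ (Fin d) → ℝ := {z | ρ / 2 < ‖z‖}.indicator
    fun z => h (x₀ + z) * ‖z‖ ^ (-(d : ℝ) - α) with hG₀
  have hG₀i : Integrable G₀ := (integrable_indicator_iff hm).2 k1
  have hG₀0 : ∀ z, 0 ≤ G₀ z := fun z => Set.indicator_nonneg
    (fun z _ => mul_nonneg (h0 _) (by positivity)) z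
  set G : EuclideanSpace ℝ (Fin d) → ℝ := fun z => G₀ ((x - x₀) + z) with hG
  have hGi : Integrable G := hG₀i.comp_add_left _
  have hGI : ∫ z, G z ≤ (poissonConst d (α / 2))⁻¹ * (ρ / 2) ^ (-α) * h x₀ := by
    rw [hG, integral_add_left_eq_self G₀, hG₀, integral_indicator hm]; exact k2
  obtain ⟨r1, r2⟩ := radial_integral_far (d := d) hα hτ
  have hbd : ∀ z : EuclideanSpace ℝ (Fin d), τ ≤ ‖z‖ → h (x + z) * ‖z‖ ^ (-(d : ℝ) - α) ≤
      (2 * L / τ) ^ ((d : ℝ) + α) * G z + 2 ^ d * h x₀ * ‖z‖ ^ (-(d : ℝ) - α) := by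
    intro z hz
    have hz0 : 0 < ‖z‖ := hτ.trans_le hz
    by_cases hy : ρ / 2 < ‖x - x₀ + z‖
    · have e1 : G z = h (x + z) * ‖x - x₀ + z‖ ^ (-(d : ℝ) - α) := by
        rw [hG, hG₀]; beta_reduce
        rw [Set.indicator_of_mem (by exact hy)]
        congr 2; abel
      have hy0 : 0 < ‖x - x₀ + z‖ := (half_pos hρ).trans hy
      have h1 : ‖x - x₀ + z‖ ≤ 2 * L / τ * ‖z‖ := by
        refine (norm_add_le _ _).trans ?_
        rw [div_mul_eq_mul_div, le_div_iff₀ hτ]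
        nlinarith
      have h2 : ‖z‖ ^ (-(d : ℝ) - α) ≤
          (2 * L / τ) ^ ((d : ℝ) + α) * ‖x - x₀ + z‖ ^ (-(d : ℝ) - α) := by
        have h3 := Real.rpow_le_rpow_of_nonpos hy0 h1 (z := -(d : ℝ) - α)
          (by have := (Nat.cast_nonneg d : (0 : ℝ) ≤ d); linarith)
        rw [Real.mul_rpow (by positivity) hz0.le] at h3
        have e2 : (2 * L / τ) ^ (-(d : ℝ) - α) = ((2 * L / τ) ^ ((d : ℝ) + α))⁻¹ := by
          rw [← Real.rpow_neg (by positivity)]; congr 1; ring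
        have hq : 0 < (2 * L / τ) ^ ((d : ℝ) + α) := by positivity
        rw [e2, inv_mul_le_iff₀ hq] at h3
        exact h3
      rw [e1]
      have := mul_le_mul_of_nonneg_left h2 (h0 (x + z))
      have h4 : 0 ≤ 2 ^ d * h x₀ * ‖z‖ ^ (-(d : ℝ) - α) :=
        mul_nonneg (mul_nonneg (by positivity) (h0 _)) (by positivity)
      linarith
    · have h1 : h (x + z) ≤ 2 ^ d * h x₀ := by
        refine hh.harnack hα hα2 h0 hρ hU ?_
        rw [dist_eq_norm, add_sub_right_comm]; exact not_lt.1 hy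
      have h2 := mul_le_mul_of_nonneg_right h1 (by positivity : 0 ≤ ‖z‖ ^ (-(d : ℝ) - α))
      have h3 : 0 ≤ (2 * L / τ) ^ ((d : ℝ) + α) * G z := mul_nonneg (by positivity) (hG₀0 _)
      linarith
  have hbi : IntegrableOn (fun z => (2 * L / τ) ^ ((d : ℝ) + α) * G z +
      2 ^ d * h x₀ * ‖z‖ ^ (-(d : ℝ) - α)) {z | τ ≤ ‖z‖} :=
    (hGi.integrableOn.const_mul _).add (r1.const_mul _)
  have hae := hh.aestronglyMeasurable hα hα2 h0 hρ hU
  have hae2 : AEStronglyMeasurable (fun z => h (x + z)) :=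
    hae.comp_measurePreserving (measurePreserving_add_left volume x)
  have hi : IntegrableOn (fun z => h (x + z) * ‖z‖ ^ (-(d : ℝ) - α)) {z | τ ≤ ‖z‖} := by
    refine hbi.mono' (hae2.restrict.mul (Measurable.aestronglyMeasurable (by fun_prop))) ?_
    filter_upwards [ae_restrict_mem hmτ] with z hz
    rw [Real.norm_of_nonneg (mul_nonneg (h0 _) (by positivity))]
    exact hbd z hz
  refine ⟨hi, (setIntegral_mono_on hi hbi hmτ hbd).trans ?_⟩
  rw [integral_add (hGi.integrableOn.const_mul _) (r1.const_mul _), integral_const_mul,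
    integral_const_mul, r2]
  have hGs : ∫ z in {z : EuclideanSpace ℝ (Fin d) | τ ≤ ‖z‖}, G z ≤
      (poissonConst d (α / 2))⁻¹ * (ρ / 2) ^ (-α) * h x₀ :=
    (setIntegral_le_integral hGi (Filter.Eventually.of_forall fun z => hG₀0 _)).trans hGI
  have t1 := mul_le_mul_of_nonneg_left hGs (by positivity : 0 ≤ (2 * L / τ) ^ ((d : ℝ) + α))
  have e1 : (2 * L / τ) ^ ((d : ℝ) + α) * ((poissonConst d (α / 2))⁻¹ * (ρ / 2) ^ (-α) * h x₀) =
      2 ^ ((d : ℝ) + α) * 2 ^ α * (poissonConst d (α / 2))⁻¹ *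
        ((L / τ) ^ ((d : ℝ) + α) * ρ ^ (-α) * h x₀) := by
    rw [mul_div_assoc, Real.mul_rpow zero_le_two (by positivity), Real.div_rpow hρ.le zero_le_two,
      Real.rpow_neg zero_le_two]
    field_simp
  have t2 : τ ^ (-α) ≤ (L / τ) ^ ((d : ℝ) + α) * ρ ^ (-α) := by
    have h1 : (L / τ) ^ α ≤ (L / τ) ^ ((d : ℝ) + α) :=
      Real.rpow_le_rpow_of_exponent_le ((one_le_div hτ).2 hτL)
        (by have := (Nat.cast_nonneg d : (0 : ℝ) ≤ d); linarith)
    have h2 : (ρ / τ) ^ α ≤ (L / τ) ^ α :=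
      Real.rpow_le_rpow (by positivity) (div_le_div_of_nonneg_right hL hτ.le) hα.le
    have h3 : τ ^ (-α) = (ρ / τ) ^ α * ρ ^ (-α) := by
      rw [Real.div_rpow hρ.le hτ.le, Real.rpow_neg hτ.le, Real.rpow_neg hρ.le]
      have := Real.rpow_pos_of_pos hρ α
      field_simp
    rw [h3]
    exact mul_le_mul_of_nonneg_right (h2.trans h1) (by positivity)
  have t3 := mul_le_mul_of_nonneg_left t2
    (mul_nonneg (by positivity : 0 ≤ 2 ^ d * (sphereArea d / α)) (h0 x₀))
  rw [e1] at t1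
  have e3 : 2 ^ d * h x₀ * (sphereArea d * (τ ^ (-α) / α)) =
      2 ^ d * (sphereArea d / α) * h x₀ * τ ^ (-α) := by ring
  rw [e3, tailConst]
  linarith

theorem AlphaHarmonicOn.touching (hh : AlphaHarmonicOn d α h U) (hα : 0 < α)
    (hα2 : α < 2) (h0 : ∀ x, 0 ≤ h x) (hU : IsOpen U) {x : EuclideanSpace ℝ (Fin d)} (hx : x ∈ U)
    {η₀ A : ℝ} (hA : 0 ≤ A) (b : EuclideanSpace ℝ (Fin d))
    (hb : ∀ z : EuclideanSpace ℝ (Fin d), ‖z‖ < η₀ → h (x + z) - h x ≤ inner ℝ b z + A * ‖z‖ ^ 2)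
    {η : ℝ} (hη : 0 < η) (hη₀ : η < η₀) :
    IntegrableOn (fun z => h (x + z) * ‖z‖ ^ (-(d : ℝ) - α)) {z | η ≤ ‖z‖} ∧
    -(A * sphereArea d * η ^ (2 - α) / (2 - α)) ≤
      ∫ z in {z : EuclideanSpace ℝ (Fin d) | η ≤ ‖z‖},
        (h (x + z) - h x) * ‖z‖ ^ (-(d : ℝ) - α) := by
  obtain ⟨ε, hε, hεU⟩ := Metric.isOpen_iff.1 hU x hx
  have hsub : ∀ ρ ∈ Set.Ioo 0 ε, closedBall x ρ ⊆ U := fun ρ hρ =>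
    (closedBall_subset_ball hρ.2).trans hεU
  have key := truncated_fractional_laplacian_ge (d := d) (a := α / 2) (by linarith) (by linarith)
    (u := fun z => h (x + z)) (fun z => h0 _) hε
    (fun ρ hρ => ⟨(hh.center hρ.1 (hsub ρ hρ)).1, by
      simpa only [add_zero] using hh.integral_sub_eq_zero hα hα2 hρ.1 (hsub ρ hρ)⟩) hA b
    (fun z hz => by simpa only [add_zero] using hb z hz) hη hη₀
  have e : 2 * (α / 2) = α := by ring
  simpa only [add_zero, e] using key
end harmonic

theorem exists_pow_le_quadratic (n : ℕ) : ∃ C : ℝ, 0 ≤ C ∧ ∀ v : ℝ, |v| ≤ 1 / 2 →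
    (1 + v + 2 * v ^ 2) ^ n ≤ 1 + n * v + C * v ^ 2 := by
  induction n with
  | zero => exact ⟨0, le_rfl, fun v _ => by simp⟩
  | succ n ih =>
    obtain ⟨C, hC, h⟩ := ih
    refine ⟨2 + 3 * n + 4 * C, by positivity, fun v hv => ?_⟩
    have hv' := abs_le.1 hv
    have h1 : 0 < 1 + v + 2 * v ^ 2 := by nlinarith
    have h2 := mul_le_mul_of_nonneg_right (h v hv) h1.le
    rw [pow_succ]
    refine h2.trans ?_
    have hn : (0 : ℝ) ≤ n := n.cast_nonneg
    have hs : 0 ≤ v ^ 2 := sq_nonneg v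
    have h3 : v ^ 3 ≤ v ^ 2 := by nlinarith
    have h4 : v ^ 4 ≤ v ^ 2 := by nlinarith
    have h5 := mul_le_mul_of_nonneg_left h3 (by positivity : 0 ≤ 2 * (n : ℝ) + C)
    have h6 := mul_le_mul_of_nonneg_left h4 hC
    push_cast
    nlinarith

theorem exists_inv_pow_le_quadratic (n : ℕ) : ∃ C : ℝ, 0 ≤ C ∧ ∀ v : ℝ, |v| ≤ 1 / 2 →
    ((1 - v) ^ n)⁻¹ ≤ 1 + n * v + C * v ^ 2 := by
  obtain ⟨C, hC, h⟩ := exists_pow_le_quadratic n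
  refine ⟨C, hC, fun v hv => le_trans ?_ (h v hv)⟩
  have hv' := abs_le.1 hv
  have h1 : 0 < 1 - v := by linarith
  rw [← inv_pow]
  refine pow_le_pow_left₀ (by positivity) ?_ n
  rw [inv_le_iff_one_le_mul₀ h1]
  nlinarith [mul_nonneg (sq_nonneg v) (by linarith : 0 ≤ 1 - 2 * v)]

section harmonic
variable {d : ℕ} [NeZero d] {α : ℝ}

omit [NeZero d] in
theorem weighted_max_touching {Cd : ℝ} (hCd : 0 ≤ Cd)
    (hquad : ∀ v : ℝ, |v| ≤ 1 / 2 → ((1 - v) ^ d)⁻¹ ≤ 1 + d * v + Cd * v ^ 2)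
    {h : EuclideanSpace ℝ (Fin d) → ℝ} (h0 : ∀ x, 0 ≤ h x) {ω q τ : ℝ}
    {x₀ : EuclideanSpace ℝ (Fin d)} (hω0 : 0 < ω) (hqp : 0 < q) (hq : q = ω ^ 2 - ‖x₀‖ ^ 2)
    (hx₀n : ‖x₀‖ ≤ ω) (hτ0 : 0 < τ) (hqτ : q = 8 * ω * τ) (hτω : 8 * τ ≤ ω)
    (hmax : ∀ y : EuclideanSpace ℝ (Fin d), ‖y‖ ≤ ω →
      h y * (ω ^ 2 - ‖y‖ ^ 2) ^ d ≤ h x₀ * q ^ d) (z : EuclideanSpace ℝ (Fin d)) (hzτ : ‖z‖ < τ) :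
    h (x₀ + z) - h x₀ ≤
      inner ℝ ((h x₀ * d * 2 / q) • x₀) z + (h x₀ * (d + Cd) / τ ^ 2) * ‖z‖ ^ 2 := by
  have hz0 := norm_nonneg z
  set k : ℝ := inner ℝ x₀ z with hk
  have hkz : |k| ≤ ω * ‖z‖ := (abs_real_inner_le_norm x₀ z).trans
    (mul_le_mul_of_nonneg_right hx₀n hz0)
  have hkz' := abs_le.1 hkz
  set v := (2 * k + ‖z‖ ^ 2) / q with hv
  have hvq : v * q = 2 * k + ‖z‖ ^ 2 := by rw [hv]; field_simp
  have hnorm : ω ^ 2 - ‖x₀ + z‖ ^ 2 = q * (1 - v) := by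
    rw [norm_add_sq_real, mul_sub, mul_one, mul_comm q v, hvq, hq]; ring
  have hvabs : |2 * k + ‖z‖ ^ 2| ≤ 3 * ω * ‖z‖ := by
    have hzω : ‖z‖ ^ 2 ≤ ω * ‖z‖ := by
      rw [pow_two]; exact mul_le_mul_of_nonneg_right (by linarith) hz0
    have := sq_nonneg ‖z‖
    have := mul_nonneg hω0.le hz0
    rw [abs_le]; constructor <;> linarith
  have hv1 : |v| ≤ 1 / 2 := by
    rw [hv, abs_div, abs_of_pos hqp, div_le_iff₀ hqp, hqτ]
    have := mul_le_mul_of_nonneg_left hzτ.le hω0.le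
    have := mul_nonneg hω0.le hτ0.le
    linarith
  have hd0 : (0 : ℝ) ≤ d := Nat.cast_nonneg d
  have hv' := abs_le.1 hv1
  have hv2 : v ^ 2 ≤ 9 / 64 * (‖z‖ ^ 2 / τ ^ 2) := by
    have h1 : |v| ≤ 3 / 8 * (‖z‖ / τ) := by
      rw [hv, abs_div, abs_of_pos hqp, div_le_iff₀ hqp, hqτ]
      refine hvabs.trans (le_of_eq ?_); field_simp
    rw [← sq_abs]
    refine (pow_le_pow_left₀ (abs_nonneg v) h1 2).trans (le_of_eq ?_)
    field_simp; norm_num; ring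
  have hxzω : ‖x₀ + z‖ ≤ ω := by
    have : 0 < q * (1 - v) := mul_pos hqp (by linarith)
    rw [← hnorm] at this
    nlinarith [norm_nonneg (x₀ + z)]
  have h1 := hmax (x₀ + z) hxzω
  rw [hnorm, mul_pow, mul_left_comm, mul_comm (h x₀)] at h1
  have h2 : h (x₀ + z) * (1 - v) ^ d ≤ h x₀ :=
    le_of_mul_le_mul_left h1 (by positivity)
  have h1v : 0 < (1 - v) ^ d := pow_pos (by linarith) d
  have h3 : h (x₀ + z) ≤ h x₀ * (1 + d * v + Cd * v ^ 2) := by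
    rw [← le_div_iff₀ h1v, div_eq_mul_inv] at h2
    exact h2.trans (mul_le_mul_of_nonneg_left (hquad v hv1) (h0 _))
  have e1 : inner ℝ ((h x₀ * d * 2 / q) • x₀) z = h x₀ * d * (2 * k / q) := by
    rw [inner_smul_left, ← hk]; simp; ring
  have e2 : v = 2 * k / q + ‖z‖ ^ 2 / q := by rw [hv]; ring
  have h4 : ‖z‖ ^ 2 / q ≤ ‖z‖ ^ 2 / τ ^ 2 := by
    refine div_le_div_of_nonneg_left (by positivity) (by positivity) ?_
    rw [hqτ]; nlinarith
  have h5 : Cd * v ^ 2 ≤ Cd * (‖z‖ ^ 2 / τ ^ 2) := by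
    refine mul_le_mul_of_nonneg_left (hv2.trans ?_) hCd
    have : 0 ≤ ‖z‖ ^ 2 / τ ^ 2 := by positivity
    linarith
  have h6 : (d : ℝ) * (‖z‖ ^ 2 / q) ≤ d * (‖z‖ ^ 2 / τ ^ 2) := mul_le_mul_of_nonneg_left h4 hd0
  have h7 : h x₀ * (d * (‖z‖ ^ 2 / q) + Cd * v ^ 2) ≤
      h x₀ * (d * (‖z‖ ^ 2 / τ ^ 2) + Cd * (‖z‖ ^ 2 / τ ^ 2)) :=
    mul_le_mul_of_nonneg_left (add_le_add h6 h5) (h0 _)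
  have e3 : h x₀ * (d + Cd) / τ ^ 2 * ‖z‖ ^ 2 =
      h x₀ * (d * (‖z‖ ^ 2 / τ ^ 2) + Cd * (‖z‖ ^ 2 / τ ^ 2)) := by ring
  have e4 : h x₀ * (1 + d * v + Cd * v ^ 2) - h x₀ =
      h x₀ * d * (2 * k / q) + h x₀ * (d * (‖z‖ ^ 2 / q) + Cd * v ^ 2) := by
    rw [show (d : ℝ) * v = d * (2 * k / q + ‖z‖ ^ 2 / q) from by rw [← e2]]; ring
  rw [e1, e3]
  linarith

set_option maxHeartbeats 1000000 in
theorem exists_sup_bound (hα : 0 < α) (hα2 : α < 2) {κ₀ : ℝ} (hκ₀ : 0 < κ₀) (hκ₁ : κ₀ ≤ 1) :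
    ∃ C : ℝ, 0 < C ∧ ∀ (R : ℝ) (D : Set (EuclideanSpace ℝ (Fin d)))
      (h : EuclideanSpace ℝ (Fin d) → ℝ) (x₁ : EuclideanSpace ℝ (Fin d)), 0 < R → IsOpen D →
      (∀ x, 0 ≤ h x) → AlphaHarmonicOn d α h (D ∩ ball 0 R) → (∀ x ∈ ball 0 R \ D, h x = 0) →
      ContinuousOn h (ball 0 R) → ‖x₁‖ ≤ R → closedBall x₁ (κ₀ * R) ⊆ D ∩ ball 0 R →
      ∀ x, ‖x‖ ≤ R / 2 → h x ≤ C * h x₁ := by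
  obtain ⟨Cd, hCd, hquad⟩ := exists_inv_pow_le_quadratic d
  have hσ := sphereArea_pos d
  have htc := tailConst_pos d hα hα2
  have h2α : 0 < 2 - α := by linarith
  have hd0 : (0 : ℝ) < d := Nat.cast_pos.2 (NeZero.pos d)
  set B : ℝ := d + Cd with hB
  have hBp : 0 < B := by positivity
  obtain ⟨ε, hε0, hε1, hεB⟩ : ∃ ε : ℝ, 0 < ε ∧ ε < 1 ∧ B * ε ^ 2 / (2 - α) ≤ 1 / (2 * α) := by
    refine ⟨min (1 / 2) ((2 - α) / (2 * α * B)), by positivity, ?_, ?_⟩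
    · exact (min_le_left _ _).trans_lt (by norm_num)
    · set e := min (1 / 2) ((2 - α) / (2 * α * B)) with he
      have h0 : 0 < e := by positivity
      have h1 : e ≤ 1 / 2 := min_le_left _ _
      have h2 : e ≤ (2 - α) / (2 * α * B) := min_le_right _ _
      rw [le_div_iff₀ (by positivity)] at h2
      rw [div_le_div_iff₀ h2α (by positivity)]
      nlinarith [mul_pos hα hBp]
  set C' : ℝ := 2 * α / sphereArea d * (tailConst d α * 2 ^ ((d : ℝ) + α) * κ₀ ^ (-α)) / ε ^ d with hC'
  have hC'0 : 0 < C' := by positivity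
  refine ⟨20 ^ d * C', by positivity, ?_⟩
  intro R D h x₁ hR hD h0 hh hz hc hx₁ hball x hx
  set ω : ℝ := 3 * R / 4 with hω
  have hω0 : 0 < ω := by positivity
  set U := D ∩ ball (0 : EuclideanSpace ℝ (Fin d)) R
  have hUo : IsOpen U := hD.inter isOpen_ball
  have hsub : closedBall (0 : EuclideanSpace ℝ (Fin d)) ω ⊆ ball 0 R :=
    closedBall_subset_ball (by rw [hω]; linarith)
  have hcont : ContinuousOn (fun x => h x * (ω ^ 2 - ‖x‖ ^ 2) ^ d) (closedBall 0 ω) :=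
    (hc.mono hsub).mul (by fun_prop)
  obtain ⟨x₀, hx₀, hmax⟩ := (isCompact_closedBall (0 : EuclideanSpace ℝ (Fin d)) ω).exists_isMaxOn
    (nonempty_closedBall.2 hω0.le) hcont
  have hmax : ∀ y : EuclideanSpace ℝ (Fin d), ‖y‖ ≤ ω →
      h y * (ω ^ 2 - ‖y‖ ^ 2) ^ d ≤ h x₀ * (ω ^ 2 - ‖x₀‖ ^ 2) ^ d := fun y hy =>
    hmax (mem_closedBall_zero_iff.2 hy)
  have hx₀n : ‖x₀‖ ≤ ω := mem_closedBall_zero_iff.1 hx₀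
  have hn0 := norm_nonneg x₀
  set q := ω ^ 2 - ‖x₀‖ ^ 2 with hq
  have hq0 : 0 ≤ q := by rw [hq]; nlinarith
  have hgoal : h x₀ * q ^ d ≤ (6 * R) ^ d * C' * R ^ d * h x₁ → h x ≤ 20 ^ d * C' * h x₁ := by
    intro hg
    have hxω : ‖x‖ ≤ ω := by rw [hω]; linarith
    have h1 := (hmax x hxω).trans hg
    have h2 : (5 / 16 * R ^ 2) ^ d ≤ (ω ^ 2 - ‖x‖ ^ 2) ^ d := by
      refine pow_le_pow_left₀ (by positivity) ?_ d
      rw [hω]; nlinarith [norm_nonneg x]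
    have h3 := (mul_le_mul_of_nonneg_left h2 (h0 x)).trans h1
    have h4 : (6 * R) ^ d * C' * R ^ d * h x₁ ≤ (20 ^ d * C' * h x₁) * (5 / 16 * R ^ 2) ^ d := by
      have e1 : (6 * R) ^ d * R ^ d ≤ 20 ^ d * (5 / 16 * R ^ 2) ^ d := by
        rw [← mul_pow, ← mul_pow]
        exact pow_le_pow_left₀ (by positivity) (by nlinarith) d
      have := mul_le_mul_of_nonneg_right e1 (mul_nonneg hC'0.le (h0 x₁))
      linarith
    exact le_of_mul_le_mul_right (h3.trans h4) (by positivity)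
  apply hgoal
  have hrhs : 0 ≤ (6 * R) ^ d * C' * R ^ d * h x₁ := mul_nonneg (by positivity) (h0 _)
  rcases (h0 x₀).eq_or_lt with hx0 | hhx₀
  · rw [← hx0]; simpa using hrhs
  rcases hq0.eq_or_lt with hq0' | hqp
  · rw [← hq0', zero_pow (NeZero.ne d), mul_zero]; exact hrhs
  have hx₀U : x₀ ∈ U := by
    refine ⟨?_, hsub hx₀⟩
    by_contra hcon
    exact hhx₀.ne' (hz x₀ ⟨hsub hx₀, hcon⟩)
  set τ := q / (8 * ω) with hτ
  have hτ0 : 0 < τ := by positivity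
  have hqτ : q = 8 * ω * τ := by rw [hτ]; field_simp
  have hτω : 8 * τ ≤ ω := by
    have : q ≤ ω ^ 2 := by rw [hq]; nlinarith
    rw [hqτ] at this; nlinarith
  have htouch : ∀ z : EuclideanSpace ℝ (Fin d), ‖z‖ < τ → h (x₀ + z) - h x₀ ≤
      inner ℝ ((h x₀ * d * 2 / q) • x₀) z + (h x₀ * B / τ ^ 2) * ‖z‖ ^ 2 :=
    weighted_max_touching hCd hquad h0 hω0 hqp hq hx₀n hτ0 hqτ hτω hmax
  set η := ε * τ with hη
  have hη0 : 0 < η := by positivity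
  have hητ : η < τ := by rw [hη]; nlinarith
  obtain ⟨_, hlow⟩ := hh.touching hα hα2 h0 hUo hx₀U (by positivity) _ htouch hη0 hητ
  have hηR : η ≤ 2 * R := by rw [hω] at hτω; nlinarith
  have hx₀R : ‖x₀ - x₁‖ ≤ 2 * R := by
    refine (norm_sub_le _ _).trans ?_
    rw [hω] at hx₀n; linarith
  obtain ⟨ti, tl⟩ := hh.tail_le hα hα2 h0 (ρ := κ₀ * R) (by positivity) hball hx₀R
    (by nlinarith) hη0 hηR
  obtain ⟨r1, r2⟩ := radial_integral_far (d := d) hα hη0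
  have hspl : ∫ z in {z : EuclideanSpace ℝ (Fin d) | η ≤ ‖z‖},
      (h (x₀ + z) - h x₀) * ‖z‖ ^ (-(d : ℝ) - α) =
      (∫ z in {z : EuclideanSpace ℝ (Fin d) | η ≤ ‖z‖}, h (x₀ + z) * ‖z‖ ^ (-(d : ℝ) - α)) -
        h x₀ * (sphereArea d * (η ^ (-α) / α)) := by
    simp only [sub_mul]
    rw [integral_sub ti (r1.const_mul _), integral_const_mul, r2]
  rw [hspl] at hlow
  have e1 : h x₀ * B / τ ^ 2 * sphereArea d * η ^ (2 - α) / (2 - α) =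
      h x₀ * sphereArea d * η ^ (-α) * (B * ε ^ 2 / (2 - α)) := by
    have : η ^ (2 - α) = η ^ 2 * η ^ (-α) := by
      rw [sub_eq_add_neg, Real.rpow_add hη0]; norm_num
    rw [this, hη]; field_simp
  rw [e1] at hlow
  have hηα : 0 < η ^ (-α) := by positivity
  have h1 : h x₀ * sphereArea d * η ^ (-α) * (B * ε ^ 2 / (2 - α)) ≤
      h x₀ * sphereArea d * η ^ (-α) * (1 / (2 * α)) :=
    mul_le_mul_of_nonneg_left hεB (by positivity)
  have h2 : h x₀ * sphereArea d * η ^ (-α) * (1 / (2 * α)) ≤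
      tailConst d α * (2 * R / η) ^ ((d : ℝ) + α) * (κ₀ * R) ^ (-α) * h x₁ := by
    have : h x₀ * (sphereArea d * (η ^ (-α) / α)) =
        2 * (h x₀ * sphereArea d * η ^ (-α) * (1 / (2 * α))) := by field_simp
    linarith
  have e2 : tailConst d α * (2 * R / η) ^ ((d : ℝ) + α) * (κ₀ * R) ^ (-α) * h x₁ =
      (tailConst d α * 2 ^ ((d : ℝ) + α) * κ₀ ^ (-α)) * R ^ d * (η ^ (-α) / η ^ d) * h x₁ := by
    rw [Real.div_rpow (by positivity) hη0.le, Real.mul_rpow zero_le_two hR.le,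
      Real.mul_rpow hκ₀.le hR.le, Real.rpow_add hR, Real.rpow_add hη0, Real.rpow_neg hR.le,
      Real.rpow_neg hη0.le, Real.rpow_natCast, Real.rpow_natCast]
    have := Real.rpow_pos_of_pos hR α
    have := Real.rpow_pos_of_pos hη0 α
    field_simp
  rw [e2] at h2
  have h3 : h x₀ * τ ^ d ≤ C' * R ^ d * h x₁ := by
    have hηd : 0 < η ^ d := by positivity
    have h4 := mul_le_mul_of_nonneg_right h2
      (by positivity : 0 ≤ 2 * α / sphereArea d * η ^ d / η ^ (-α) / ε ^ d)
    have e3 : h x₀ * sphereArea d * η ^ (-α) * (1 / (2 * α)) *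
        (2 * α / sphereArea d * η ^ d / η ^ (-α) / ε ^ d) = h x₀ * τ ^ d := by
      rw [hη, mul_pow]
      rw [← hη]; field_simp
    have e4 : (tailConst d α * 2 ^ ((d : ℝ) + α) * κ₀ ^ (-α)) * R ^ d * (η ^ (-α) / η ^ d) * h x₁ *
        (2 * α / sphereArea d * η ^ d / η ^ (-α) / ε ^ d) = C' * R ^ d * h x₁ := by
      rw [hC']; field_simp
    rw [e3, e4] at h4; exact h4
  have e5 : h x₀ * q ^ d = (6 * R) ^ d * (h x₀ * τ ^ d) := by
    rw [hqτ, mul_pow, hω, show 8 * (3 * R / 4) = 6 * R from by ring]; ring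
  rw [e5]
  have := mul_le_mul_of_nonneg_left h3 (by positivity : 0 ≤ (6 * R) ^ d)
  linarith
end harmonic

/-- A regular global modulus of continuity, with its constants. -/
structure RegularModulus (ℓ : ℝ → ℝ) (c C : ℝ) : Prop where
  pos : ∀ r : ℝ, 0 < r → 0 < ℓ r
  mono : ∀ s r : ℝ, 0 < s → s ≤ r → ℓ s ≤ ℓ r
  lim : Filter.Tendsto ℓ (nhdsWithin 0 (Set.Ioi 0)) (nhds 0)
  one_le : 1 ≤ c
  almost : ∀ s r : ℝ, 0 < s → s ≤ r → ℓ r / r ≤ c * (ℓ s / s)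
  diff : ∀ r : ℝ, 0 < r → DifferentiableAt ℝ ℓ r
  nonneg_const : 0 < C
  reg : ∀ r : ℝ, 0 < r → r * deriv ℓ r ≤ C * ℓ r

/-- The extension of a modulus of continuity by zero to the nonpositive half-line. -/
noncomputable def modExt (ℓ : ℝ → ℝ) (t : ℝ) : ℝ := if 0 < t then ℓ t else 0

/-- The primitive of `modExt ℓ`. -/
noncomputable def modPrim (ℓ : ℝ → ℝ) (t : ℝ) : ℝ := ∫ u in (0 : ℝ)..t, modExt ℓ u

/-- The weight `exp(-λ ∫_u^R ℓ(v)/v dv)`, extended by zero. -/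
noncomputable def modWeight (ℓ : ℝ → ℝ) (lam R u : ℝ) : ℝ :=
  if 0 < u then Real.exp (-(lam * ∫ v in u..R, ℓ v / v)) else 0

namespace RegularModulus
variable {ℓ : ℝ → ℝ} {c C : ℝ} (H : RegularModulus ℓ c C)
include H

theorem continuousOn : ContinuousOn ℓ (Set.Ioi 0) :=
  fun r hr => (H.diff r hr).continuousAt.continuousWithinAt

theorem modExt_nonneg (t : ℝ) : 0 ≤ modExt ℓ t := by
  unfold modExt; split_ifs with h
  · exact (H.pos t h).le
  · exact le_rfl

theorem modExt_mono : Monotone (modExt ℓ) := by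
  intro s t hst
  by_cases hs : 0 < s
  · simp only [modExt, hs, hs.trans_le hst, if_true]; exact H.mono s t hs hst
  · rw [show modExt ℓ s = 0 from if_neg hs]; exact H.modExt_nonneg t

theorem modExt_le {t r : ℝ} (hr : 0 < r) (ht : t ≤ r) : modExt ℓ t ≤ ℓ r :=
  (H.modExt_mono ht).trans_eq (if_pos hr)

theorem modExt_continuous : Continuous (modExt ℓ) := by
  rw [continuous_iff_continuousAt]
  intro t
  rcases lt_trichotomy t 0 with ht | rfl | ht
  · refine (continuousAt_const (y := (0 : ℝ))).congr ?_
    filter_upwards [Iio_mem_nhds ht] with u hu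
    exact (if_neg (not_lt.2 (le_of_lt hu))).symm
  · have h0 : modExt ℓ 0 = 0 := if_neg (lt_irrefl 0)
    rw [continuousAt_iff_continuous_left_right]
    constructor
    · refine (continuousWithinAt_const (b := (0 : ℝ))).congr ?_ h0
      intro u hu
      exact if_neg (not_lt.2 hu)
    · rw [← continuousWithinAt_Ioi_iff_Ici, ContinuousWithinAt, h0]
      refine H.lim.congr' ?_
      filter_upwards [self_mem_nhdsWithin] with u hu
      exact (if_pos hu).symm
  · refine (H.diff t ht).continuousAt.congr ?_
    filter_upwards [Ioi_mem_nhds ht] with u hu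
    exact (if_pos hu).symm

theorem hasDerivAt_modPrim (t : ℝ) : HasDerivAt (modPrim ℓ) (modExt ℓ t) t :=
  intervalIntegral.integral_hasDerivAt_right (H.modExt_continuous.intervalIntegrable _ _)
    (H.modExt_continuous.stronglyMeasurableAtFilter _ _) H.modExt_continuous.continuousAt

theorem modPrim_continuous : Continuous (modPrim ℓ) :=
  continuous_iff_continuousAt.2 fun t => (H.hasDerivAt_modPrim t).continuousAt

theorem modPrim_sub (s t : ℝ) : modPrim ℓ t - modPrim ℓ s = ∫ u in s..t, modExt ℓ u :=
  intervalIntegral.integral_interval_sub_left (H.modExt_continuous.intervalIntegrable _ _)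
    (H.modExt_continuous.intervalIntegrable _ _)

theorem modPrim_support (s t : ℝ) : modPrim ℓ s + modExt ℓ s * (t - s) ≤ modPrim ℓ t := by
  have h := H.modPrim_sub s t
  have hi : ∀ u v : ℝ, IntervalIntegrable (modExt ℓ) volume u v :=
    fun u v => H.modExt_continuous.intervalIntegrable u v
  rcases le_total s t with hst | hst
  · have := intervalIntegral.integral_mono_on hst (intervalIntegrable_const (c := modExt ℓ s))
      (hi s t) (fun u hu => H.modExt_mono hu.1)
    rw [intervalIntegral.integral_const, smul_eq_mul] at this
    linarith
  · have := intervalIntegral.integral_mono_on hst (hi t s)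
      (intervalIntegrable_const (c := modExt ℓ s)) (fun u hu => H.modExt_mono hu.2)
    rw [intervalIntegral.integral_const, smul_eq_mul] at this
    rw [intervalIntegral.integral_symm] at h
    linarith

omit H in
theorem modPrim_zero : modPrim ℓ 0 = 0 := intervalIntegral.integral_same

theorem modPrim_nonneg (t : ℝ) : 0 ≤ modPrim ℓ t := by
  have h := H.modPrim_support 0 t
  rw [modPrim_zero, show modExt ℓ 0 = 0 from if_neg (lt_irrefl 0)] at h
  linarith

theorem modPrim_le_mul (t : ℝ) : modPrim ℓ t ≤ modExt ℓ t * t := by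
  have h := H.modPrim_support t 0
  rw [modPrim_zero] at h
  linarith

theorem modPrim_le_gEll (t : ℝ) : modPrim ℓ t ≤ gEll ℓ t := by
  refine (H.modPrim_le_mul t).trans_eq ?_
  unfold modExt gEll; split_ifs <;> ring

theorem modPrim_of_nonpos {t : ℝ} (ht : t ≤ 0) : modPrim ℓ t = 0 := by
  refine le_antisymm ((H.modPrim_le_mul t).trans_eq ?_) (H.modPrim_nonneg t)
  rw [show modExt ℓ t = 0 from if_neg (not_lt.2 ht), zero_mul]

theorem modPrim_ge {t u : ℝ} (hu : 0 < u) (ht : u / 4 ≤ t) (htu : t ≤ u) :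
    u * ℓ u / (64 * c) ≤ modPrim ℓ t := by
  have hc : 0 < c := zero_lt_one.trans_le H.one_le
  have ht2 : 0 < t / 2 := by linarith
  have h1 := H.modPrim_support (t / 2) t
  have h2 := H.modPrim_nonneg (t / 2)
  rw [show modExt ℓ (t / 2) = ℓ (t / 2) from if_pos ht2] at h1
  have h3 := H.almost (t / 2) u ht2 (by linarith)
  have h4 : ℓ u / u * (t / 2) / c ≤ ℓ (t / 2) := by
    rw [div_le_iff₀ hc]
    have := mul_le_mul_of_nonneg_right h3 ht2.le
    rw [mul_assoc c, div_mul_cancel₀ _ ht2.ne'] at this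
    linarith
  have h5 : u * ℓ u / (64 * c) ≤ ℓ u / u * (t / 2) / c * (t / 2) := by
    have hℓ := H.pos u hu
    have : ℓ u / u * (t / 2) / c * (t / 2) = ℓ u / (u * c) * (t / 2) ^ 2 := by field_simp
    rw [this]
    have h6 : (u / 8) ^ 2 ≤ (t / 2) ^ 2 := pow_le_pow_left₀ (by positivity) (by linarith) 2
    refine le_trans (le_of_eq ?_) (mul_le_mul_of_nonneg_left h6 (by positivity))
    field_simp; norm_num
  have h7 := mul_le_mul_of_nonneg_right h4 ht2.le
  have : ℓ (t / 2) * (t - t / 2) = ℓ (t / 2) * (t / 2) := by ring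
  linarith

/-- The Bregman divergence of the primitive. -/
theorem modPrim_div_add (t v : ℝ) :
    modPrim ℓ |v| ≤ (modPrim ℓ v - modPrim ℓ t - modExt ℓ t * (v - t)) +
      (modPrim ℓ (-v) - modPrim ℓ t - modExt ℓ t * (-v - t)) := by
  have h := H.modPrim_le_mul t
  have : modPrim ℓ |v| = modPrim ℓ v + modPrim ℓ (-v) := by
    rcases le_total 0 v with hv | hv
    · rw [abs_of_nonneg hv, H.modPrim_of_nonpos (t := -v) (by linarith), add_zero]
    · rw [abs_of_nonpos hv, H.modPrim_of_nonpos (t := v) hv, zero_add]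
  rw [this]
  linarith

theorem intervalIntegrable_div {u R : ℝ} (hu : 0 < u) (hR : 0 < R) :
    IntervalIntegrable (fun v => ℓ v / v) volume u R := by
  refine ContinuousOn.intervalIntegrable ?_
  have hs : Set.uIcc u R ⊆ Set.Ioi 0 := fun v hv => (lt_min hu hR).trans_le hv.1
  exact (H.continuousOn.mono hs).div continuousOn_id fun v hv => (hs hv).ne'

variable {lam R : ℝ}

omit H in
theorem modWeight_pos {u : ℝ} (hu : 0 < u) : 0 < modWeight ℓ lam R u := by
  rw [modWeight, if_pos hu]; exact Real.exp_pos _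

omit H in
theorem modWeight_nonneg (u : ℝ) : 0 ≤ modWeight ℓ lam R u := by
  unfold modWeight; split_ifs
  · exact (Real.exp_pos _).le
  · exact le_rfl

omit H in
theorem modWeight_self (hR : 0 < R) : modWeight ℓ lam R R = 1 := by
  rw [modWeight, if_pos hR, intervalIntegral.integral_same]; simp

theorem hasDerivAt_modWeight (hR : 0 < R) {u : ℝ} (hu : 0 < u) :
    HasDerivAt (modWeight ℓ lam R) (lam * (ℓ u / u) * modWeight ℓ lam R u) u := by
  have hcont : ContinuousOn (fun v => ℓ v / v) (Set.Ioi 0) :=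
    H.continuousOn.div continuousOn_id fun v hv => (ne_of_gt hv)
  have h1 : HasDerivAt (fun u => ∫ v in u..R, ℓ v / v) (-(ℓ u / u)) u :=
    intervalIntegral.integral_hasDerivAt_left (H.intervalIntegrable_div hu hR)
      (hcont.stronglyMeasurableAtFilter isOpen_Ioi u hu) (hcont.continuousAt (Ioi_mem_nhds hu))
  have h2 := ((h1.const_mul lam).neg).exp
  have h3 : HasDerivAt (modWeight ℓ lam R) _ u := h2.congr_of_eventuallyEq (by
    filter_upwards [Ioi_mem_nhds hu] with v hv
    rw [modWeight, if_pos (Set.mem_Ioi.1 hv)]; rfl)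
  refine h3.congr_deriv ?_
  rw [modWeight, if_pos hu]
  simp only [Pi.neg_apply]
  ring

theorem modWeight_mono (hlam : 0 ≤ lam) (hR : 0 < R) : Monotone (modWeight ℓ lam R) := by
  intro s t hst
  by_cases hs : 0 < s
  · have hm : MonotoneOn (modWeight ℓ lam R) (Set.Ioi 0) := by
      refine monotoneOn_of_hasDerivWithinAt_nonneg
        (f' := fun u => lam * (ℓ u / u) * modWeight ℓ lam R u) (convex_Ioi 0)
        (fun u hu => (H.hasDerivAt_modWeight hR hu).continuousAt.continuousWithinAt)
        (fun u hu => ?_) (fun u hu => ?_)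
      · rw [interior_Ioi] at hu
        exact (H.hasDerivAt_modWeight hR hu).hasDerivWithinAt
      · rw [interior_Ioi] at hu
        have := H.pos u hu
        have := modWeight_pos (ℓ := ℓ) (lam := lam) (R := R) hu
        have : 0 < u := hu
        positivity
    exact hm hs (hs.trans_le hst) hst
  · rw [show modWeight ℓ lam R s = 0 from if_neg hs]; exact modWeight_nonneg t

theorem modWeight_le_one (hlam : 0 ≤ lam) (hR : 0 < R) {u : ℝ} (hu : u ≤ R) :
    modWeight ℓ lam R u ≤ 1 :=
  (H.modWeight_mono hlam hR hu).trans_eq (modWeight_self hR)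

theorem modWeight_deriv_le (hlam : 0 ≤ lam) (hR : 0 < R) {r u : ℝ} (hr : 0 < r)
    (hu : r / 2 ≤ u) (hu2 : u ≤ 2 * r) : lam * (ℓ u / u) * modWeight ℓ lam R u ≤
      2 * lam * (ℓ (2 * r) * modWeight ℓ lam R (2 * r)) / r := by
  have hu0 : 0 < u := by linarith
  have h1 : ℓ u * modWeight ℓ lam R u ≤ ℓ (2 * r) * modWeight ℓ lam R (2 * r) :=
    mul_le_mul (H.mono _ _ hu0 hu2) (H.modWeight_mono hlam hR hu2) (modWeight_nonneg _)
      (H.pos _ (by linarith)).le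
  have h2 : u⁻¹ ≤ 2 / r := by
    rw [inv_eq_one_div, div_le_div_iff₀ hu0 hr]; linarith
  have h3 := mul_le_mul h1 h2 (by positivity)
    (mul_nonneg (H.pos (2 * r) (by linarith)).le (modWeight_nonneg _))
  have := mul_le_mul_of_nonneg_left h3 hlam
  calc _ = lam * (ℓ u * modWeight ℓ lam R u * u⁻¹) := by rw [div_eq_mul_inv]; ring
    _ ≤ _ := this
    _ = _ := by ring

theorem modWeight_abs_sub_le (hlam : 0 ≤ lam) (hR : 0 < R) {r u : ℝ} (hr : 0 < r)
    (hu : r / 2 ≤ u) (hu2 : u ≤ 2 * r) : |modWeight ℓ lam R u - modWeight ℓ lam R r| ≤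
      2 * lam * (ℓ (2 * r) * modWeight ℓ lam R (2 * r)) / r * |u - r| := by
  have hpos : ∀ v ∈ Set.Icc (r / 2) (2 * r), 0 < v := fun v hv => by linarith [hv.1]
  have := (convex_Icc (r / 2) (2 * r)).norm_image_sub_le_of_norm_hasDerivWithin_le
    (f := modWeight ℓ lam R) (f' := fun u => lam * (ℓ u / u) * modWeight ℓ lam R u)
    (C := 2 * lam * (ℓ (2 * r) * modWeight ℓ lam R (2 * r)) / r)
    (fun v hv => (H.hasDerivAt_modWeight hR (hpos v hv)).hasDerivWithinAt)
    (fun v hv => by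
      rw [Real.norm_eq_abs, abs_of_nonneg]
      · exact H.modWeight_deriv_le hlam hR hr hv.1 hv.2
      · have := H.pos v (hpos v hv)
        have := modWeight_nonneg (ℓ := ℓ) (lam := lam) (R := R) v
        have := hpos v hv
        positivity)
    (x := r) (y := u) ⟨by linarith, by linarith⟩ ⟨hu, hu2⟩
  simpa only [Real.norm_eq_abs] using this

theorem modWeight_sub_le (hlam : 0 ≤ lam) (hR : 0 < R) {r u : ℝ} (hr : 0 < r)
    (hu : r / 2 ≤ u) (hu2 : u ≤ 2 * r) (hsmall : lam * ℓ (2 * r) ≤ 1) :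
    modWeight ℓ lam R u - modWeight ℓ lam R r ≤
      lam * (ℓ r / r) * modWeight ℓ lam R r * (u - r) +
      2 * lam * (C + 1) * (ℓ (2 * r) * modWeight ℓ lam R (2 * r)) / r ^ 2 * (u - r) ^ 2 := by
  set N := ℓ (2 * r) * modWeight ℓ lam R (2 * r) with hN
  set K := 4 * lam * (C + 1) * N / r ^ 2 with hK
  have hpos : ∀ v ∈ Set.Icc (r / 2) (2 * r), 0 < v := fun v hv => by linarith [hv.1]
  have hd1 : ∀ v : ℝ, 0 < v → HasDerivAt (fun u => modWeight ℓ lam R u - K / 2 * (u - r) ^ 2)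
      (lam * (ℓ v / v) * modWeight ℓ lam R v - K * (v - r)) v := by
    intro v hv
    have := (((hasDerivAt_id v).sub_const r).pow 2).const_mul (K / 2)
    refine ((H.hasDerivAt_modWeight hR hv).sub this).congr_deriv ?_
    simp; ring
  have hd2 : ∀ v : ℝ, 0 < v → HasDerivAt
      (fun v => lam * (ℓ v / v) * modWeight ℓ lam R v - K * (v - r))
      (lam * ((deriv ℓ v * v - ℓ v) / v ^ 2) * modWeight ℓ lam R v +
        lam * (ℓ v / v) * (lam * (ℓ v / v) * modWeight ℓ lam R v) - K) v := by
    intro v hv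
    have h1 := (((H.diff v hv).hasDerivAt.div (hasDerivAt_id v) hv.ne').const_mul lam).mul
      (H.hasDerivAt_modWeight (lam := lam) hR hv)
    have h2 := ((hasDerivAt_id v).sub_const r).const_mul K
    refine (h1.sub h2).congr_deriv ?_
    simp
  have hconc : ConcaveOn ℝ (Set.Icc (r / 2) (2 * r))
      (fun u => modWeight ℓ lam R u - K / 2 * (u - r) ^ 2) := by
    refine concaveOn_of_hasDerivWithinAt2_nonpos (convex_Icc _ _)
      (fun v hv => (hd1 v (hpos v hv)).continuousAt.continuousWithinAt)
      (fun v hv => (hd1 v (hpos v (interior_subset hv))).hasDerivWithinAt)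
      (fun v hv => (hd2 v (hpos v (interior_subset hv))).hasDerivWithinAt) ?_
    intro v hv
    have hv' := interior_subset hv
    have hv0 := hpos v hv'
    have hr1 := H.reg v hv0
    have hℓ := H.pos v hv0
    have hℓ2 := H.mono v (2 * r) hv0 hv'.2
    have hg0 := modWeight_nonneg (ℓ := ℓ) (lam := lam) (R := R) v
    have hg1 := H.modWeight_mono hlam hR hv'.2
    have e1 : lam * ((deriv ℓ v * v - ℓ v) / v ^ 2) * modWeight ℓ lam R v +
        lam * (ℓ v / v) * (lam * (ℓ v / v) * modWeight ℓ lam R v) =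
        lam * (v * deriv ℓ v - ℓ v + ℓ v * (lam * ℓ v)) * modWeight ℓ lam R v * (v ^ 2)⁻¹ := by
      field_simp
    have h1 : lam * ℓ v ≤ 1 := (mul_le_mul_of_nonneg_left hℓ2 hlam).trans hsmall
    have h2 : v * deriv ℓ v - ℓ v + ℓ v * (lam * ℓ v) ≤ (C + 1) * ℓ v := by nlinarith
    have hC := H.nonneg_const
    have h3 : ℓ v * modWeight ℓ lam R v ≤ N :=
      mul_le_mul hℓ2 hg1 hg0 (H.pos _ (by linarith)).le
    have h4 : (v ^ 2)⁻¹ ≤ 4 / r ^ 2 := by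
      rw [inv_eq_one_div, div_le_div_iff₀ (by positivity) (by positivity)]
      nlinarith [hv'.1]
    have h5 : lam * (v * deriv ℓ v - ℓ v + ℓ v * (lam * ℓ v)) * modWeight ℓ lam R v * (v ^ 2)⁻¹ ≤
        lam * (C + 1) * (ℓ v * modWeight ℓ lam R v) * (v ^ 2)⁻¹ := by
      refine mul_le_mul_of_nonneg_right ?_ (by positivity)
      have := mul_le_mul_of_nonneg_right (mul_le_mul_of_nonneg_left h2 hlam) hg0
      linarith
    have h6 : lam * (C + 1) * (ℓ v * modWeight ℓ lam R v) * (v ^ 2)⁻¹ ≤ K := by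
      have : (ℓ v * modWeight ℓ lam R v) * (v ^ 2)⁻¹ ≤ N * (4 / r ^ 2) :=
        mul_le_mul h3 h4 (by positivity) ((mul_nonneg hℓ.le hg0).trans h3)
      have := mul_le_mul_of_nonneg_left this (by positivity : 0 ≤ lam * (C + 1))
      calc _ = lam * (C + 1) * (ℓ v * modWeight ℓ lam R v * (v ^ 2)⁻¹) := by ring
        _ ≤ _ := this
        _ = _ := by rw [hK]; ring
    linarith
  have hmem : r ∈ Set.Icc (r / 2) (2 * r) := ⟨by linarith, by linarith⟩
  have key : modWeight ℓ lam R u - K / 2 * (u - r) ^ 2 ≤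
      modWeight ℓ lam R r + lam * (ℓ r / r) * modWeight ℓ lam R r * (u - r) := by
    have hd := hd1 r hr
    rw [sub_self, mul_zero, sub_zero] at hd
    rcases lt_trichotomy u r with hur | rfl | hur
    · have h := hconc.le_slope_of_hasDerivAt ⟨hu, hu2⟩ hmem hur hd
      rw [slope_def_field, le_div_iff₀ (by linarith)] at h
      simp only [sub_self] at h
      linarith
    · simp
    · have h := hconc.slope_le_of_hasDerivAt hmem ⟨hu, hu2⟩ hur hd
      rw [slope_def_field, div_le_iff₀ (by linarith)] at h
      simp only [sub_self] at h
      linarith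
  have : K / 2 = 2 * lam * (C + 1) * N / r ^ 2 := by rw [hK]; ring
  rw [← this]
  linarith
end RegularModulus

namespace RegularModulus
variable {ℓ : ℝ → ℝ} {c C : ℝ} (H : RegularModulus ℓ c C) {lam R a r : ℝ}
include H

theorem continuousOn_weight (hR : 0 < R) :
    ContinuousOn (fun u => u⁻¹ * (u ^ (-a) * (ℓ u * modWeight ℓ lam R u))) (Set.Ioi 0) := by
  intro u hu
  have hu0 : u ≠ 0 := ne_of_gt hu
  exact ((continuousAt_inv₀ hu0).mul ((Real.continuousAt_rpow_const u (-a) (Or.inl hu0)).mul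
    ((H.diff u hu).continuousAt.mul (H.hasDerivAt_modWeight hR hu).continuousAt))).continuousWithinAt

theorem intervalIntegrable_weight (hR : 0 < R) {s t : ℝ} (hs : 0 < s) (ht : 0 < t) :
    IntervalIntegrable (fun u => u⁻¹ * (u ^ (-a) * (ℓ u * modWeight ℓ lam R u))) volume s t :=
  ContinuousOn.intervalIntegrable ((H.continuousOn_weight hR).mono
    fun _ hv => (lt_min hs ht).trans_le hv.1)

theorem le_integral_weight (hlam : 0 ≤ lam) (ha : 0 ≤ a) (ha1 : a ≤ 1) (hr : 0 < r)
    (hrR : 4 * r ≤ R) : ℓ (2 * r) * modWeight ℓ lam R (2 * r) * r ^ (-a) ≤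
      8 * ∫ u in (2 * r)..R, u⁻¹ * (u ^ (-a) * (ℓ u * modWeight ℓ lam R u)) := by
  have hR : 0 < R := by linarith
  have h2r : 0 < 2 * r := by linarith
  have h4r : 0 < 4 * r := by linarith
  set N := ℓ (2 * r) * modWeight ℓ lam R (2 * r) with hN
  have hN0 : 0 ≤ N := mul_nonneg (H.pos _ h2r).le (modWeight_nonneg _)
  have h1 := intervalIntegral.integral_mono_on (by linarith : 2 * r ≤ 4 * r)
    (intervalIntegrable_const (c := (4 * r)⁻¹ * ((4 * r) ^ (-a) * N)))
    (H.intervalIntegrable_weight (lam := lam) (a := a) hR h2r h4r) (fun u hu => by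
      have hu0 : 0 < u := h2r.trans_le hu.1
      have e1 : (4 * r)⁻¹ ≤ u⁻¹ := inv_anti₀ hu0 hu.2
      have e2 : (4 * r) ^ (-a) ≤ u ^ (-a) := Real.rpow_le_rpow_of_nonpos hu0 hu.2 (by linarith)
      have e3 : N ≤ ℓ u * modWeight ℓ lam R u := mul_le_mul (H.mono _ _ h2r hu.1)
        (H.modWeight_mono hlam hR hu.1) (modWeight_nonneg _) (H.pos _ hu0).le
      gcongr)
  have h2 : 0 ≤ ∫ u in (4 * r)..R, u⁻¹ * (u ^ (-a) * (ℓ u * modWeight ℓ lam R u)) :=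
    intervalIntegral.integral_nonneg hrR fun u hu => by
      have hu0 : 0 < u := h4r.trans_le hu.1
      have := H.pos u hu0
      have := modWeight_nonneg (ℓ := ℓ) (lam := lam) (R := R) u
      positivity
  have h3 := intervalIntegral.integral_add_adjacent_intervals
    (H.intervalIntegrable_weight (lam := lam) (a := a) hR h2r h4r)
    (H.intervalIntegrable_weight (lam := lam) (a := a) hR h4r hR)
  rw [intervalIntegral.integral_const, smul_eq_mul] at h1
  have h4 : N * r ^ (-a) ≤ 8 * ((4 * r - 2 * r) * ((4 * r)⁻¹ * ((4 * r) ^ (-a) * N))) := by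
    rw [Real.mul_rpow (by norm_num) hr.le]
    have : (1 / 4 : ℝ) ≤ 4 ^ (-a) := by
      rw [show (1 / 4 : ℝ) = 4 ^ (-1 : ℝ) from by rw [Real.rpow_neg_one]; norm_num]
      exact Real.rpow_le_rpow_of_exponent_le (by norm_num) (by linarith)
    have e : 8 * ((4 * r - 2 * r) * ((4 * r)⁻¹ * (4 ^ (-a) * r ^ (-a) * N))) =
        4 * 4 ^ (-a) * (N * r ^ (-a)) := by field_simp; ring
    rw [e]
    have : 0 ≤ N * r ^ (-a) := by positivity
    nlinarith
  linarith

theorem integral_weight_le (hlam : 0 ≤ lam) (ha : 0 ≤ a) (ha1 : a ≤ 1) (hr : 0 < r)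
    (hrR : 4 * r ≤ R) :
    ∫ u in r..R, u⁻¹ * (u ^ (-a) * (ℓ u * modWeight ℓ lam R u)) ≤
      9 * ∫ u in (2 * r)..R, u⁻¹ * (u ^ (-a) * (ℓ u * modWeight ℓ lam R u)) := by
  have hR : 0 < R := by linarith
  have h2r : 0 < 2 * r := by linarith
  have h0 := H.le_integral_weight hlam ha ha1 hr hrR
  set N := ℓ (2 * r) * modWeight ℓ lam R (2 * r) with hN
  have h1 := intervalIntegral.integral_mono_on (by linarith : r ≤ 2 * r)
    (H.intervalIntegrable_weight (lam := lam) (a := a) hR hr h2r)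
    (intervalIntegrable_const (c := r⁻¹ * (r ^ (-a) * N))) (fun u hu => by
      have hu0 : 0 < u := hr.trans_le hu.1
      have e1 : u⁻¹ ≤ r⁻¹ := inv_anti₀ hr hu.1
      have e2 : u ^ (-a) ≤ r ^ (-a) := Real.rpow_le_rpow_of_nonpos hr hu.1 (by linarith)
      have e3 : ℓ u * modWeight ℓ lam R u ≤ N := mul_le_mul (H.mono _ _ hu0 hu.2)
        (H.modWeight_mono hlam hR hu.2) (modWeight_nonneg _) (H.pos _ h2r).le
      have e4 : 0 ≤ ℓ u * modWeight ℓ lam R u :=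
        mul_nonneg (H.pos _ hu0).le (modWeight_nonneg _)
      gcongr)
  rw [intervalIntegral.integral_const, smul_eq_mul] at h1
  have h3 := intervalIntegral.integral_add_adjacent_intervals
    (H.intervalIntegrable_weight (lam := lam) (a := a) hR hr h2r)
    (H.intervalIntegrable_weight (lam := lam) (a := a) hR h2r hR)
  have h4 : (2 * r - r) * (r⁻¹ * (r ^ (-a) * N)) = N * r ^ (-a) := by field_simp; ring
  linarith

theorem intervalIntegrable_weight_sub (hR : 0 < R) (hr : 0 < r) :
    IntervalIntegrable (fun u => u⁻¹ * (u ^ (-a) * (modWeight ℓ lam R u - modWeight ℓ lam R r)))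
      volume r R := by
  refine ContinuousOn.intervalIntegrable fun u hu => ?_
  have hu0 : 0 < u := (lt_min hr hR).trans_le hu.1
  exact ((continuousAt_inv₀ hu0.ne').mul ((Real.continuousAt_rpow_const u (-a)
    (Or.inl hu0.ne')).mul ((H.hasDerivAt_modWeight hR hu0).continuousAt.sub
      continuousAt_const))).continuousWithinAt

theorem integral_weight_sub_le (hlam : 0 ≤ lam) (ha : 0 < a) (ha1 : a ≤ 1) (hr : 0 < r)
    (hrR : 4 * r ≤ R) :
    ∫ u in r..R, u⁻¹ * (u ^ (-a) * (modWeight ℓ lam R u - modWeight ℓ lam R r)) ≤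
      9 * lam / a * (∫ u in (2 * r)..R, u⁻¹ * (u ^ (-a) * (ℓ u * modWeight ℓ lam R u))) -
        R ^ (-a) * (1 - modWeight ℓ lam R r) / a := by
  have hR : 0 < R := by linarith
  set g := modWeight ℓ lam R with hg
  have hd : ∀ u ∈ Set.uIcc r R, HasDerivAt (fun u => -(u ^ (-a) * (g u - g r)) / a)
      (u⁻¹ * (u ^ (-a) * (g u - g r)) - lam / a * (u⁻¹ * (u ^ (-a) * (ℓ u * g u)))) u := by
    intro u hu
    have hu0 : 0 < u := (lt_min hr hR).trans_le hu.1
    have := (((Real.hasDerivAt_rpow_const (p := -a) (Or.inl hu0.ne')).mul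
      ((H.hasDerivAt_modWeight (lam := lam) hR hu0).sub_const (g r))).neg).div_const a
    refine this.congr_deriv ?_
    rw [Real.rpow_sub_one hu0.ne']
    field_simp
    ring
  have i1 := H.intervalIntegrable_weight_sub (lam := lam) (a := a) hR hr
  have i2 := (H.intervalIntegrable_weight (lam := lam) (a := a) hR hr hR).const_mul (lam / a)
  have h1 := intervalIntegral.integral_eq_sub_of_hasDerivAt hd (i1.sub i2)
  rw [intervalIntegral.integral_sub i1 i2, intervalIntegral.integral_const_mul,
    show g R = 1 from modWeight_self hR] at h1
  have h2 := mul_le_mul_of_nonneg_left (H.integral_weight_le hlam ha.le ha1 hr hrR)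
    (div_nonneg hlam ha.le)
  simp only [sub_self, mul_zero, neg_zero, zero_div, sub_zero] at h1
  rw [← hg] at h2
  have e : 9 * lam / a * (∫ u in (2 * r)..R, u⁻¹ * (u ^ (-a) * (ℓ u * g u))) =
    lam / a * (9 * ∫ u in (2 * r)..R, u⁻¹ * (u ^ (-a) * (ℓ u * g u))) := by ring
  rw [e]
  have e2 : -(R ^ (-a) * (1 - g r)) / a = -(R ^ (-a) * (1 - g r) / a) := by ring
  rw [e2] at h1
  linarith
end RegularModulus

section integrals
variable {d : ℕ} [NeZero d] {a : ℝ}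

/-- A quadratic-type majorant inside a ball, constant outside. -/
noncomputable def nearMajorant (a ρ : ℝ) (b : EuclideanSpace ℝ (Fin d)) (A B D : ℝ)
    (z : EuclideanSpace ℝ (Fin d)) : ℝ :=
  if ‖z‖ < ρ then inner ℝ b z + A * ‖z‖ ^ 2 + B * ‖z‖ ^ (1 + a) else D

theorem integral_inner_annulus (ha : 0 < a) (b : EuclideanSpace ℝ (Fin d)) {η ρ : ℝ} (hη : 0 < η) :
    IntegrableOn (fun z : EuclideanSpace ℝ (Fin d) => inner ℝ b z * ‖z‖ ^ (-(d : ℝ) - 2 * a))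
      {z | ‖z‖ ∈ Set.Ico η ρ} ∧
    ∫ z in {z : EuclideanSpace ℝ (Fin d) | ‖z‖ ∈ Set.Ico η ρ},
      inner ℝ b z * ‖z‖ ^ (-(d : ℝ) - 2 * a) = 0 := by
  have hm : MeasurableSet {z : EuclideanSpace ℝ (Fin d) | ‖z‖ ∈ Set.Ico η ρ} :=
    measurable_norm measurableSet_Ico
  constructor
  · have h1 := (radial_integral_far (d := d) (by linarith : 0 < 2 * a) hη).1
    have h2 := (h1.mono_set (s := {z : EuclideanSpace ℝ (Fin d) | ‖z‖ ∈ Set.Ico η ρ})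
      (fun z hz => hz.1)).const_mul (‖b‖ * ρ)
    refine Integrable.mono' h2 (by fun_prop) ?_
    filter_upwards [ae_restrict_mem hm] with z hz
    rw [norm_mul, Real.norm_of_nonneg (r := ‖z‖ ^ (-(d : ℝ) - 2 * a)) (by positivity)]
    exact mul_le_mul_of_nonneg_right ((norm_inner_le_norm b z).trans
      (mul_le_mul_of_nonneg_left hz.2.le (norm_nonneg b))) (by positivity)
  · have h := (Measure.measurePreserving_neg
      (volume : Measure (EuclideanSpace ℝ (Fin d)))).setIntegral_preimage_emb
      (MeasurableEquiv.neg (EuclideanSpace ℝ (Fin d))).measurableEmbedding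
      (fun z => inner ℝ b z * ‖z‖ ^ (-(d : ℝ) - 2 * a)) {z | ‖z‖ ∈ Set.Ico η ρ}
    have e : (Neg.neg : EuclideanSpace ℝ (Fin d) → _) ⁻¹' {z | ‖z‖ ∈ Set.Ico η ρ} =
        {z | ‖z‖ ∈ Set.Ico η ρ} := by ext z; simp
    rw [e] at h
    simp only [norm_neg, inner_neg_right, neg_mul, integral_neg] at h
    linarith

theorem nearMajorant_integral_le (ha : 0 < a) (ha1 : a < 1) (b : EuclideanSpace ℝ (Fin d))
    {A B D η ρ : ℝ} (hA : 0 ≤ A) (hB : 0 ≤ B) (hD : 0 ≤ D) (hη : 0 < η) (hρ : 0 < ρ) :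
    IntegrableOn (fun z : EuclideanSpace ℝ (Fin d) =>
      nearMajorant a ρ b A B D z * ‖z‖ ^ (-(d : ℝ) - 2 * a)) {z | η ≤ ‖z‖} ∧
    ∫ z in {z : EuclideanSpace ℝ (Fin d) | η ≤ ‖z‖},
      nearMajorant a ρ b A B D z * ‖z‖ ^ (-(d : ℝ) - 2 * a) ≤
      sphereArea d * (A * (ρ ^ (2 - 2 * a) / (2 - 2 * a)) + B * (ρ ^ (1 - a) / (1 - a)) +
        D * (ρ ^ (-(2 * a)) / (2 * a))) := by
  obtain ⟨i1, j1⟩ := integral_inner_annulus ha b (ρ := ρ) hη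
  obtain ⟨i2, j2⟩ := radial_integral_near (d := d) (by linarith : 0 < 2 - 2 * a) hρ
  obtain ⟨i3, j3⟩ := radial_integral_near (d := d) (by linarith : 0 < 1 - a) hρ
  obtain ⟨i4, j4⟩ := radial_integral_far (d := d) (by linarith : 0 < 2 * a) hρ
  have m1 : MeasurableSet {z : EuclideanSpace ℝ (Fin d) | ‖z‖ ∈ Set.Ico η ρ} :=
    measurable_norm measurableSet_Ico
  have m2 : MeasurableSet {z : EuclideanSpace ℝ (Fin d) | ‖z‖ ∈ Set.Ioo 0 ρ} :=
    measurable_norm measurableSet_Ioo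
  have m4 : MeasurableSet {z : EuclideanSpace ℝ (Fin d) | ρ ≤ ‖z‖} := measurableSet_le_norm
  have mE : MeasurableSet {z : EuclideanSpace ℝ (Fin d) | η ≤ ‖z‖} := measurableSet_le_norm
  set f1 := {z : EuclideanSpace ℝ (Fin d) | ‖z‖ ∈ Set.Ico η ρ}.indicator
    (fun z => inner ℝ b z * ‖z‖ ^ (-(d : ℝ) - 2 * a)) with hf1
  set f2 := {z : EuclideanSpace ℝ (Fin d) | ‖z‖ ∈ Set.Ioo 0 ρ}.indicator
    (fun z => ‖z‖ ^ (-(d : ℝ) + (2 - 2 * a))) with hf2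
  set f3 := {z : EuclideanSpace ℝ (Fin d) | ‖z‖ ∈ Set.Ioo 0 ρ}.indicator
    (fun z => ‖z‖ ^ (-(d : ℝ) + (1 - a))) with hf3
  set f4 := {z : EuclideanSpace ℝ (Fin d) | ρ ≤ ‖z‖}.indicator
    (fun z => ‖z‖ ^ (-(d : ℝ) - 2 * a)) with hf4
  have k1 : Integrable f1 := (integrable_indicator_iff m1).2 i1
  have k2 : Integrable f2 := (integrable_indicator_iff m2).2 i2
  have k3 : Integrable f3 := (integrable_indicator_iff m2).2 i3
  have k4 : Integrable f4 := (integrable_indicator_iff m4).2 i4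
  have heq : Set.EqOn (fun z : EuclideanSpace ℝ (Fin d) =>
      nearMajorant a ρ b A B D z * ‖z‖ ^ (-(d : ℝ) - 2 * a))
      (fun z => f1 z + A * f2 z + B * f3 z + D * f4 z) {z | η ≤ ‖z‖} := by
    intro z hz
    have hz0 : 0 < ‖z‖ := lt_of_lt_of_le hη hz
    beta_reduce
    by_cases hzρ : ‖z‖ < ρ
    · have e1 : f1 z = inner ℝ b z * ‖z‖ ^ (-(d : ℝ) - 2 * a) := by
        rw [hf1, Set.indicator_of_mem]; exact ⟨hz, hzρ⟩
      have e2 : f2 z = ‖z‖ ^ (-(d : ℝ) + (2 - 2 * a)) := by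
        rw [hf2, Set.indicator_of_mem]; exact ⟨hz0, hzρ⟩
      have e3 : f3 z = ‖z‖ ^ (-(d : ℝ) + (1 - a)) := by
        rw [hf3, Set.indicator_of_mem]; exact ⟨hz0, hzρ⟩
      have e4 : f4 z = 0 := by
        rw [hf4, Set.indicator_of_notMem]; exact not_le.2 hzρ
      rw [e1, e2, e3, e4, nearMajorant, if_pos hzρ,
        show -(d : ℝ) + (2 - 2 * a) = 2 + (-d - 2 * a) from by ring,
        show -(d : ℝ) + (1 - a) = (1 + a) + (-d - 2 * a) from by ring, Real.rpow_add hz0 2,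
        Real.rpow_add hz0 (1 + a), Real.rpow_two]
      ring
    · have e1 : f1 z = 0 := Set.indicator_of_notMem (fun h => hzρ h.2) _
      have e2 : f2 z = 0 := Set.indicator_of_notMem (fun h => hzρ h.2) _
      have e3 : f3 z = 0 := Set.indicator_of_notMem (fun h => hzρ h.2) _
      have e4 : f4 z = ‖z‖ ^ (-(d : ℝ) - 2 * a) := by
        rw [hf4, Set.indicator_of_mem]; exact not_lt.1 hzρ
      rw [e1, e2, e3, e4, nearMajorant, if_neg hzρ]
      ring
  have hI := (((k1.add (k2.const_mul A)).add (k3.const_mul B)).add (k4.const_mul D))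
  refine ⟨(integrableOn_congr_fun heq mE).2 hI.integrableOn, ?_⟩
  rw [setIntegral_congr_fun mE heq]
  have g1 : ∫ z in {z : EuclideanSpace ℝ (Fin d) | η ≤ ‖z‖}, f1 z = 0 := by
    rw [setIntegral_indicator m1]
    rwa [Set.inter_eq_self_of_subset_right (fun z hz => hz.1)]
  have nn : ∀ {f : EuclideanSpace ℝ (Fin d) → ℝ}, Integrable f → (∀ z, 0 ≤ f z) →
      ∫ z in {z : EuclideanSpace ℝ (Fin d) | η ≤ ‖z‖}, f z ≤ ∫ z, f z := fun hf h0 =>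
    setIntegral_le_integral hf (Filter.Eventually.of_forall h0)
  have g2 := nn k2 (fun z => Set.indicator_nonneg (fun z _ => by positivity) z)
  have g3 := nn k3 (fun z => Set.indicator_nonneg (fun z _ => by positivity) z)
  have g4 := nn k4 (fun z => Set.indicator_nonneg (fun z _ => by positivity) z)
  rw [show ∫ z, f2 z = _ from (integral_indicator m2).trans j2] at g2
  rw [show ∫ z, f3 z = _ from (integral_indicator m2).trans j3] at g3
  rw [show ∫ z, f4 z = _ from (integral_indicator m4).trans j4] at g4
  have l1 := k1.integrableOn (s := {z : EuclideanSpace ℝ (Fin d) | η ≤ ‖z‖})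
  have l2 := (k2.const_mul A).integrableOn (s := {z : EuclideanSpace ℝ (Fin d) | η ≤ ‖z‖})
  have l3 := (k3.const_mul B).integrableOn (s := {z : EuclideanSpace ℝ (Fin d) | η ≤ ‖z‖})
  have l4 := (k4.const_mul D).integrableOn (s := {z : EuclideanSpace ℝ (Fin d) | η ≤ ‖z‖})
  have s1 := integral_add ((l1.add l2).add l3) l4
  have s2 := integral_add (l1.add l2) l3
  have s3 := integral_add l1 l2
  simp only [Pi.add_apply] at s1 s2 s3
  rw [s1, s2, s3]
  rw [g1, integral_const_mul, integral_const_mul, integral_const_mul]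
  have := mul_le_mul_of_nonneg_left g2 hA
  have := mul_le_mul_of_nonneg_left g3 hB
  have := mul_le_mul_of_nonneg_left g4 hD
  linarith

/-- Reflection of one coordinate. -/
noncomputable def coordReflection (i : Fin d) :
    EuclideanSpace ℝ (Fin d) ≃ₗᵢ[ℝ] EuclideanSpace ℝ (Fin d) :=
  LinearIsometryEquiv.piLpCongrRight 2
    fun k => if k = i then LinearIsometryEquiv.neg ℝ else LinearIsometryEquiv.refl ℝ ℝ

omit [NeZero d] in
theorem coordReflection_same (i : Fin d) (z : EuclideanSpace ℝ (Fin d)) :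
    coordReflection i z i = -z i := by
  simp [coordReflection]

omit [NeZero d] in
theorem coordReflection_ne {i k : Fin d} (h : k ≠ i) (z : EuclideanSpace ℝ (Fin d)) :
    coordReflection i z k = z k := by
  simp [coordReflection, h]

omit [NeZero d] in
theorem setIntegral_coordReflection (i : Fin d) (f : EuclideanSpace ℝ (Fin d) → ℝ)
    {S : Set (EuclideanSpace ℝ (Fin d))} (hS : (coordReflection i) ⁻¹' S = S) :
    ∫ z in S, f (coordReflection i z) = ∫ z in S, f z := by
  have h := (coordReflection i).measurePreserving.setIntegral_preimage_emb
    (coordReflection i).toHomeomorph.measurableEmbedding f S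
  rwa [hS] at h

omit [NeZero d] in
theorem integrableOn_coordReflection (i : Fin d) {f : EuclideanSpace ℝ (Fin d) → ℝ}
    {S : Set (EuclideanSpace ℝ (Fin d))} (hS : (coordReflection i) ⁻¹' S = S)
    (hf : IntegrableOn f S) : IntegrableOn (fun z => f (coordReflection i z)) S := by
  have h := ((coordReflection i).measurePreserving.integrableOn_comp_preimage
    (coordReflection i).toHomeomorph.measurableEmbedding (f := f) (s := S)).2 hf
  rwa [hS] at h

end integrals

namespace RegularModulus
variable {d : ℕ} [NeZero d] {ℓ : ℝ → ℝ} {c C : ℝ} (H : RegularModulus ℓ c C) {lam R a r : ℝ}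
include H

theorem integral_weight_annulus (hr : 0 < r) (hrR : r ≤ R) :
    IntegrableOn (fun y : EuclideanSpace ℝ (Fin d) => ‖y‖ ^ (-(d : ℝ)) *
      (‖y‖ ^ (-a) * (modWeight ℓ lam R ‖y‖ - modWeight ℓ lam R r))) {y | ‖y‖ ∈ Set.Ioc r R} ∧
    ∫ y in {y : EuclideanSpace ℝ (Fin d) | ‖y‖ ∈ Set.Ioc r R}, ‖y‖ ^ (-(d : ℝ)) *
      (‖y‖ ^ (-a) * (modWeight ℓ lam R ‖y‖ - modWeight ℓ lam R r)) =
    sphereArea d * ∫ u in r..R, u⁻¹ * (u ^ (-a) * (modWeight ℓ lam R u - modWeight ℓ lam R r)) := by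
  have h := radial_integral (d := d)
    (fun t => t ^ (-a) * (modWeight ℓ lam R t - modWeight ℓ lam R r)) (S := Set.Ioc r R)
    measurableSet_Ioc (fun t ht => hr.trans ht.1)
  refine ⟨h.1.2 ((intervalIntegrable_iff_integrableOn_Ioc_of_le hrR).1
    (H.intervalIntegrable_weight_sub (hr.trans_le hrR) hr)), ?_⟩
  rw [intervalIntegral.integral_of_le hrR]
  exact h.2

/-- The Bregman divergence of the primitive of a modulus is nonnegative. -/
theorem modPrim_div_nonneg (t v : ℝ) :
    0 ≤ modPrim ℓ v - modPrim ℓ t - modExt ℓ t * (v - t) := by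
  linarith [H.modPrim_support t v]

theorem exists_integral_div_ge {i j : Fin d} (hij : i ≠ j) : ∃ κ : ℝ, 0 < κ ∧
    ∀ lam R r t : ℝ, 0 ≤ lam → 0 < r → 2 * r ≤ R →
    IntegrableOn (fun y : EuclideanSpace ℝ (Fin d) => ‖y‖ ^ (-(d : ℝ)) * (‖y‖ ^ (-a - 1) *
      (modPrim ℓ (y i) - modPrim ℓ t - modExt ℓ t * (y i - t)) * modWeight ℓ lam R ‖y‖))
      {y | ‖y‖ ∈ Set.Ioc (2 * r) R ∧ ‖y‖ / 2 ≤ y j} ∧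
    κ * ∫ u in (2 * r)..R, u⁻¹ * (u ^ (-a) * (ℓ u * modWeight ℓ lam R u)) ≤
      ∫ y in {y : EuclideanSpace ℝ (Fin d) | ‖y‖ ∈ Set.Ioc (2 * r) R ∧ ‖y‖ / 2 ≤ y j},
        ‖y‖ ^ (-(d : ℝ)) * (‖y‖ ^ (-a - 1) *
        (modPrim ℓ (y i) - modPrim ℓ t - modExt ℓ t * (y i - t)) * modWeight ℓ lam R ‖y‖) := by
  obtain ⟨κ, hκ, hcone⟩ := exists_integral_coordCone hij
  have hc : 0 < c := zero_lt_one.trans_le H.one_le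
  refine ⟨κ / (128 * c), by positivity, ?_⟩
  intro lam R r t hlam hr hrR
  have hR : 0 < R := by linarith
  set A : Set (EuclideanSpace ℝ (Fin d)) := {y | ‖y‖ ∈ Set.Ioc (2 * r) R ∧ ‖y‖ / 2 ≤ y j} with hA
  set F : EuclideanSpace ℝ (Fin d) → ℝ := fun y => ‖y‖ ^ (-(d : ℝ)) * (‖y‖ ^ (-a - 1) *
    (modPrim ℓ (y i) - modPrim ℓ t - modExt ℓ t * (y i - t)) * modWeight ℓ lam R ‖y‖) with hF
  have hAm : MeasurableSet A := (measurable_norm measurableSet_Ioc).inter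
    (measurableSet_le (f := fun z : EuclideanSpace ℝ (Fin d) => ‖z‖ / 2) (g := fun z => z j)
      (by fun_prop) (by fun_prop))
  have hFA : IntegrableOn F A := by
    have hcl : IsClosed {y : EuclideanSpace ℝ (Fin d) | 2 * r ≤ ‖y‖} :=
      isClosed_le continuous_const continuous_norm
    have hcpt : IsCompact (closedBall (0 : EuclideanSpace ℝ (Fin d)) R ∩ {y | 2 * r ≤ ‖y‖}) :=
      (isCompact_closedBall 0 R).inter_right hcl
    have hsubA : A ⊆ closedBall (0 : EuclideanSpace ℝ (Fin d)) R ∩ {y | 2 * r ≤ ‖y‖} :=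
      fun y hy => ⟨mem_closedBall_zero_iff.2 hy.1.2, hy.1.1.le⟩
    refine IntegrableOn.mono_set (ContinuousOn.integrableOn_compact hcpt ?_) hsubA
    intro y hy
    have hy0 : 0 < ‖y‖ := lt_of_lt_of_le (by linarith) hy.2
    have h1 : ContinuousAt (fun y : EuclideanSpace ℝ (Fin d) => ‖y‖ ^ (-(d : ℝ))) y :=
      continuous_norm.continuousAt.rpow_const (Or.inl hy0.ne')
    have h2 : ContinuousAt (fun y : EuclideanSpace ℝ (Fin d) => ‖y‖ ^ (-a - 1)) y :=
      continuous_norm.continuousAt.rpow_const (Or.inl hy0.ne')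
    have h3 : ContinuousAt (fun y : EuclideanSpace ℝ (Fin d) => modWeight ℓ lam R ‖y‖) y :=
      (H.hasDerivAt_modWeight (lam := lam) hR hy0).continuousAt.comp continuous_norm.continuousAt
    have h4 : Continuous (fun y : EuclideanSpace ℝ (Fin d) =>
        modPrim ℓ (y i) - modPrim ℓ t - modExt ℓ t * (y i - t)) := by
      have := H.modPrim_continuous
      fun_prop
    exact (h1.mul ((h2.mul h4.continuousAt).mul h3)).continuousWithinAt
  refine ⟨hFA, ?_⟩
  have hpre : (coordReflection i) ⁻¹' A = A := by
    ext y
    simp only [hA, Set.mem_preimage, Set.mem_ofPred_eq, LinearIsometryEquiv.norm_map,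
      coordReflection_ne hij.symm]
  have hFr := integrableOn_coordReflection i hpre hFA
  have hint := setIntegral_coordReflection i F hpre
  have hii : IntegrableOn (fun u => u⁻¹ * (u ^ (-a) * (ℓ u * modWeight ℓ lam R u)))
      (Set.Ioc (2 * r) R) := (intervalIntegrable_iff_integrableOn_Ioc_of_le hrR).1
    (H.intervalIntegrable_weight hR (by linarith) hR)
  obtain ⟨c1, c2⟩ := hcone (Set.Ioc (2 * r) R) (fun u => u ^ (-a) * (ℓ u * modWeight ℓ lam R u))
    measurableSet_Ioc (fun u hu => lt_trans (by linarith) hu.1) hii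
  rw [intervalIntegral.integral_of_le hrR]
  have hsub : coordCone i j ∩ {z | ‖z‖ ∈ Set.Ioc (2 * r) R} ⊆ A := fun y hy => ⟨hy.2, hy.1.1⟩
  have hFnn : ∀ y, 0 ≤ F y := fun y => mul_nonneg (by positivity)
    (mul_nonneg (mul_nonneg (by positivity) (H.modPrim_div_nonneg t _)) (modWeight_nonneg _))
  have hmc : MeasurableSet (coordCone i j ∩ {z : EuclideanSpace ℝ (Fin d) |
      ‖z‖ ∈ Set.Ioc (2 * r) R}) :=
    (measurableSet_coordCone i j).inter (measurable_norm measurableSet_Ioc)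
  have h1 : ∫ z in coordCone i j ∩ {z | ‖z‖ ∈ Set.Ioc (2 * r) R},
      (‖z‖ ^ (-(d : ℝ)) * (‖z‖ ^ (-a) * (ℓ ‖z‖ * modWeight ℓ lam R ‖z‖))) * (1 / (64 * c)) ≤
      ∫ z in coordCone i j ∩ {z | ‖z‖ ∈ Set.Ioc (2 * r) R}, (F z + F (coordReflection i z)) := by
    refine setIntegral_mono_on (c1.mul_const _) ((hFA.add hFr).mono_set hsub) hmc ?_
    intro y hy
    have hy0 : 0 < ‖y‖ := lt_trans (by linarith) hy.2.1
    have hcoord : |y i| ≤ ‖y‖ := by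
      have := PiLp.norm_apply_le y i
      rwa [Real.norm_eq_abs] at this
    have g1 := H.modPrim_ge hy0 hy.1.2 hcoord
    have g2 := H.modPrim_div_add t (y i)
    have e : F y + F (coordReflection i y) = ‖y‖ ^ (-(d : ℝ)) * ‖y‖ ^ (-a - 1) *
        modWeight ℓ lam R ‖y‖ * ((modPrim ℓ (y i) - modPrim ℓ t - modExt ℓ t * (y i - t)) +
      (modPrim ℓ (-y i) - modPrim ℓ t - modExt ℓ t * (-y i - t))) := by
      simp only [hF, LinearIsometryEquiv.norm_map, coordReflection_same]
      ring
    rw [e]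
    have hw := modWeight_nonneg (ℓ := ℓ) (lam := lam) (R := R) ‖y‖
    refine le_trans (le_of_eq ?_) (mul_le_mul_of_nonneg_left (g1.trans g2) (by positivity))
    rw [Real.rpow_sub_one hy0.ne']
    field_simp
  have h2 : ∫ z in coordCone i j ∩ {z | ‖z‖ ∈ Set.Ioc (2 * r) R},
      (F z + F (coordReflection i z)) ≤ ∫ z in A, (F z + F (coordReflection i z)) :=
    setIntegral_mono_set (hFA.add hFr)
      (Filter.Eventually.of_forall fun z => add_nonneg (hFnn _) (hFnn _))
      (Filter.Eventually.of_forall hsub)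
  rw [integral_mul_const, c2] at h1
  rw [integral_add hFA hFr, hint] at h2
  have e : κ / (128 * c) * ∫ u in Set.Ioc (2 * r) R,
      u⁻¹ * (u ^ (-a) * (ℓ u * modWeight ℓ lam R u)) =
      (κ * (∫ u in Set.Ioc (2 * r) R, u⁻¹ * (u ^ (-a) * (ℓ u * modWeight ℓ lam R u))) *
        (1 / (64 * c))) / 2 := by
    field_simp
    ring
  rw [e]
  linarith
end RegularModulus

theorem exists_integral_cone_far {d : ℕ} [NeZero d] {a : ℝ} (ha : 0 < a) {i j : Fin d}
    (hij : i ≠ j) : ∃ κ : ℝ, 0 < κ ∧ ∀ R : ℝ, 0 < R →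
    IntegrableOn (fun y : EuclideanSpace ℝ (Fin d) => ‖y‖ ^ (-(d : ℝ)) * ‖y‖ ^ (-a))
      (coordCone i j ∩ {y | ‖y‖ ∈ Set.Ioi R}) ∧
    ∫ y in coordCone i j ∩ {y : EuclideanSpace ℝ (Fin d) | ‖y‖ ∈ Set.Ioi R},
      ‖y‖ ^ (-(d : ℝ)) * ‖y‖ ^ (-a) = κ * R ^ (-a) := by
  obtain ⟨κ, hκ, hcone⟩ := exists_integral_coordCone hij
  refine ⟨κ / a, by positivity, fun R hR => ?_⟩
  have e : ∀ u ∈ Set.Ioi R, u ^ (-a - 1) = u⁻¹ * u ^ (-a) := fun u hu => by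
    rw [Real.rpow_sub_one (hR.trans hu).ne', div_eq_inv_mul]
  have hi : IntegrableOn (fun u : ℝ => u⁻¹ * u ^ (-a)) (Set.Ioi R) :=
    (integrableOn_congr_fun e measurableSet_Ioi).1 (integrableOn_Ioi_rpow_of_lt (by linarith) hR)
  obtain ⟨h1, h2⟩ := hcone (Set.Ioi R) (fun u => u ^ (-a)) measurableSet_Ioi
    (fun u hu => hR.trans hu) hi
  refine ⟨h1, h2.trans ?_⟩
  rw [← setIntegral_congr_fun measurableSet_Ioi e, integral_Ioi_rpow_of_lt (by linarith) hR,
    show -a - 1 + 1 = -a from by ring]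
  field_simp

theorem abs_coord_le_norm {d : ℕ} (z : EuclideanSpace ℝ (Fin d)) (k : Fin d) : |z k| ≤ ‖z‖ := by
  simpa using PiLp.norm_apply_le z k

/-- The covector `e_j - m e_i`. -/
noncomputable def slopeVector {d : ℕ} (m : ℝ) (i j : Fin d) : EuclideanSpace ℝ (Fin d) :=
  EuclideanSpace.single j 1 - m • EuclideanSpace.single i 1

theorem inner_slopeVector {d : ℕ} (m : ℝ) (i j : Fin d) (z : EuclideanSpace ℝ (Fin d)) :
    inner ℝ (slopeVector m i j) z = z j - m * z i := by
  simp [slopeVector, inner_sub_left, inner_smul_left, EuclideanSpace.inner_single_left]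

theorem abs_inner_slopeVector_le {d : ℕ} {m : ℝ} (hm : 0 ≤ m) (hm1 : m ≤ 1) (i j : Fin d)
    (z : EuclideanSpace ℝ (Fin d)) : |inner ℝ (slopeVector m i j) z| ≤ 2 * ‖z‖ := by
  rw [inner_slopeVector]
  have h1 := abs_le.1 (abs_coord_le_norm z i)
  have h2 := abs_le.1 (abs_coord_le_norm z j)
  have h3 : |m * z i| ≤ ‖z‖ := by
    rw [abs_mul, abs_of_nonneg hm]
    nlinarith [abs_coord_le_norm z i, abs_nonneg (z i)]
  have h4 := abs_le.1 h3
  rw [abs_le]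
  constructor <;> linarith

/-- Tangent-line bound for a concave power. -/
theorem rpow_le_tangent {a s p : ℝ} (ha : 0 < a) (ha1 : a ≤ 1) (hs : 0 ≤ s) (hp : 0 < p) :
    s ^ a ≤ p ^ a + a * p ^ (a - 1) * (s - p) := by
  have h := rpow_one_add_le_one_add_mul_self (s := s / p - 1)
    (by have := div_nonneg hs hp.le; linarith) ha.le ha1
  rw [show 1 + (s / p - 1) = s / p from by ring, Real.div_rpow hs hp.le] at h
  have hpa : 0 < p ^ a := Real.rpow_pos_of_pos hp a
  rw [div_le_iff₀ hpa] at h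
  refine h.trans_eq ?_
  rw [Real.rpow_sub_one hp.ne']
  field_simp

theorem norm_add_sub_norm_le {d : ℕ} {x z : EuclideanSpace ℝ (Fin d)} (hx : 0 < ‖x‖) :
    ‖x + z‖ - ‖x‖ ≤ inner ℝ x z / ‖x‖ + ‖z‖ ^ 2 / (2 * ‖x‖) := by
  have h := norm_add_sq_real x z
  have e : inner ℝ x z / ‖x‖ + ‖z‖ ^ 2 / (2 * ‖x‖) = (‖x + z‖ ^ 2 - ‖x‖ ^ 2) / (2 * ‖x‖) := by
    rw [h]; field_simp; ring
  rw [e, le_div_iff₀ (by linarith)]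
  nlinarith [sq_nonneg (‖x + z‖ - ‖x‖)]

/-- The barrier `max(x_j - γ(x_i), 0)^a g(|x|)`, truncated outside the ball of radius `R`. -/
noncomputable def truncBarrier {d : ℕ} (ℓ : ℝ → ℝ) (a lam R : ℝ) (i j : Fin d)
    (y : EuclideanSpace ℝ (Fin d)) : ℝ :=
  if ‖y‖ ≤ R then max (y j - modPrim ℓ (y i)) 0 ^ a * modWeight ℓ lam R ‖y‖ else 0

namespace RegularModulus
variable {d : ℕ} {ℓ : ℝ → ℝ} {c C : ℝ} (H : RegularModulus ℓ c C) {lam R a : ℝ}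
  {x z : EuclideanSpace ℝ (Fin d)} {i j : Fin d}
include H

/-- The Taylor-type upper bound for a multiple of the increment of the weight. -/
theorem mul_weight_sub_le (hlam : 0 ≤ lam) (hx : 0 < ‖x‖) (hR : 4 * ‖x‖ ≤ R)
    (hsmall : lam * ℓ R ≤ 1) {w₀ w : ℝ} (hw₀ : 0 ≤ w₀) (hz : ‖z‖ < ‖x‖ / 2) :
    w * (modWeight ℓ lam R ‖x + z‖ - modWeight ℓ lam R ‖x‖) ≤
      inner ℝ ((w₀ * (lam * (ℓ ‖x‖ / ‖x‖) * modWeight ℓ lam R ‖x‖) / ‖x‖) • x) z +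
      w₀ * (lam * (ℓ ‖x‖ / ‖x‖) * modWeight ℓ lam R ‖x‖ / (2 * ‖x‖) +
        2 * lam * (C + 1) * (ℓ (2 * ‖x‖) * modWeight ℓ lam R (2 * ‖x‖)) / ‖x‖ ^ 2) * ‖z‖ ^ 2 +
      |w - w₀| *
        (2 * lam * (ℓ (2 * ‖x‖) * modWeight ℓ lam R (2 * ‖x‖)) / ‖x‖ * ‖z‖) := by
  set g := modWeight ℓ lam R with hg
  set N := ℓ (2 * ‖x‖) * g (2 * ‖x‖) with hN
  have hR0 : 0 < R := by linarith
  have hN0 : 0 ≤ N := mul_nonneg (H.pos _ (by linarith)).le (modWeight_nonneg _)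
  have hC := H.nonneg_const
  have hu1 : |‖x + z‖ - ‖x‖| ≤ ‖z‖ := by
    have := abs_norm_sub_norm_le (x + z) x
    rwa [add_sub_cancel_left] at this
  have hu := abs_le.1 hu1
  have hsm : lam * ℓ (2 * ‖x‖) ≤ 1 :=
    (mul_le_mul_of_nonneg_left (H.mono _ _ (by linarith) (by linarith)) hlam).trans hsmall
  have h1 := H.modWeight_sub_le hlam hR0 hx (u := ‖x + z‖) (by linarith) (by linarith) hsm
  have h2 := H.modWeight_abs_sub_le hlam hR0 hx (u := ‖x + z‖) (by linarith) (by linarith)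
  rw [← hg, ← hN] at h1 h2
  set q := lam * (ℓ ‖x‖ / ‖x‖) * g ‖x‖ with hq
  have hq0 : 0 ≤ q := mul_nonneg (mul_nonneg hlam (div_nonneg (H.pos _ hx).le hx.le))
    (modWeight_nonneg _)
  set K := 2 * lam * (C + 1) * N / ‖x‖ ^ 2 with hK
  have hK0 : 0 ≤ K := by positivity
  set L := 2 * lam * N / ‖x‖ with hL
  have hL0 : 0 ≤ L := by positivity
  have h3 : g ‖x + z‖ - g ‖x‖ ≤ q * (inner ℝ x z / ‖x‖ + ‖z‖ ^ 2 / (2 * ‖x‖)) + K * ‖z‖ ^ 2 := by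
    have e1 := mul_le_mul_of_nonneg_left (norm_add_sub_norm_le (z := z) hx) hq0
    have e2 : (‖x + z‖ - ‖x‖) ^ 2 ≤ ‖z‖ ^ 2 := by
      rw [← sq_abs]; exact pow_le_pow_left₀ (abs_nonneg _) hu1 2
    have e3 := mul_le_mul_of_nonneg_left e2 hK0
    linarith
  have h5 : (w - w₀) * (g ‖x + z‖ - g ‖x‖) ≤ |w - w₀| * (L * ‖z‖) := by
    refine (le_abs_self _).trans ?_
    rw [abs_mul]
    have e1 : |g ‖x + z‖ - g ‖x‖| ≤ L * ‖z‖ := h2.trans (mul_le_mul_of_nonneg_left hu1 hL0)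
    exact mul_le_mul_of_nonneg_left e1 (abs_nonneg _)
  have h6 := mul_le_mul_of_nonneg_left h3 hw₀
  have e : inner ℝ ((w₀ * q / ‖x‖) • x) z = w₀ * (q * (inner ℝ x z / ‖x‖)) := by
    rw [inner_smul_left]; simp; ring
  rw [e]
  have e2 : w * (g ‖x + z‖ - g ‖x‖) = w₀ * (g ‖x + z‖ - g ‖x‖) +
    (w - w₀) * (g ‖x + z‖ - g ‖x‖) := by ring
  rw [e2]
  refine (add_le_add h6 h5).trans_eq ?_
  ring

/-- The Taylor-type upper bound for the product of a half-space power and the weight. -/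
theorem weight_mul_near_le (ha : 0 < a) (ha1 : a ≤ 1) (hlam : 0 ≤ lam) (hx : 0 < ‖x‖)
    (hR : 4 * ‖x‖ ≤ R) (hsmall : lam * ℓ R ≤ 1) {p₀ p : ℝ} (hp₀ : 0 < p₀)
    (hp : |p - p₀| ≤ 2 * ‖z‖) (hz : ‖z‖ < ‖x‖ / 2) :
    max p 0 ^ a * (modWeight ℓ lam R ‖x + z‖ - modWeight ℓ lam R ‖x‖) ≤
      inner ℝ ((p₀ ^ a * (lam * (ℓ ‖x‖ / ‖x‖) * modWeight ℓ lam R ‖x‖) / ‖x‖) • x) z +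
      p₀ ^ a * (lam * (ℓ ‖x‖ / ‖x‖) * modWeight ℓ lam R ‖x‖ / (2 * ‖x‖) +
        2 * lam * (C + 1) * (ℓ (2 * ‖x‖) * modWeight ℓ lam R (2 * ‖x‖)) / ‖x‖ ^ 2) * ‖z‖ ^ 2 +
      2 * (2 * lam * (ℓ (2 * ‖x‖) * modWeight ℓ lam R (2 * ‖x‖)) / ‖x‖) * ‖z‖ ^ (1 + a) := by
  have hN0 : 0 ≤ ℓ (2 * ‖x‖) * modWeight ℓ lam R (2 * ‖x‖) :=
    mul_nonneg (H.pos _ (by linarith)).le (modWeight_nonneg _)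
  refine (H.mul_weight_sub_le hlam hx hR hsmall (w := max p 0 ^ a)
    (Real.rpow_nonneg hp₀.le a) hz).trans (add_le_add le_rfl ?_)
  have h4 : |max p 0 ^ a - p₀ ^ a| ≤ 2 * ‖z‖ ^ a := by
    have := abs_max_rpow_sub_le ha ha1 (u := p) (v := p₀)
    rw [max_eq_left hp₀.le] at this
    refine this.trans ((Real.rpow_le_rpow (abs_nonneg _) hp ha.le).trans ?_)
    rw [Real.mul_rpow (by norm_num) (norm_nonneg _)]
    refine mul_le_mul_of_nonneg_right ?_ (by positivity)
    calc (2 : ℝ) ^ a ≤ 2 ^ (1 : ℝ) := Real.rpow_le_rpow_of_exponent_le (by norm_num) ha1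
      _ = 2 := Real.rpow_one 2
  refine (mul_le_mul_of_nonneg_right h4 (by positivity)).trans_eq ?_
  rcases (norm_nonneg z).eq_or_lt with h | h
  · rw [← h, Real.zero_rpow (show 1 + a ≠ 0 by linarith)]; ring
  · rw [Real.rpow_add h, Real.rpow_one]; ring

theorem weight_mul_far_le (ha : 0 < a) (hlam : 0 ≤ lam) (hx : 0 < ‖x‖)
    (hR : 4 * ‖x‖ ≤ R) {p : ℝ} (hp2 : ‖x‖ ≤ ‖x + z‖ → p ≤ 3 * ‖x + z‖) (hz : ‖x‖ / 2 ≤ ‖z‖)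
    (hR2 : ‖x + z‖ ≤ R) :
    max p 0 ^ a * (modWeight ℓ lam R ‖x + z‖ - modWeight ℓ lam R ‖x‖) *
      ‖z‖ ^ (-(d : ℝ) - 2 * a) ≤ 3 ^ ((d : ℝ) + 3 * a) *
      ({y : EuclideanSpace ℝ (Fin d) | ‖y‖ ∈ Set.Ioc ‖x‖ R}.indicator (fun y => ‖y‖ ^ (-(d : ℝ)) *
      (‖y‖ ^ (-a) * (modWeight ℓ lam R ‖y‖ - modWeight ℓ lam R ‖x‖))) (x + z)) := by
  have hR0 : 0 < R := by linarith
  have hz0 : 0 < ‖z‖ := by linarith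
  by_cases h : ‖x‖ < ‖x + z‖
  · rw [Set.indicator_of_mem (show x + z ∈ {y : EuclideanSpace ℝ (Fin d) | ‖y‖ ∈ Set.Ioc ‖x‖ R}
      from ⟨h, hR2⟩)]
    have hy0 : 0 < ‖x + z‖ := hx.trans h
    have hg : 0 ≤ modWeight ℓ lam R ‖x + z‖ - modWeight ℓ lam R ‖x‖ :=
      sub_nonneg.2 (H.modWeight_mono hlam hR0 h.le)
    have h1 : max p 0 ^ a ≤ 3 ^ a * ‖x + z‖ ^ a := by
      rw [← Real.mul_rpow (by norm_num) hy0.le]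
      exact Real.rpow_le_rpow (le_max_right _ _) (max_le (hp2 h.le) (by positivity)) ha.le
    have h2 : ‖z‖ ^ (-(d : ℝ) - 2 * a) ≤ 3 ^ ((d : ℝ) + 2 * a) * ‖x + z‖ ^ (-(d : ℝ) - 2 * a) := by
      have e : (3 : ℝ) ^ ((d : ℝ) + 2 * a) = (3⁻¹) ^ (-(d : ℝ) - 2 * a) := by
        rw [Real.inv_rpow (by norm_num), ← Real.rpow_neg (by norm_num)]; ring_nf
      rw [e, ← Real.mul_rpow (by norm_num) hy0.le]
      refine Real.rpow_le_rpow_of_nonpos (by positivity) ?_ ?_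
      · have := norm_add_le x z; linarith
      · have : (0 : ℝ) ≤ d := Nat.cast_nonneg d
        linarith
    calc _ ≤ (3 ^ a * ‖x + z‖ ^ a) * (modWeight ℓ lam R ‖x + z‖ - modWeight ℓ lam R ‖x‖) *
          (3 ^ ((d : ℝ) + 2 * a) * ‖x + z‖ ^ (-(d : ℝ) - 2 * a)) := by gcongr
      _ = _ := by
        have e1 : (3 : ℝ) ^ ((d : ℝ) + 3 * a) = 3 ^ ((d : ℝ) + 2 * a) * 3 ^ a := by
          rw [← Real.rpow_add (by norm_num)]; ring_nf
        have e2 : ‖x + z‖ ^ (-(d : ℝ)) * ‖x + z‖ ^ (-a) =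
            ‖x + z‖ ^ (-(d : ℝ) - 2 * a) * ‖x + z‖ ^ a := by
          rw [← Real.rpow_add hy0, ← Real.rpow_add hy0]; ring_nf
        rw [e1, ← mul_assoc (‖x + z‖ ^ (-(d : ℝ))), e2]; ring
  · rw [Set.indicator_of_notMem (fun h' => h h'.1), mul_zero]
    have hg : modWeight ℓ lam R ‖x + z‖ - modWeight ℓ lam R ‖x‖ ≤ 0 :=
      sub_nonpos.2 (H.modWeight_mono hlam hR0 (not_lt.1 h))
    exact mul_nonpos_of_nonpos_of_nonneg (mul_nonpos_of_nonneg_of_nonpos (by positivity) hg)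
      (by positivity)

/-- The gain from the strict concavity of the graph. -/
theorem gain_div_le (ha : 0 < a) (ha1 : a ≤ 1) (hx : 0 < ‖x‖) {t : ℝ}
    (hℓ : ℓ R ≤ 1 / 4) (hy : ‖x + z‖ ∈ Set.Ioc (2 * ‖x‖) R ∧ ‖x + z‖ / 2 ≤ (x + z) j) {p : ℝ}
    (hp2 : p ≤ 3 * ‖x + z‖)
    (hps : (x + z) j - modPrim ℓ ((x + z) i) = p - (modPrim ℓ ((x + z) i) - modPrim ℓ t -
      modExt ℓ t * ((x + z) i - t))) :
    a * 3 ^ (a - 1) * 2 ^ (-(d : ℝ) - 2 * a) * (‖x + z‖ ^ (-(d : ℝ)) * (‖x + z‖ ^ (-a - 1) *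
      (modPrim ℓ ((x + z) i) - modPrim ℓ t - modExt ℓ t * ((x + z) i - t)) *
        modWeight ℓ lam R ‖x + z‖)) ≤
    (max p 0 ^ a - max ((x + z) j - modPrim ℓ ((x + z) i)) 0 ^ a) * modWeight ℓ lam R ‖x + z‖ *
      ‖z‖ ^ (-(d : ℝ) - 2 * a) := by
  obtain ⟨⟨hy1, hy2⟩, hy3⟩ := hy
  set y := x + z with hyd
  have hy0 : 0 < ‖y‖ := by linarith
  set D := modPrim ℓ (y i) - modPrim ℓ t - modExt ℓ t * (y i - t) with hD
  have hD0 : 0 ≤ D := H.modPrim_div_nonneg t (y i)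
  have hγ : modPrim ℓ (y i) ≤ ‖y‖ / 4 := by
    refine (H.modPrim_le_mul (y i)).trans ?_
    have e1 : modExt ℓ (y i) ≤ 1 / 4 :=
      (H.modExt_le (hy0.trans_le hy2) ((le_abs_self _).trans ((abs_coord_le_norm y i).trans hy2))).trans hℓ
    have e2 := H.modExt_nonneg (y i)
    have e3 := le_abs_self (y i)
    have e4 := abs_coord_le_norm y i
    nlinarith [abs_nonneg (y i)]
  have hs : 0 < y j - modPrim ℓ (y i) := by linarith
  have hp : 0 < p := by linarith
  rw [max_eq_left hs.le, max_eq_left hp.le]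
  have h1 := rpow_le_tangent ha ha1 hs.le hp
  have h2 : 3 ^ (a - 1) * ‖y‖ ^ (a - 1) ≤ p ^ (a - 1) := by
    rw [← Real.mul_rpow (by norm_num) hy0.le]
    exact Real.rpow_le_rpow_of_nonpos hp hp2 (by linarith)
  have h3 : a * (3 ^ (a - 1) * ‖y‖ ^ (a - 1)) * D ≤ p ^ a - (y j - modPrim ℓ (y i)) ^ a := by
    have := mul_le_mul_of_nonneg_right (mul_le_mul_of_nonneg_left h2 ha.le) hD0
    have e : y j - modPrim ℓ (y i) - p = -D := by linarith
    rw [e] at h1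
    linarith
  have hzn : 0 < ‖z‖ := by
    have := norm_add_le x z; rw [← hyd] at this; linarith
  have h4 : 2 ^ (-(d : ℝ) - 2 * a) * ‖y‖ ^ (-(d : ℝ) - 2 * a) ≤ ‖z‖ ^ (-(d : ℝ) - 2 * a) := by
    rw [← Real.mul_rpow (by norm_num) hy0.le]
    refine Real.rpow_le_rpow_of_nonpos hzn ?_ ?_
    · have := norm_sub_le y x
      rw [hyd, add_sub_cancel_left, ← hyd] at this
      linarith
    · have : (0 : ℝ) ≤ d := Nat.cast_nonneg d
      linarith
  have hg : 0 ≤ modWeight ℓ lam R ‖y‖ := modWeight_nonneg _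
  have h5 : 0 ≤ a * (3 ^ (a - 1) * ‖y‖ ^ (a - 1)) * D := by positivity
  calc _ = a * (3 ^ (a - 1) * ‖y‖ ^ (a - 1)) * D * modWeight ℓ lam R ‖y‖ *
        (2 ^ (-(d : ℝ) - 2 * a) * ‖y‖ ^ (-(d : ℝ) - 2 * a)) := by
        have e2 : ‖y‖ ^ (-(d : ℝ)) * ‖y‖ ^ (-a - 1) =
            ‖y‖ ^ (a - 1) * ‖y‖ ^ (-(d : ℝ) - 2 * a) := by
          rw [← Real.rpow_add hy0, ← Real.rpow_add hy0]; ring_nf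
        linear_combination a * 3 ^ (a - 1) * 2 ^ (-(d : ℝ) - 2 * a) * D *
          modWeight ℓ lam R ‖y‖ * e2
    _ ≤ _ := mul_le_mul (mul_le_mul_of_nonneg_right h3 hg) h4 (by positivity)
        (mul_nonneg (h5.trans h3) hg)

omit H in
/-- The gain from truncation. -/
theorem gain_trunc_le (ha : 0 < a) (hx : 0 < ‖x‖) (hxy : ‖x‖ ≤ ‖x + z‖) (hz : 0 < ‖z‖) {p : ℝ}
    (hp : ‖x + z‖ / 4 ≤ p) :
    4 ^ (-a) * 2 ^ (-(d : ℝ) - 2 * a) * (‖x + z‖ ^ (-(d : ℝ)) * ‖x + z‖ ^ (-a)) ≤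
    max p 0 ^ a * ‖z‖ ^ (-(d : ℝ) - 2 * a) := by
  set y := x + z with hyd
  have hy0 : 0 < ‖y‖ := by linarith
  have h1 : 4 ^ (-a) * ‖y‖ ^ a ≤ max p 0 ^ a := by
    rw [Real.rpow_neg (by norm_num), ← Real.inv_rpow (by norm_num),
      ← Real.mul_rpow (by norm_num) hy0.le]
    exact Real.rpow_le_rpow (by positivity) (le_max_of_le_left (by linarith)) ha.le
  have h4 : 2 ^ (-(d : ℝ) - 2 * a) * ‖y‖ ^ (-(d : ℝ) - 2 * a) ≤ ‖z‖ ^ (-(d : ℝ) - 2 * a) := by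
    rw [← Real.mul_rpow (by norm_num) hy0.le]
    refine Real.rpow_le_rpow_of_nonpos hz ?_ ?_
    · have := norm_sub_le y x
      rw [hyd, add_sub_cancel_left, ← hyd] at this
      linarith
    · have : (0 : ℝ) ≤ d := Nat.cast_nonneg d
      linarith
  calc _ = 4 ^ (-a) * ‖y‖ ^ a * (2 ^ (-(d : ℝ) - 2 * a) * ‖y‖ ^ (-(d : ℝ) - 2 * a)) := by
        have e2 : ‖y‖ ^ (-(d : ℝ)) * ‖y‖ ^ (-a) = ‖y‖ ^ a * ‖y‖ ^ (-(d : ℝ) - 2 * a) := by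
          rw [← Real.rpow_add hy0, ← Real.rpow_add hy0]; ring_nf
        linear_combination (4 : ℝ) ^ (-a) * 2 ^ (-(d : ℝ) - 2 * a) * e2
    _ ≤ _ := mul_le_mul h1 h4 (by positivity) (by positivity)

end RegularModulus

/-- The contribution of the increase of the weight over the annulus `r < |y| ≤ R`. -/
noncomputable def annulusTerm {d : ℕ} (ℓ : ℝ → ℝ) (a lam r R : ℝ) :
    EuclideanSpace ℝ (Fin d) → ℝ :=
  {y : EuclideanSpace ℝ (Fin d) | ‖y‖ ∈ Set.Ioc r R}.indicator (fun y => ‖y‖ ^ (-(d : ℝ)) *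
    (‖y‖ ^ (-a) * (modWeight ℓ lam R ‖y‖ - modWeight ℓ lam R r)))

/-- The contribution of the concavity of the domain over the annulus `2r < |y| ≤ R`. -/
noncomputable def divergenceTerm {d : ℕ} (ℓ : ℝ → ℝ) (a lam r R t : ℝ) (i j : Fin d) :
    EuclideanSpace ℝ (Fin d) → ℝ :=
  {y : EuclideanSpace ℝ (Fin d) | ‖y‖ ∈ Set.Ioc (2 * r) R ∧ ‖y‖ / 2 ≤ y j}.indicator
    (fun y => ‖y‖ ^ (-(d : ℝ)) * (‖y‖ ^ (-a - 1) *
      (modPrim ℓ (y i) - modPrim ℓ t - modExt ℓ t * (y i - t)) * modWeight ℓ lam R ‖y‖))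

/-- The contribution of the truncation outside the ball of radius `R`. -/
noncomputable def coneTerm {d : ℕ} (a R : ℝ) (i j : Fin d) : EuclideanSpace ℝ (Fin d) → ℝ :=
  (coordCone i j ∩ {y : EuclideanSpace ℝ (Fin d) | ‖y‖ ∈ Set.Ioi R}).indicator
    (fun y => ‖y‖ ^ (-(d : ℝ)) * ‖y‖ ^ (-a))

namespace RegularModulus
variable {d : ℕ} {ℓ : ℝ → ℝ} {c C : ℝ} (H : RegularModulus ℓ c C) {lam R a : ℝ}
  {x z : EuclideanSpace ℝ (Fin d)} {i j : Fin d}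
include H

theorem annulusTerm_nonneg (hlam : 0 ≤ lam) (hR : 0 < R) {r : ℝ} (y : EuclideanSpace ℝ (Fin d)) :
    0 ≤ annulusTerm ℓ a lam r R y := by
  refine Set.indicator_nonneg (fun y hy => ?_) y
  have := sub_nonneg.2 (H.modWeight_mono hlam hR hy.1.le)
  positivity

theorem truncBarrier_sub_le (ha : 0 < a) (ha1 : a ≤ 1) (hlam : 0 ≤ lam) (hx : 0 < ‖x‖)
    (hR : 4 * ‖x‖ ≤ R) (hsmall : lam * ℓ R ≤ 1) (hℓ : ℓ R ≤ 1 / 4)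
    (hp₀ : 0 < x j - modPrim ℓ (x i)) (hz : 0 < ‖z‖) :
    (truncBarrier ℓ a lam R i j (x + z) - truncBarrier ℓ a lam R i j x) *
      ‖z‖ ^ (-(d : ℝ) - 2 * a) ≤
    modWeight ℓ lam R ‖x‖ *
      ((max (x j - modPrim ℓ (x i) + inner ℝ (slopeVector (modExt ℓ (x i)) i j) z) 0 ^ a -
        (x j - modPrim ℓ (x i)) ^ a) * ‖z‖ ^ (-(d : ℝ) - 2 * a)) +
    nearMajorant a (‖x‖ / 2)
      (((x j - modPrim ℓ (x i)) ^ a * (lam * (ℓ ‖x‖ / ‖x‖) * modWeight ℓ lam R ‖x‖) / ‖x‖) • x)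
      ((x j - modPrim ℓ (x i)) ^ a * (lam * (ℓ ‖x‖ / ‖x‖) * modWeight ℓ lam R ‖x‖ / (2 * ‖x‖) +
        2 * lam * (C + 1) * (ℓ (2 * ‖x‖) * modWeight ℓ lam R (2 * ‖x‖)) / ‖x‖ ^ 2))
      (2 * (2 * lam * (ℓ (2 * ‖x‖) * modWeight ℓ lam R (2 * ‖x‖)) / ‖x‖)) 0 z *
        ‖z‖ ^ (-(d : ℝ) - 2 * a) +
    3 ^ ((d : ℝ) + 3 * a) * annulusTerm ℓ a lam ‖x‖ R (x + z) -
    a * 3 ^ (a - 1) * 2 ^ (-(d : ℝ) - 2 * a) * divergenceTerm ℓ a lam ‖x‖ R (x i) i j (x + z) -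
    4 ^ (-a) * 2 ^ (-(d : ℝ) - 2 * a) * modWeight ℓ lam R ‖x‖ * coneTerm a R i j (x + z) := by
  have hR0 : 0 < R := by linarith
  set t := x i with ht
  set m := modExt ℓ t with hm
  have hm0 : 0 ≤ m := H.modExt_nonneg t
  have hxi := abs_coord_le_norm x i
  have hxj := abs_coord_le_norm x j
  have hm1 : m ≤ 1 / 4 := (H.modExt_le hR0 (by linarith [le_abs_self (x i)])).trans hℓ
  set p₀ := x j - modPrim ℓ t with hp₀d
  set b := slopeVector m i j with hb
  set p := p₀ + inner ℝ b z with hp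
  set K := ‖z‖ ^ (-(d : ℝ) - 2 * a) with hK
  have hK0 : 0 ≤ K := by positivity
  have hpp : |p - p₀| ≤ 2 * ‖z‖ := by
    rw [hp, add_sub_cancel_left]; exact abs_inner_slopeVector_le hm0 (by linarith) i j z
  have hbz : inner ℝ b z = z j - m * z i := inner_slopeVector m i j z
  set y := x + z with hy
  have hyi : y i = t + z i := by simp [hy, ht]
  have hyj : y j = x j + z j := by simp [hy]
  have hγ := H.modPrim_le_mul t
  have hγ0 := H.modPrim_nonneg t
  have hpy : p = y j + (m * t - modPrim ℓ t) - m * y i := by rw [hp, hbz, hyi, hyj]; ring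
  have hmt : m * t ≤ ‖x‖ / 4 := by
    have := le_abs_self t
    nlinarith [norm_nonneg x, abs_nonneg t]
  have hyin := abs_coord_le_norm y i
  have hyjn := abs_coord_le_norm y j
  have hmy : |m * y i| ≤ ‖y‖ / 4 := by
    rw [abs_mul, abs_of_nonneg hm0]
    nlinarith [abs_nonneg (y i)]
  have hmy' := abs_le.1 hmy
  have hp2 : ‖x‖ ≤ ‖y‖ → p ≤ 3 * ‖y‖ := fun h => by
    linarith [le_abs_self (y j)]
  have hps : y j - modPrim ℓ (y i) = p - (modPrim ℓ (y i) - modPrim ℓ t - m * (y i - t)) := by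
    rw [hpy]; ring
  have hg0 : 0 ≤ modWeight ℓ lam R ‖x‖ := modWeight_nonneg _
  have hBx : truncBarrier ℓ a lam R i j x = p₀ ^ a * modWeight ℓ lam R ‖x‖ := by
    rw [truncBarrier, if_pos (by linarith), max_eq_left hp₀.le]
  rw [hBx]
  by_cases hyR : ‖y‖ ≤ R
  · rw [truncBarrier, if_pos hyR, coneTerm, Set.indicator_of_notMem (fun h' => not_lt.2 hyR h'.2),
      mul_zero, sub_zero]
    set g := modWeight ℓ lam R ‖y‖ with hg
    have hgn : 0 ≤ g := modWeight_nonneg _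
    set sp := max (y j - modPrim ℓ (y i)) 0 ^ a with hsp
    have hA : max p 0 ^ a * (g - modWeight ℓ lam R ‖x‖) * K ≤
        nearMajorant a (‖x‖ / 2)
          ((p₀ ^ a * (lam * (ℓ ‖x‖ / ‖x‖) * modWeight ℓ lam R ‖x‖) / ‖x‖) • x)
          (p₀ ^ a * (lam * (ℓ ‖x‖ / ‖x‖) * modWeight ℓ lam R ‖x‖ / (2 * ‖x‖) +
          2 * lam * (C + 1) * (ℓ (2 * ‖x‖) * modWeight ℓ lam R (2 * ‖x‖)) / ‖x‖ ^ 2))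
          (2 * (2 * lam * (ℓ (2 * ‖x‖) * modWeight ℓ lam R (2 * ‖x‖)) / ‖x‖)) 0 z * K +
        3 ^ ((d : ℝ) + 3 * a) * annulusTerm ℓ a lam ‖x‖ R y := by
      by_cases hzn : ‖z‖ < ‖x‖ / 2
      · rw [nearMajorant, if_pos hzn]
        have h1 := mul_le_mul_of_nonneg_right (H.weight_mul_near_le (p := p) ha ha1 hlam hx hR hsmall
          hp₀ hpp hzn) hK0
        have h2 := H.annulusTerm_nonneg (a := a) (r := ‖x‖) hlam hR0 y
        have h3 : 0 ≤ 3 ^ ((d : ℝ) + 3 * a) * annulusTerm ℓ a lam ‖x‖ R y := by positivity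
        exact h1.trans (le_add_of_nonneg_right h3)
      · rw [nearMajorant, if_neg hzn, zero_mul, zero_add]
        exact H.weight_mul_far_le ha hlam hx hR hp2 (not_lt.1 hzn) hyR
    have hB : a * 3 ^ (a - 1) * 2 ^ (-(d : ℝ) - 2 * a) * divergenceTerm ℓ a lam ‖x‖ R t i j y ≤
        (max p 0 ^ a - sp) * g * K := by
      by_cases hyS : ‖y‖ ∈ Set.Ioc (2 * ‖x‖) R ∧ ‖y‖ / 2 ≤ y j
      · rw [divergenceTerm, Set.indicator_of_mem (show y ∈ {y : EuclideanSpace ℝ (Fin d) |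
          ‖y‖ ∈ Set.Ioc (2 * ‖x‖) R ∧ ‖y‖ / 2 ≤ y j} from hyS)]
        exact H.gain_div_le ha ha1 hx hℓ hyS (hp2 (by linarith [hyS.1.1])) hps
      · rw [divergenceTerm, Set.indicator_of_notMem (show y ∉ {y : EuclideanSpace ℝ (Fin d) |
          ‖y‖ ∈ Set.Ioc (2 * ‖x‖) R ∧ ‖y‖ / 2 ≤ y j} from hyS), mul_zero]
        have h1 : sp ≤ max p 0 ^ a := by
          refine Real.rpow_le_rpow (le_max_right _ _) (max_le_max ?_ le_rfl) ha.le
          have := H.modPrim_div_nonneg t (y i)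
          rw [hps]; linarith
        have := sub_nonneg.2 h1
        positivity
    linarith
  · have hyR' : R < ‖y‖ := not_le.1 hyR
    have hzx : ¬ ‖z‖ < ‖x‖ / 2 := fun h => by
      have := norm_add_le x z
      rw [← hy] at this
      linarith
    rw [truncBarrier, if_neg hyR, nearMajorant, if_neg hzx, annulusTerm, divergenceTerm,
      Set.indicator_of_notMem (fun h' => hyR h'.2), Set.indicator_of_notMem (fun h' => hyR h'.1.2)]
    have hC : 4 ^ (-a) * 2 ^ (-(d : ℝ) - 2 * a) * coneTerm a R i j y ≤ max p 0 ^ a * K := by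
      by_cases hyc : y ∈ coordCone i j
      · rw [coneTerm, Set.indicator_of_mem (show y ∈ coordCone i j ∩
          {y : EuclideanSpace ℝ (Fin d) | ‖y‖ ∈ Set.Ioi R} from ⟨hyc, hyR'⟩)]
        refine gain_trunc_le ha hx (by rw [← hy]; linarith) hz ?_
        rw [← hy]
        have := hyc.1
        linarith
      · rw [coneTerm, Set.indicator_of_notMem (fun h' => hyc h'.1), mul_zero]
        positivity
    have := mul_le_mul_of_nonneg_left hC hg0
    linarith

end RegularModulus

theorem integrableOn_add_left_of_integrable {d : ℕ} {k : EuclideanSpace ℝ (Fin d) → ℝ}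
    (hk : Integrable k) (x : EuclideanSpace ℝ (Fin d)) (S : Set (EuclideanSpace ℝ (Fin d))) :
    IntegrableOn (fun z => k (x + z)) S :=
  (hk.comp_add_left x).integrableOn

theorem setIntegral_add_left_le {d : ℕ} {k : EuclideanSpace ℝ (Fin d) → ℝ} (hk : Integrable k)
    (hk0 : ∀ y, 0 ≤ k y) (x : EuclideanSpace ℝ (Fin d)) (S : Set (EuclideanSpace ℝ (Fin d))) :
    ∫ z in S, k (x + z) ≤ ∫ y, k y := by
  rw [← integral_add_left_eq_self k x]
  exact setIntegral_le_integral (hk.comp_add_left x) (Filter.Eventually.of_forall fun z => hk0 _)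

theorem setIntegral_add_left_eq {d : ℕ} {k : EuclideanSpace ℝ (Fin d) → ℝ}
    {x : EuclideanSpace ℝ (Fin d)} {η : ℝ} (hx : η ≤ ‖x‖) (hk : ∀ y, ‖y‖ ≤ 2 * ‖x‖ → k y = 0) :
    ∫ z in {z : EuclideanSpace ℝ (Fin d) | η ≤ ‖z‖}, k (x + z) = ∫ y, k y := by
  rw [← integral_add_left_eq_self k x]
  refine setIntegral_eq_integral_of_forall_compl_eq_zero fun z hz => hk _ ?_
  have hz' : ‖z‖ < η := not_le.1 hz
  linarith [norm_add_le x z]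

namespace RegularModulus
variable {d : ℕ} [NeZero d] {ℓ : ℝ → ℝ} {c C : ℝ} (H : RegularModulus ℓ c C) {a : ℝ} {i j : Fin d}
include H

theorem near_term_le (ha : 0 < a) (ha1 : a < 1) {lam R r p₀ σ : ℝ} (hlam : 0 ≤ lam) (hr : 0 < r)
    (hR : 4 * r ≤ R) (hp₀ : 0 ≤ p₀) (hp₀r : p₀ ≤ r) (hσ : 0 ≤ σ) :
    σ * ((p₀ ^ a * (lam * (ℓ r / r) * modWeight ℓ lam R r / (2 * r) +
        2 * lam * (C + 1) * (ℓ (2 * r) * modWeight ℓ lam R (2 * r)) / r ^ 2)) *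
        ((r / 2) ^ (2 - 2 * a) / (2 - 2 * a)) +
      2 * (2 * lam * (ℓ (2 * r) * modWeight ℓ lam R (2 * r)) / r) *
        ((r / 2) ^ (1 - a) / (1 - a)) + 0 * ((r / 2) ^ (-(2 * a)) / (2 * a))) ≤
    lam * (8 * σ * ((2 * C + 3) / (2 - 2 * a) + 4 / (1 - a))) *
      ∫ u in (2 * r)..R, u⁻¹ * (u ^ (-a) * (ℓ u * modWeight ℓ lam R u)) := by
  have hR0 : 0 < R := by linarith
  have h1 := H.le_integral_weight (a := a) hlam ha.le ha1.le hr hR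
  set I := ∫ u in (2 * r)..R, u⁻¹ * (u ^ (-a) * (ℓ u * modWeight ℓ lam R u)) with hI
  set N := ℓ (2 * r) * modWeight ℓ lam R (2 * r) with hN
  have hC := H.nonneg_const
  have hN0 : 0 ≤ N := mul_nonneg (H.pos _ (by linarith)).le (modWeight_nonneg _)
  have hgN : ℓ r * modWeight ℓ lam R r ≤ N :=
    mul_le_mul (H.mono _ _ hr (by linarith)) (H.modWeight_mono hlam hR0 (by linarith))
      (modWeight_nonneg _) (H.pos _ (by linarith)).le
  have e1 : lam * (ℓ r / r) * modWeight ℓ lam R r / (2 * r) + 2 * lam * (C + 1) * N / r ^ 2 ≤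
      lam * (2 * C + 3) * N / r ^ 2 := by
    have : lam * (ℓ r / r) * modWeight ℓ lam R r / (2 * r) =
        lam * (ℓ r * modWeight ℓ lam R r) / 2 / r ^ 2 := by field_simp
    rw [this, ← add_div]
    refine div_le_div_of_nonneg_right ?_ (by positivity)
    nlinarith [mul_le_mul_of_nonneg_left hgN hlam, mul_nonneg hlam hN0]
  have e2 : p₀ ^ a ≤ r ^ a := Real.rpow_le_rpow hp₀ hp₀r ha.le
  have e3 : (r / 2) ^ (2 - 2 * a) ≤ r ^ (2 - 2 * a) :=
    Real.rpow_le_rpow (by positivity) (by linarith) (by linarith)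
  have e4 : (r / 2) ^ (1 - a) ≤ r ^ (1 - a) :=
    Real.rpow_le_rpow (by positivity) (by linarith) (by linarith)
  have hℓ0 := (H.pos _ hr).le
  have hg0 : 0 ≤ modWeight ℓ lam R r := modWeight_nonneg _
  have h2a : 0 < 2 - 2 * a := by linarith
  have h1a : 0 < 1 - a := by linarith
  have t1 : r ^ a * (lam * (2 * C + 3) * N / r ^ 2) * (r ^ (2 - 2 * a) / (2 - 2 * a)) =
      lam * ((2 * C + 3) / (2 - 2 * a)) * (N * r ^ (-a)) := by
    have : r ^ (-a) = r ^ a * (r ^ 2)⁻¹ * r ^ (2 - 2 * a) := by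
      rw [← Real.rpow_natCast r 2, ← Real.rpow_neg hr.le, ← Real.rpow_add hr, ← Real.rpow_add hr]
      congr 1; push_cast; ring
    rw [this]; ring
  have t2 : 2 * (2 * lam * N / r) * (r ^ (1 - a) / (1 - a)) =
      lam * (4 / (1 - a)) * (N * r ^ (-a)) := by
    have : r ^ (-a) = r⁻¹ * r ^ (1 - a) := by
      rw [← Real.rpow_neg_one r, ← Real.rpow_add hr]; congr 1; ring
    rw [this]; ring
  calc _ ≤ σ * (r ^ a * (lam * (2 * C + 3) * N / r ^ 2) * (r ^ (2 - 2 * a) / (2 - 2 * a)) +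
        2 * (2 * lam * N / r) * (r ^ (1 - a) / (1 - a))) := by
        rw [zero_mul, add_zero]
        gcongr
    _ = lam * (σ * ((2 * C + 3) / (2 - 2 * a) + 4 / (1 - a))) * (N * r ^ (-a)) := by
        rw [t1, t2]; ring
    _ ≤ lam * (σ * ((2 * C + 3) / (2 - 2 * a) + 4 / (1 - a))) * (8 * I) := by gcongr
    _ = _ := by ring

set_option maxHeartbeats 1000000 in
theorem exists_barrier_majorant (ha : 0 < a) (ha1 : a < 1) (hij : i ≠ j) :
    ∃ lam₀ κ : ℝ, 0 < lam₀ ∧ 0 < κ ∧ ∀ lam R : ℝ, 0 ≤ lam → lam ≤ lam₀ → 0 < R →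
      lam * ℓ R ≤ 1 → ℓ R ≤ 1 / 4 → ∀ x : EuclideanSpace ℝ (Fin d), 0 < ‖x‖ → 4 * ‖x‖ ≤ R →
      0 < x j - modPrim ℓ (x i) → ∃ E : ℝ, ∀ η : ℝ, 0 < η → 4 * η ≤ x j - modPrim ℓ (x i) →
      ∃ G : EuclideanSpace ℝ (Fin d) → ℝ, IntegrableOn G {z | η ≤ ‖z‖} ∧
        (∀ z, η ≤ ‖z‖ → (truncBarrier ℓ a lam R i j (x + z) - truncBarrier ℓ a lam R i j x) *
          ‖z‖ ^ (-(d : ℝ) - 2 * a) ≤ G z) ∧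
        ∫ z in {z : EuclideanSpace ℝ (Fin d) | η ≤ ‖z‖}, G z ≤
          E * η ^ (2 - 2 * a) - κ * R ^ (-a) := by
  obtain ⟨κ₃, hκ₃, hdiv⟩ := H.exists_integral_div_ge (a := a) hij
  obtain ⟨κ₄, hκ₄, hcone⟩ := exists_integral_cone_far ha hij
  set σ := sphereArea d with hσ
  have hσ0 : 0 < σ := sphereArea_pos d
  have hC := H.nonneg_const
  have h2a : 0 < 2 - 2 * a := by linarith
  have h1a : 0 < 1 - a := by linarith
  set C₂ : ℝ := 3 ^ ((d : ℝ) + 3 * a) with hC₂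
  set C₃ : ℝ := a * 3 ^ (a - 1) * 2 ^ (-(d : ℝ) - 2 * a) with hC₃
  set C₄ : ℝ := 4 ^ (-a) * 2 ^ (-(d : ℝ) - 2 * a) with hC₄
  have hC₂0 : 0 < C₂ := by positivity
  have hC₃0 : 0 < C₃ := by positivity
  have hC₄0 : 0 < C₄ := by positivity
  set X := 8 * σ * ((2 * C + 3) / (2 - 2 * a) + 4 / (1 - a)) + C₂ * σ * (9 / a) with hX
  have hX0 : 0 < X := by positivity
  refine ⟨C₃ * κ₃ / X, min (C₂ * σ / a) (C₄ * κ₄), by positivity, by positivity, ?_⟩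
  intro lam R hlam hlam0 hR0 hsmall hℓ x hx hR hp₀
  set r := ‖x‖ with hr
  set p₀ := x j - modPrim ℓ (x i) with hp₀d
  set b := slopeVector (modExt ℓ (x i)) i j with hb
  have hm0 := H.modExt_nonneg (x i)
  have hm1 : modExt ℓ (x i) ≤ 1 / 4 :=
    (H.modExt_le hR0 (by linarith [le_abs_self (x i), abs_coord_le_norm x i])).trans hℓ
  have hb2 : ‖b‖ ≤ 2 := by
    have h := abs_inner_slopeVector_le hm0 (by linarith) i j b
    rw [← hb, real_inner_self_eq_norm_sq, abs_of_nonneg (sq_nonneg _)] at h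
    by_contra hcon
    nlinarith [norm_nonneg b]
  have hp₀r : p₀ ≤ r := by
    linarith [H.modPrim_nonneg (x i), le_abs_self (x j), abs_coord_le_norm x j]
  set g₀ := modWeight ℓ lam R r with hg₀
  have hg₀0 : 0 ≤ g₀ := modWeight_nonneg _
  have hg₀1 : g₀ ≤ 1 := H.modWeight_le_one hlam hR0 (by linarith)
  set μ := (volume : Measure (EuclideanSpace ℝ (Fin d))).toSphere.real Set.univ with hμ
  refine ⟨g₀ * (p₀ ^ (a - 2) * ‖b‖ ^ 2 * μ), ?_⟩
  intro η hη hηp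
  have hηr : η ≤ r := by linarith
  obtain ⟨w1, w2⟩ := integral_halfSpace_le ha ha1 hp₀ b hη (by nlinarith)
  set A := p₀ ^ a * (lam * (ℓ r / r) * g₀ / (2 * r) +
        2 * lam * (C + 1) * (ℓ (2 * r) * modWeight ℓ lam R (2 * r)) / r ^ 2) with hA
  set B := 2 * (2 * lam * (ℓ (2 * r) * modWeight ℓ lam R (2 * r)) / r) with hB
  have hℓr := (H.pos _ hx).le
  have hN0 : 0 ≤ ℓ (2 * r) * modWeight ℓ lam R (2 * r) :=
    mul_nonneg (H.pos _ (by linarith)).le (modWeight_nonneg _)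
  have hA0 : 0 ≤ A := by positivity
  have hB0 : 0 ≤ B := by positivity
  obtain ⟨n1, n2⟩ := nearMajorant_integral_le ha ha1 ((p₀ ^ a * (lam * (ℓ r / r) * g₀) / r) • x)
    hA0 hB0 le_rfl hη (by positivity : 0 < r / 2)
  have n3 := H.near_term_le ha ha1 hlam hx hR hp₀.le hp₀r hσ0.le
  obtain ⟨k21, k22⟩ := H.integral_weight_annulus (d := d) (lam := lam) (a := a) hx
    (by linarith : r ≤ R)
  have k23 := H.integral_weight_sub_le hlam ha ha1.le hx hR
  obtain ⟨k31, k32⟩ := hdiv lam R r (x i) hlam hx (by linarith)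
  obtain ⟨k41, k42⟩ := hcone R hR0
  have m2 : MeasurableSet {y : EuclideanSpace ℝ (Fin d) | ‖y‖ ∈ Set.Ioc r R} :=
    measurable_norm measurableSet_Ioc
  have m3 : MeasurableSet {y : EuclideanSpace ℝ (Fin d) |
      ‖y‖ ∈ Set.Ioc (2 * r) R ∧ ‖y‖ / 2 ≤ y j} :=
    (measurable_norm measurableSet_Ioc).inter
      (measurableSet_le (f := fun z : EuclideanSpace ℝ (Fin d) => ‖z‖ / 2) (g := fun z => z j)
        (by fun_prop) (by fun_prop))
  have m4 : MeasurableSet (coordCone i j ∩ {y : EuclideanSpace ℝ (Fin d) | ‖y‖ ∈ Set.Ioi R}) :=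
    (measurableSet_coordCone i j).inter (measurable_norm measurableSet_Ioi)
  have i2 : Integrable (annulusTerm (d := d) ℓ a lam r R) := (integrable_indicator_iff m2).2 k21
  have i3 : Integrable (divergenceTerm ℓ a lam r R (x i) i j) := (integrable_indicator_iff m3).2 k31
  have i4 : Integrable (coneTerm a R i j) := (integrable_indicator_iff m4).2 k41
  rw [← integral_indicator m2] at k22
  rw [← integral_indicator m3] at k32
  rw [← integral_indicator m4] at k42
  have v2 := setIntegral_add_left_le i2 (H.annulusTerm_nonneg hlam hR0) x {z | η ≤ ‖z‖}
  have v3 := setIntegral_add_left_eq (k := divergenceTerm ℓ a lam r R (x i) i j) (x := x) hηr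
    (fun y hy => Set.indicator_of_notMem (fun h => not_lt.2 hy h.1.1) _)
  have v4 := setIntegral_add_left_eq (k := coneTerm a R i j) (x := x) hηr
    (fun y hy => Set.indicator_of_notMem (fun h => by
      have : R < ‖y‖ := h.2
      linarith) _)
  have j2 := integrableOn_add_left_of_integrable i2 x {z | η ≤ ‖z‖}
  have j3 := integrableOn_add_left_of_integrable i3 x {z | η ≤ ‖z‖}
  have j4 := integrableOn_add_left_of_integrable i4 x {z | η ≤ ‖z‖}
  have q1 := w1.const_mul g₀
  have q2 := j2.const_mul C₂
  have q3 := j3.const_mul C₃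
  have q4 := j4.const_mul (C₄ * g₀)
  refine ⟨_, (((q1.add n1).add q2).sub q3).sub q4, fun z hz =>
    H.truncBarrier_sub_le ha ha1.le hlam hx hR hsmall hℓ hp₀ (hη.trans_le hz), ?_⟩
  have s1 := integral_sub (((q1.add n1).add q2).sub q3) q4
  have s2 := integral_sub ((q1.add n1).add q2) q3
  have s3 := integral_add (q1.add n1) q2
  have s4 := integral_add q1 n1
  simp only [Pi.add_apply, Pi.sub_apply] at s1 s2 s3 s4 ⊢
  rw [s1, s2, s3, s4, integral_const_mul, integral_const_mul, integral_const_mul,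
    integral_const_mul, v3, v4]
  have k22' : ∫ y, annulusTerm (d := d) ℓ a lam r R y =
      σ * ∫ u in r..R, u⁻¹ * (u ^ (-a) * (modWeight ℓ lam R u - modWeight ℓ lam R r)) := k22
  have k32' : κ₃ * (∫ u in (2 * r)..R, u⁻¹ * (u ^ (-a) * (ℓ u * modWeight ℓ lam R u))) ≤
      ∫ y, divergenceTerm ℓ a lam r R (x i) i j y := k32
  have k42' : ∫ y, coneTerm a R i j y = κ₄ * R ^ (-a) := k42
  have hI0 : 0 ≤ ∫ u in (2 * r)..R, u⁻¹ * (u ^ (-a) * (ℓ u * modWeight ℓ lam R u)) := by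
    have := H.le_integral_weight (a := a) hlam ha.le ha1.le hx hR
    have h2 : 0 ≤ ℓ (2 * r) * modWeight ℓ lam R (2 * r) * r ^ (-a) := by positivity
    linarith
  rw [k42']
  set I := ∫ u in (2 * r)..R, u⁻¹ * (u ^ (-a) * (ℓ u * modWeight ℓ lam R u)) with hI
  have f1 := mul_le_mul_of_nonneg_left w2 hg₀0
  have f2 := n2.trans n3
  have f3 := mul_le_mul_of_nonneg_left (v2.trans (k22'.trans_le
    (mul_le_mul_of_nonneg_left k23 hσ0.le))) hC₂0.le
  have f4 := mul_le_mul_of_nonneg_left k32' hC₃0.le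
  have f5 : lam * X * I ≤ C₃ * κ₃ * I := by
    refine mul_le_mul_of_nonneg_right ?_ hI0
    rwa [le_div_iff₀ hX0] at hlam0
  have hRa : 0 ≤ R ^ (-a) := by positivity
  have f6 : min (C₂ * σ / a) (C₄ * κ₄) * R ^ (-a) ≤
      (C₂ * σ / a) * (1 - g₀) * R ^ (-a) + C₄ * κ₄ * g₀ * R ^ (-a) := by
    rw [← add_mul]
    refine mul_le_mul_of_nonneg_right ?_ hRa
    have e1 := mul_le_mul_of_nonneg_right (min_le_left (C₂ * σ / a) (C₄ * κ₄))
      (by linarith : 0 ≤ 1 - g₀)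
    have e2 := mul_le_mul_of_nonneg_right (min_le_right (C₂ * σ / a) (C₄ * κ₄)) hg₀0
    linarith
  have f7 : lam * X * I = lam * (8 * σ * ((2 * C + 3) / (2 - 2 * a) + 4 / (1 - a))) * I +
      C₂ * (σ * (9 * lam / a * I)) := by rw [hX]; ring
  have f8 : C₂ * (σ * (9 * lam / a * I - R ^ (-a) * (1 - g₀) / a)) =
      C₂ * (σ * (9 * lam / a * I)) - (C₂ * σ / a) * (1 - g₀) * R ^ (-a) := by ring
  rw [f8] at f3
  linarith

end RegularModulus

namespace RegularModulus
variable {d : ℕ} {ℓ : ℝ → ℝ} {c C : ℝ} (H : RegularModulus ℓ c C) {lam R a : ℝ}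
  {x : EuclideanSpace ℝ (Fin d)} {i j : Fin d}
include H

/-- The barrier is touched from above by a paraboloid. -/
theorem exists_truncBarrier_paraboloid (ha : 0 < a) (ha1 : a ≤ 1) (hlam : 0 ≤ lam) (hx : 0 < ‖x‖)
    (hR : 4 * ‖x‖ ≤ R) (hsmall : lam * ℓ R ≤ 1) (hℓ : ℓ R ≤ 1 / 4)
    (hp₀ : 0 < x j - modPrim ℓ (x i)) :
    ∃ (b : EuclideanSpace ℝ (Fin d)) (A η₀ : ℝ), 0 ≤ A ∧ 0 < η₀ ∧ ∀ z, ‖z‖ < η₀ →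
      truncBarrier ℓ a lam R i j (x + z) - truncBarrier ℓ a lam R i j x ≤
        inner ℝ b z + A * ‖z‖ ^ 2 := by
  have hR0 : 0 < R := by linarith
  have hC := H.nonneg_const
  set t := x i with ht
  set m := modExt ℓ t with hm
  have hm0 : 0 ≤ m := H.modExt_nonneg t
  have hxi := abs_coord_le_norm x i
  have hm1 : m ≤ 1 / 4 := (H.modExt_le hR0 (by linarith [le_abs_self (x i)])).trans hℓ
  set p₀ := x j - modPrim ℓ t with hp₀d
  set g₀ := modWeight ℓ lam R ‖x‖ with hg₀
  have hg₀0 : 0 ≤ g₀ := modWeight_nonneg _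
  have hN0 : 0 ≤ ℓ (2 * ‖x‖) * modWeight ℓ lam R (2 * ‖x‖) :=
    mul_nonneg (H.pos _ (by linarith)).le (modWeight_nonneg _)
  have hℓx := (H.pos _ hx).le
  set L := 2 * lam * (ℓ (2 * ‖x‖) * modWeight ℓ lam R (2 * ‖x‖)) / ‖x‖ with hL
  have hL0 : 0 ≤ L := by positivity
  refine ⟨(g₀ * (a * p₀ ^ (a - 1))) • slopeVector m i j +
    (p₀ ^ a * (lam * (ℓ ‖x‖ / ‖x‖) * g₀) / ‖x‖) • x,
    p₀ ^ a * (lam * (ℓ ‖x‖ / ‖x‖) * g₀ / (2 * ‖x‖) +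
        2 * lam * (C + 1) * (ℓ (2 * ‖x‖) * modWeight ℓ lam R (2 * ‖x‖)) / ‖x‖ ^ 2) +
      2 * (p₀ / 2) ^ (a - 1) * L, min (p₀ / 4) (‖x‖ / 2), by positivity, by positivity, ?_⟩
  intro z hz
  have hz1 : ‖z‖ < p₀ / 4 := hz.trans_le (min_le_left _ _)
  have hz2 : ‖z‖ < ‖x‖ / 2 := hz.trans_le (min_le_right _ _)
  set p := p₀ + inner ℝ (slopeVector m i j) z with hp
  have hpp := abs_inner_slopeVector_le hm0 (by linarith) i j z
  have hpp' := abs_le.1 hpp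
  have hph : p₀ / 2 < p := by rw [hp]; linarith
  have hp0 : 0 < p := by linarith
  have hyR : ‖x + z‖ ≤ R := by linarith [norm_add_le x z]
  have hBx : truncBarrier ℓ a lam R i j x = p₀ ^ a * g₀ := by
    rw [truncBarrier, if_pos (by linarith), max_eq_left hp₀.le]
  rw [hBx, truncBarrier, if_pos hyR]
  set g := modWeight ℓ lam R ‖x + z‖ with hg
  have hg0 : 0 ≤ g := modWeight_nonneg _
  have hs : max ((x + z) j - modPrim ℓ ((x + z) i)) 0 ≤ p := by
    refine max_le ?_ hp0.le
    have h1 := H.modPrim_support t ((x + z) i)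
    have h2 : inner ℝ (slopeVector m i j) z = z j - m * z i := inner_slopeVector m i j z
    have hyi : (x + z) i = t + z i := by simp [ht]
    have hyj : (x + z) j = x j + z j := by simp
    rw [hyi] at h1 ⊢
    rw [hp, h2, hyj]
    rw [← hm] at h1
    linarith
  have h1 : max ((x + z) j - modPrim ℓ ((x + z) i)) 0 ^ a * g ≤ p ^ a * g :=
    mul_le_mul_of_nonneg_right (Real.rpow_le_rpow (le_max_right _ _) hs ha.le) hg0
  have h2 := rpow_le_tangent ha ha1 hp0.le hp₀
  have h3 := rpow_le_tangent ha ha1 hp₀.le hp0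
  have hq : ∀ u, p₀ / 2 ≤ u → a * u ^ (a - 1) ≤ (p₀ / 2) ^ (a - 1) := fun u hu => by
    have hh : u ^ (a - 1) ≤ (p₀ / 2) ^ (a - 1) :=
      Real.rpow_le_rpow_of_nonpos (by linarith) hu (by linarith)
    have : 0 ≤ u ^ (a - 1) := Real.rpow_nonneg (by linarith) _
    nlinarith
  have h4 : |p ^ a - p₀ ^ a| ≤ 2 * (p₀ / 2) ^ (a - 1) * ‖z‖ := by
    have e : p - p₀ = inner ℝ (slopeVector m i j) z := by rw [hp]; ring
    have hab : |p - p₀| ≤ 2 * ‖z‖ := e ▸ hpp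
    have k1 : a * p₀ ^ (a - 1) * (p - p₀) ≤ (p₀ / 2) ^ (a - 1) * (2 * ‖z‖) :=
      (mul_le_mul_of_nonneg_left (le_abs_self _) (by positivity)).trans
        (mul_le_mul (hq p₀ (by linarith)) hab (abs_nonneg _) (by positivity))
    have k2 : a * p ^ (a - 1) * (p₀ - p) ≤ (p₀ / 2) ^ (a - 1) * (2 * ‖z‖) :=
      (mul_le_mul_of_nonneg_left (le_abs_self _) (by positivity)).trans
        (mul_le_mul (hq p hph.le) (by rwa [abs_sub_comm]) (abs_nonneg _) (by positivity))
    rw [abs_le]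
    constructor <;> linarith
  have h5 := H.mul_weight_sub_le hlam hx hR hsmall (w := p ^ a) (Real.rpow_nonneg hp₀.le a) hz2
  have h6 := mul_le_mul_of_nonneg_left h2 hg₀0
  have h7 := mul_le_mul_of_nonneg_right h4 (by positivity : 0 ≤ L * ‖z‖)
  rw [inner_add_left, inner_smul_left]
  have e : p - p₀ = inner ℝ (slopeVector m i j) z := by rw [hp]; ring
  rw [← e]
  simp only [conj_trivial]
  rw [← hL, ← hg, ← hg₀] at h5
  have e8 : p ^ a * g - p₀ ^ a * g₀ = g₀ * p ^ a - g₀ * p₀ ^ a + p ^ a * (g - g₀) := by ring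
  calc _ ≤ p ^ a * g - p₀ ^ a * g₀ := by linarith
    _ ≤ _ := by rw [e8]; linarith

omit H in
theorem truncBarrier_nonneg (y : EuclideanSpace ℝ (Fin d)) : 0 ≤ truncBarrier ℓ a lam R i j y := by
  unfold truncBarrier
  split_ifs
  · have := modWeight_nonneg (ℓ := ℓ) (lam := lam) (R := R) ‖y‖
    positivity
  · exact le_rfl

theorem continuousOn_truncBarrier (ha : 0 < a) (hlam : 0 ≤ lam) (hR : 0 < R) :
    ContinuousOn (truncBarrier ℓ a lam R i j) (closedBall (0 : EuclideanSpace ℝ (Fin d)) R) := by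
  have e : Set.EqOn (truncBarrier ℓ a lam R i j) (fun y : EuclideanSpace ℝ (Fin d) =>
      max (y j - modPrim ℓ (y i)) 0 ^ a * modWeight ℓ lam R ‖y‖) (closedBall 0 R) := fun y hy =>
    if_pos (mem_closedBall_zero_iff.1 hy)
  refine ContinuousOn.congr ?_ e
  have hs : Continuous fun y : EuclideanSpace ℝ (Fin d) => max (y j - modPrim ℓ (y i)) 0 ^ a := by
    refine Continuous.rpow_const ?_ fun _ => Or.inr ha.le
    exact ((by fun_prop : Continuous fun y : EuclideanSpace ℝ (Fin d) => y j).sub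
      (H.modPrim_continuous.comp (by fun_prop))).max continuous_const
  intro y hy
  by_cases hy0 : y = 0
  · subst hy0
    have e0 : max ((0 : EuclideanSpace ℝ (Fin d)) j - modPrim ℓ ((0 : EuclideanSpace ℝ (Fin d)) i)) 0
        ^ a = 0 := by
      simp [modPrim_zero, Real.zero_rpow ha.ne']
    rw [ContinuousWithinAt]
    beta_reduce
    rw [e0, zero_mul]
    have hlim : Filter.Tendsto (fun y : EuclideanSpace ℝ (Fin d) =>
        max (y j - modPrim ℓ (y i)) 0 ^ a) (nhdsWithin 0 (closedBall 0 R)) (nhds 0) := by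
      have := hs.tendsto 0
      rw [e0] at this
      exact this.mono_left nhdsWithin_le_nhds
    refine tendsto_of_tendsto_of_tendsto_of_le_of_le' tendsto_const_nhds hlim ?_ ?_
    · exact Filter.Eventually.of_forall fun y => mul_nonneg (by positivity) (modWeight_nonneg _)
    · filter_upwards [self_mem_nhdsWithin] with y hy
      exact mul_le_of_le_one_right (by positivity)
        (H.modWeight_le_one hlam hR (mem_closedBall_zero_iff.1 hy))
  · refine (hs.continuousAt.mul ?_).continuousWithinAt
    exact ContinuousAt.comp (f := fun y : EuclideanSpace ℝ (Fin d) => ‖y‖)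
      (H.hasDerivAt_modWeight hR (norm_pos_iff.2 hy0)).continuousAt continuous_norm.continuousAt

end RegularModulus

namespace RegularModulus
variable {d : ℕ} [NeZero d] {ℓ : ℝ → ℝ} {c C : ℝ} (H : RegularModulus ℓ c C) {lam Q a κ : ℝ}
  {i j : Fin d}
include H

theorem le_of_touching (ha : 0 < a) (ha1 : a < 1) (hlam : 0 ≤ lam)
    (hsmall : lam * ℓ Q ≤ 1) (hℓ : ℓ Q ≤ 1 / 4) {x x₁ : EuclideanSpace ℝ (Fin d)} (hx : 0 < ‖x‖)
    (hxQ : 4 * ‖x‖ < Q) (hp₀ : 0 < x j - modPrim ℓ (x i))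
    (hG : ∃ E : ℝ, ∀ η : ℝ, 0 < η → 4 * η ≤ x j - modPrim ℓ (x i) →
      ∃ G : EuclideanSpace ℝ (Fin d) → ℝ, IntegrableOn G {z | η ≤ ‖z‖} ∧
        (∀ z, η ≤ ‖z‖ → (truncBarrier ℓ a lam Q i j (x + z) - truncBarrier ℓ a lam Q i j x) *
          ‖z‖ ^ (-(d : ℝ) - 2 * a) ≤ G z) ∧
        ∫ z in {z : EuclideanSpace ℝ (Fin d) | η ≤ ‖z‖}, G z ≤ E * η ^ (2 - 2 * a) - κ * Q ^ (-a))
    {U : Set (EuclideanSpace ℝ (Fin d))} {h : EuclideanSpace ℝ (Fin d) → ℝ}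
    (hU : IsOpen U) (hxU : x ∈ U) (h0 : ∀ x, 0 ≤ h x) (hh : AlphaHarmonicOn d (2 * a) h U)
    {M S ρ L : ℝ} (hM : 0 ≤ M) (hS : 0 ≤ S) (hρ : 0 < ρ) (hx₁ : closedBall x₁ ρ ⊆ U)
    (hL : ‖x - x₁‖ ≤ L) (hρL : ρ ≤ L) (hQL : Q / 2 ≤ L)
    (hlocal : ∀ y, ‖y‖ ≤ Q → h y - h x ≤ M * (truncBarrier ℓ a lam Q i j y -
      truncBarrier ℓ a lam Q i j x) + 16 * S / Q ^ 2 * (‖y‖ ^ 2 - ‖x‖ ^ 2))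
    (hfar : ∀ y, Q < ‖y‖ → h y - h x ≤ M * (truncBarrier ℓ a lam Q i j y -
      truncBarrier ℓ a lam Q i j x) + h y) :
    M * (κ * Q ^ (-a)) ≤ sphereArea d * (16 * S / Q ^ 2 * ((Q / 2) ^ (2 - 2 * a) / (2 - 2 * a)) +
      0 * ((Q / 2) ^ (1 - a) / (1 - a)) + 16 * S * ((Q / 2) ^ (-(2 * a)) / (2 * a))) +
      tailConst d (2 * a) * (L / (Q / 2)) ^ ((d : ℝ) + 2 * a) * ρ ^ (-(2 * a)) * h x₁ := by
  have hQ : 0 < Q := by linarith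
  obtain ⟨E, hE⟩ := hG
  obtain ⟨b, A, η₀, hA, hη₀, hpar⟩ := H.exists_truncBarrier_paraboloid ha ha1.le hlam hx hxQ.le hsmall
    hℓ hp₀
  set T := 16 * S / Q ^ 2 with hT
  have hT0 : 0 ≤ T := by positivity
  have hsq : ∀ z : EuclideanSpace ℝ (Fin d), T * (‖x + z‖ ^ 2 - ‖x‖ ^ 2) =
      inner ℝ ((2 * T) • x) z + T * ‖z‖ ^ 2 := fun z => by
    rw [norm_add_sq_real, inner_smul_left]; simp; ring
  set b' := (2 * T) • x with hb'
  have htouch : ∀ z : EuclideanSpace ℝ (Fin d), ‖z‖ < min η₀ (Q / 2) →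
      h (x + z) - h x ≤ inner ℝ (M • b + b') z + (M * A + T) * ‖z‖ ^ 2 := by
    intro z hz
    have h1 := hlocal (x + z) (by
      have := hz.trans_le (min_le_right _ _)
      linarith [norm_add_le x z])
    have h2 := mul_le_mul_of_nonneg_left (hpar z (hz.trans_le (min_le_left _ _))) hM
    rw [hsq] at h1
    rw [inner_add_left, inner_smul_left]
    simp only [conj_trivial]
    linarith
  obtain ⟨t1, t2⟩ := hh.tail_le (by linarith) (by linarith) h0 hρ hx₁ hL hρL
    (by positivity : 0 < Q / 2) hQL
  have hmQ : MeasurableSet {z : EuclideanSpace ℝ (Fin d) | Q / 2 ≤ ‖z‖} := measurableSet_le_norm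
  set RHS := sphereArea d * (T * ((Q / 2) ^ (2 - 2 * a) / (2 - 2 * a)) +
      0 * ((Q / 2) ^ (1 - a) / (1 - a)) + 16 * S * ((Q / 2) ^ (-(2 * a)) / (2 * a))) +
      tailConst d (2 * a) * (L / (Q / 2)) ^ ((d : ℝ) + 2 * a) * ρ ^ (-(2 * a)) * h x₁ with hRHS
  set K' := M * E + (M * A + T) * sphereArea d / (2 - 2 * a) with hK'
  have key : ∀ η : ℝ, 0 < η → 4 * η ≤ x j - modPrim ℓ (x i) → η < min η₀ (Q / 2) →
      M * (κ * Q ^ (-a)) ≤ RHS + K' * η ^ (2 - 2 * a) := by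
    intro η hη hη1 hη2
    obtain ⟨G, g1, g2, g3⟩ := hE η hη hη1
    obtain ⟨u1, u2⟩ := hh.touching (by linarith) (by linarith) h0 hU hxU
      (by positivity : 0 ≤ M * A + T) (M • b + b') htouch hη hη2
    obtain ⟨n1, n2⟩ := nearMajorant_integral_le ha ha1 b' hT0 le_rfl (by positivity : 0 ≤ 16 * S)
      hη (by positivity : 0 < Q / 2)
    set V := {z : EuclideanSpace ℝ (Fin d) | Q / 2 ≤ ‖z‖}.indicator
      (fun z => h (x + z) * ‖z‖ ^ (-(d : ℝ) - 2 * a)) with hV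
    have hVi : Integrable V := (integrable_indicator_iff hmQ).2 t1
    have hV0 : ∀ z, 0 ≤ V z := Set.indicator_nonneg fun z _ => mul_nonneg (h0 _) (by positivity)
    have hVint : ∫ z in {z : EuclideanSpace ℝ (Fin d) | η ≤ ‖z‖}, V z ≤
        tailConst d (2 * a) * (L / (Q / 2)) ^ ((d : ℝ) + 2 * a) * ρ ^ (-(2 * a)) * h x₁ := by
      refine (setIntegral_le_integral hVi (Filter.Eventually.of_forall hV0)).trans ?_
      rw [hV, integral_indicator hmQ]; exact t2
    have hdiff : IntegrableOn (fun z => (h (x + z) - h x) * ‖z‖ ^ (-(d : ℝ) - 2 * a))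
        {z | η ≤ ‖z‖} := by
      have r1 := (radial_integral_far (d := d) (by linarith : 0 < 2 * a) hη).1.const_mul (h x)
      exact (u1.sub r1).congr (Filter.Eventually.of_forall fun z => by
        simp only [Pi.sub_apply]; ring)
    have hmaj := ((g1.const_mul M).add n1).add hVi.integrableOn
    have hle := setIntegral_mono_on hdiff hmaj (measurableSet_le_norm (d := d) (η := η))
      (fun z hz => by
        have hz' : η ≤ ‖z‖ := hz
        have hK0 : 0 ≤ ‖z‖ ^ (-(d : ℝ) - 2 * a) := by positivity
        have e1 := mul_le_mul_of_nonneg_left (g2 z hz') hM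
        simp only [Pi.add_apply]
        by_cases hzQ : ‖z‖ < Q / 2
        · have e2 := mul_le_mul_of_nonneg_right
            (hlocal (x + z) (by linarith [norm_add_le x z])) hK0
          rw [hsq] at e2
          rw [nearMajorant, if_pos hzQ]
          have := hV0 z
          linarith
        · have eV : V z = h (x + z) * ‖z‖ ^ (-(d : ℝ) - 2 * a) := by
            rw [hV, Set.indicator_of_mem]; exact not_lt.1 hzQ
          rw [nearMajorant, if_neg hzQ, eV]
          by_cases hyQ : ‖x + z‖ ≤ Q
          · have e2 := mul_le_mul_of_nonneg_right (hlocal (x + z) hyQ) hK0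
            have e3 : T * (‖x + z‖ ^ 2 - ‖x‖ ^ 2) ≤ 16 * S := by
              have : ‖x + z‖ ^ 2 - ‖x‖ ^ 2 ≤ Q ^ 2 := by
                nlinarith [norm_nonneg (x + z), norm_nonneg x]
              refine (mul_le_mul_of_nonneg_left this hT0).trans_eq ?_
              rw [hT]; field_simp
            have e4 := mul_le_mul_of_nonneg_right e3 hK0
            have e5 := mul_nonneg (h0 (x + z)) hK0
            linarith
          · have e2 := mul_le_mul_of_nonneg_right (hfar (x + z) (not_le.1 hyQ)) hK0
            have e5 : 0 ≤ 16 * S * ‖z‖ ^ (-(d : ℝ) - 2 * a) := by positivity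
            linarith)
    have s1 := integral_add ((g1.const_mul M).add n1) hVi.integrableOn
    have s2 := integral_add (g1.const_mul M) n1
    simp only [Pi.add_apply] at s1 s2 hle
    rw [s1, s2, integral_const_mul] at hle
    have f1 := mul_le_mul_of_nonneg_left g3 hM
    have f2 : K' * η ^ (2 - 2 * a) = M * (E * η ^ (2 - 2 * a)) +
        (M * A + T) * sphereArea d * η ^ (2 - 2 * a) / (2 - 2 * a) := by rw [hK']; ring
    rw [f2]
    linarith
  have hlim : Filter.Tendsto (fun η : ℝ => RHS + K' * η ^ (2 - 2 * a)) (nhdsWithin 0 (Set.Ioi 0))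
      (nhds RHS) := by
    have hc : Continuous fun η : ℝ => RHS + K' * η ^ (2 - 2 * a) :=
      continuous_const.add (continuous_const.mul (Real.continuous_rpow_const (by linarith)))
    have := hc.tendsto 0
    rw [Real.zero_rpow (by linarith), mul_zero, add_zero] at this
    exact this.mono_left nhdsWithin_le_nhds
  refine ge_of_tendsto hlim ?_
  have hpos : 0 < min ((x j - modPrim ℓ (x i)) / 4) (min η₀ (Q / 2)) := by positivity
  filter_upwards [Ioo_mem_nhdsGT hpos] with η hη
  exact key η hη.1 (by linarith [hη.2.trans_le (min_le_left _ _)])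
    (hη.2.trans_le (min_le_right _ _))

end RegularModulus

namespace RegularModulus
variable {d : ℕ} [NeZero d] {ℓ : ℝ → ℝ} {c C : ℝ} (H : RegularModulus ℓ c C) {a κ₀ κ C₁ : ℝ}
  {i j : Fin d}
include H

set_option maxHeartbeats 1000000 in
/-- A nonnegative harmonic function vanishing outside the domain is dominated by the barrier. -/
theorem exists_barrier_comparison (ha : 0 < a) (ha1 : a < 1) (hij : i ≠ j) (hκ₀ : 0 < κ₀)
    (hκ₀1 : κ₀ ≤ 1) (hκ : 0 < κ) (hκ1 : κ ≤ 1 / 2) (hC₁ : 0 < C₁) :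
    ∃ lam₀ M : ℝ, 0 < lam₀ ∧ 0 < M ∧ ∀ lam R : ℝ, 0 ≤ lam → lam ≤ lam₀ → 0 < R →
      lam * ℓ (κ * R) ≤ 1 → ℓ (κ * R) ≤ 1 / 4 →
      ∀ (D : Set (EuclideanSpace ℝ (Fin d))) (h : EuclideanSpace ℝ (Fin d) → ℝ)
        (x₁ : EuclideanSpace ℝ (Fin d)), IsOpen D → D ⊆ {y | 0 < y j - modPrim ℓ (y i)} →
      (∀ x, 0 ≤ h x) → AlphaHarmonicOn d (2 * a) h (D ∩ ball 0 R) →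
      (∀ x ∈ ball 0 R \ D, h x = 0) → ContinuousOn h (ball 0 R) → ‖x₁‖ ≤ R →
      closedBall x₁ (κ₀ * R) ⊆ D ∩ ball 0 R → (∀ x, ‖x‖ ≤ R / 2 → h x ≤ C₁ * h x₁) →
      ∀ x, ‖x‖ ≤ κ * R / 4 → h x ≤ h x₁ * (M * (κ * R) ^ (-a) *
        truncBarrier ℓ a lam (κ * R) i j x + 16 * C₁ * ‖x‖ ^ 2 / (κ * R) ^ 2) := by
  obtain ⟨lam₀, κb, hlam₀, hκb, hbar⟩ := H.exists_barrier_majorant (d := d) ha ha1 hij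
  have hσ := sphereArea_pos d
  have htc := tailConst_pos d (by linarith : 0 < 2 * a) (by linarith : 2 * a < 2)
  have h2a : 0 < 2 - 2 * a := by linarith
  set T := sphereArea d * (16 * C₁ / (2 - 2 * a) + 64 * C₁ / (2 * a)) +
    tailConst d (2 * a) * (4 / κ) ^ ((d : ℝ) + 2 * a) * (κ₀ / κ) ^ (-(2 * a)) with hT
  have hT0 : 0 < T := by positivity
  refine ⟨lam₀, 2 * T / κb, hlam₀, by positivity, ?_⟩
  intro lam R hlam hlam1 hR hsmall hℓ D h x₁ hD hDs h0 hh hv hcont hx₁R hx₁ hsup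
  set Q := κ * R with hQ
  have hQ0 : 0 < Q := by positivity
  have hQR : Q ≤ R / 2 := by rw [hQ]; nlinarith
  have hH0 : 0 ≤ h x₁ := h0 x₁
  set S := C₁ * h x₁ with hS
  set M' := 2 * T / κb * h x₁ * Q ^ (-a) with hM'
  have hS0 : 0 ≤ S := by positivity
  have hM0 : 0 ≤ M' := by positivity
  have hB0 : ∀ y, 0 ≤ truncBarrier ℓ a lam Q i j y := fun y => truncBarrier_nonneg y
  set Ψ : EuclideanSpace ℝ (Fin d) → ℝ := fun y => M' * truncBarrier ℓ a lam Q i j y +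
    16 * S / Q ^ 2 * ‖y‖ ^ 2 with hΨ
  have hΨ0 : ∀ y, 0 ≤ Ψ y := fun y => add_nonneg (mul_nonneg hM0 (hB0 y)) (by positivity)
  have hΨS : ∀ y, Q / 4 ≤ ‖y‖ → S ≤ Ψ y := by
    intro y hy
    have h1 := mul_nonneg hM0 (hB0 y)
    have h2 : (Q / 4) ^ 2 ≤ ‖y‖ ^ 2 := pow_le_pow_left₀ (by positivity) hy 2
    have h3 := mul_le_mul_of_nonneg_left h2 (by positivity : 0 ≤ 16 * S / Q ^ 2)
    have h4 : 16 * S / Q ^ 2 * (Q / 4) ^ 2 = S := by field_simp; ring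
    simp only [hΨ]
    linarith
  suffices hmain : ∀ x, ‖x‖ ≤ Q / 4 → h x ≤ Ψ x by
    intro x hx
    refine (hmain x hx).trans_eq ?_
    simp only [hΨ, hM', hS]; ring
  by_contra! hcon
  obtain ⟨w, hw, hwΨ⟩ := hcon
  have hfc : ContinuousOn (fun y => h y - Ψ y) (closedBall 0 (Q / 4)) := by
    have c1 : ContinuousOn h (closedBall 0 (Q / 4)) :=
      hcont.mono (closedBall_subset_ball (by linarith))
    have c2 := (H.continuousOn_truncBarrier (i := i) (j := j) ha hlam hQ0).mono
      (closedBall_subset_closedBall (by linarith : Q / 4 ≤ Q))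
    exact c1.sub ((continuousOn_const.mul c2).add (by fun_prop))
  obtain ⟨x, hx, hmax⟩ := (isCompact_closedBall (0 : EuclideanSpace ℝ (Fin d)) (Q / 4)).exists_isMaxOn
    ⟨w, mem_closedBall_zero_iff.2 hw⟩ hfc
  have hx4 : ‖x‖ ≤ Q / 4 := mem_closedBall_zero_iff.1 hx
  have hmax' : ∀ y, ‖y‖ ≤ Q / 4 → h y - Ψ y ≤ h x - Ψ x :=
    fun y hy => hmax (mem_closedBall_zero_iff.2 hy)
  have hxΨ : Ψ x < h x := by linarith [hmax' w hw]
  have hhx : 0 < h x := (hΨ0 x).trans_lt hxΨ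
  have hxS : h x ≤ S := hsup x (by linarith)
  have hH : 0 < h x₁ := by
    rcases hH0.lt_or_eq with h1 | h1
    · exact h1
    · rw [hS, ← h1, mul_zero] at hxS; linarith
  have hxlt : ‖x‖ < Q / 4 := by
    by_contra! hcon
    linarith [hΨS x hcon]
  have hxD : x ∈ D := by
    by_contra hcon
    have := hv x ⟨mem_ball_zero_iff.2 (by linarith), hcon⟩
    linarith
  have hp₀ : 0 < x j - modPrim ℓ (x i) := hDs hxD
  have hxpos : 0 < ‖x‖ := by
    rw [norm_pos_iff]
    rintro rfl
    simp [modPrim_zero] at hp₀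
  have hxx : ‖x - x₁‖ ≤ 2 * R := (norm_sub_le _ _).trans (by linarith)
  have hΨx : Ψ x = M' * truncBarrier ℓ a lam Q i j x + 16 * S / Q ^ 2 * ‖x‖ ^ 2 := rfl
  have key := H.le_of_touching (M := M') (S := S) (ρ := κ₀ * R) (L := 2 * R) ha ha1 hlam hsmall hℓ
    hxpos (by linarith) hp₀ (hbar lam Q hlam hlam1 hQ0 hsmall hℓ x hxpos (by linarith) hp₀)
    (hD.inter isOpen_ball) ⟨hxD, mem_ball_zero_iff.2 (by linarith)⟩ h0 hh hM0 hS0 (by positivity)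
    hx₁ hxx (by nlinarith) (by linarith)
    (by
      intro y hy
      have h3 : h y - Ψ y ≤ h x - Ψ x := by
        rcases le_total ‖y‖ (Q / 4) with h1 | h1
        · exact hmax' y h1
        · have := hΨS y h1
          have := hsup y (by linarith)
          linarith
      simp only [hΨ] at h3
      linarith)
    (by
      intro y hy
      have h3 : truncBarrier ℓ a lam Q i j y = 0 := if_neg (not_le.2 hy)
      have h4 : 0 ≤ 16 * S / Q ^ 2 * ‖x‖ ^ 2 := by positivity
      rw [h3]
      linarith)
  have e0 : Q ^ (-a) * Q ^ (-a) = Q ^ (-(2 * a)) := by rw [← Real.rpow_add hQ0]; ring_nf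
  have e1 : M' * (κb * Q ^ (-a)) = 2 * T * (h x₁ * Q ^ (-(2 * a))) := by
    rw [← e0, hM']; field_simp
  have e2 : (Q / 2) ^ (2 - 2 * a) ≤ Q ^ 2 * Q ^ (-(2 * a)) := by
    refine (Real.rpow_le_rpow (by positivity) (by linarith : Q / 2 ≤ Q) h2a.le).trans_eq ?_
    rw [← Real.rpow_natCast, ← Real.rpow_add hQ0]; norm_num; ring_nf
  have e3 : (Q / 2) ^ (-(2 * a)) ≤ 4 * Q ^ (-(2 * a)) := by
    rw [Real.div_rpow hQ0.le (by norm_num), div_eq_mul_inv, ← Real.rpow_neg (by norm_num), neg_neg,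
      mul_comm]
    refine mul_le_mul_of_nonneg_right ?_ (by positivity)
    refine (Real.rpow_le_rpow_of_exponent_le (by norm_num) (by linarith : 2 * a ≤ 2)).trans_eq ?_
    norm_num
  have e4 : 2 * R / (Q / 2) = 4 / κ := by rw [hQ]; field_simp; norm_num
  have e5 : (κ₀ * R) ^ (-(2 * a)) = (κ₀ / κ) ^ (-(2 * a)) * Q ^ (-(2 * a)) := by
    rw [← Real.mul_rpow (by positivity) hQ0.le, hQ]; congr 1; field_simp
  rw [e1, e4, e5] at key
  have f1 : 16 * S / Q ^ 2 * ((Q / 2) ^ (2 - 2 * a) / (2 - 2 * a)) ≤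
      16 * C₁ / (2 - 2 * a) * (h x₁ * Q ^ (-(2 * a))) := by
    have : 16 * S / Q ^ 2 * ((Q / 2) ^ (2 - 2 * a) / (2 - 2 * a)) ≤
        16 * S / Q ^ 2 * (Q ^ 2 * Q ^ (-(2 * a)) / (2 - 2 * a)) := by gcongr
    refine this.trans_eq ?_
    rw [hS]; field_simp
  have f2 : 16 * S * ((Q / 2) ^ (-(2 * a)) / (2 * a)) ≤
      64 * C₁ / (2 * a) * (h x₁ * Q ^ (-(2 * a))) := by
    have : 16 * S * ((Q / 2) ^ (-(2 * a)) / (2 * a)) ≤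
        16 * S * (4 * Q ^ (-(2 * a)) / (2 * a)) := by gcongr
    refine this.trans_eq ?_
    rw [hS]; ring
  have f3 := mul_le_mul_of_nonneg_left (add_le_add f1 f2) hσ.le
  have f4 : 2 * T * (h x₁ * Q ^ (-(2 * a))) ≤ T * (h x₁ * Q ^ (-(2 * a))) := by
    refine key.trans ?_
    rw [hT]
    linarith
  have : 0 < T * (h x₁ * Q ^ (-(2 * a))) := by positivity
  linarith

end RegularModulus

namespace RegularModulus
variable {d : ℕ} {ℓ : ℝ → ℝ} {c C : ℝ} (H : RegularModulus ℓ c C)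
include H

theorem gEll_continuous : Continuous (gEll ℓ) := by
  have : gEll ℓ = fun t => t * modExt ℓ t := by
    funext t; unfold gEll modExt; split_ifs <;> ring
  rw [this]
  exact continuous_id.mul H.modExt_continuous

theorem isOpen_Dp (hd : 0 < d) : IsOpen (Dp d hd ℓ) :=
  isOpen_lt (f := fun x : EuclideanSpace ℝ (Fin d) => gEll ℓ (x ⟨0, hd⟩))
    (g := fun x => x ⟨d - 1, Nat.sub_lt hd Nat.one_pos⟩)
    (H.gEll_continuous.comp (by fun_prop)) (by fun_prop)

theorem Dp_subset (hd : 0 < d) : Dp d hd ℓ ⊆ {y : EuclideanSpace ℝ (Fin d) |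
    0 < y ⟨d - 1, Nat.sub_lt hd Nat.one_pos⟩ - modPrim ℓ (y ⟨0, hd⟩)} := by
  intro y hy
  have hy' : gEll ℓ (y ⟨0, hd⟩) < y ⟨d - 1, Nat.sub_lt hd Nat.one_pos⟩ := hy
  have := H.modPrim_le_gEll (y ⟨0, hd⟩)
  rw [Set.mem_ofPred_eq]
  linarith

theorem gEll_le {t u : ℝ} (hu : 0 ≤ u) (hu1 : u ≤ 1) (ht : t ≤ u) : gEll ℓ t ≤ u * ℓ 1 := by
  have h1 := H.pos 1 one_pos
  unfold gEll
  split_ifs with h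
  · exact mul_le_mul ht (H.mono t 1 h (ht.trans hu1)) (H.pos t h).le hu
  · positivity

theorem closedBall_single_subset (hd : 2 ≤ d) (hd0 : 0 < d) (hd1 : d - 1 < d) {R : ℝ} (hR : 0 < R) (hR1 : R ≤ 1) :
    closedBall (EuclideanSpace.single (⟨d - 1, hd1⟩ : Fin d) (R / 2))
      (1 / (8 * (1 + ℓ 1)) * R) ⊆ Dp d hd0 ℓ ∩ ball 0 R := by
  intro y hy
  have hℓ := H.pos 1 one_pos
  set x₁ := EuclideanSpace.single (⟨d - 1, hd1⟩ : Fin d) (R / 2) with hx₁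
  set ρ := 1 / (8 * (1 + ℓ 1)) * R with hρ
  have hρ0 : 0 < ρ := by positivity
  have hρR : ρ + ρ * ℓ 1 = R / 8 := by rw [hρ]; field_simp
  have hρ1 : 0 < ρ * ℓ 1 := by positivity
  rw [mem_closedBall, dist_eq_norm] at hy
  have hn : ‖x₁‖ = R / 2 := by
    rw [hx₁, PiLp.norm_single, Real.norm_of_nonneg (by linarith)]
  have hi := (abs_le.1 ((abs_coord_le_norm (y - x₁) ⟨0, hd0⟩).trans hy)).2
  have hj := (abs_le.1 ((abs_coord_le_norm (y - x₁) ⟨d - 1, hd1⟩).trans hy)).1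
  have hne : (⟨0, hd0⟩ : Fin d) ≠ ⟨d - 1, hd1⟩ := by
    rw [Ne, Fin.mk.injEq]; omega
  have hi0 : x₁ ⟨0, hd0⟩ = 0 := by rw [hx₁]; simp [hne]
  have hj0 : x₁ ⟨d - 1, hd1⟩ = R / 2 := by rw [hx₁]; simp
  rw [PiLp.sub_apply, hi0, sub_zero] at hi
  rw [PiLp.sub_apply, hj0] at hj
  constructor
  · have := H.gEll_le hρ0.le (by linarith) hi
    change gEll ℓ (y ⟨0, _⟩) < y ⟨d - 1, _⟩
    linarith
  · rw [mem_ball_zero_iff]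
    have := norm_le_norm_add_norm_sub' y x₁
    linarith

theorem div_le_exp_neg_integral {lam : ℝ} (hlam : 0 ≤ lam) (hlam1 : lam * ℓ 1 ≤ 1) {u v : ℝ}
    (hu : 0 < u) (huv : u ≤ v) (hv : v ≤ 1) :
    u / v ≤ Real.exp (-(lam * ∫ t in u..v, ℓ t / t)) := by
  have hv0 : 0 < v := hu.trans_le huv
  have h1 : ∫ t in u..v, ℓ t / t ≤ ∫ t in u..v, ℓ 1 * t⁻¹ := by
    refine intervalIntegral.integral_mono_on huv (H.intervalIntegrable_div hu hv0) ?_ ?_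
    · refine (intervalIntegral.intervalIntegrable_inv (fun t ht => ?_) continuousOn_id).const_mul _
      rw [Set.uIcc_of_le huv] at ht
      exact (hu.trans_le ht.1).ne'
    · intro t ht
      have ht0 := hu.trans_le ht.1
      rw [div_eq_mul_inv]
      exact mul_le_mul_of_nonneg_right (H.mono t 1 ht0 (ht.2.trans hv)) (by positivity)
  rw [intervalIntegral.integral_const_mul, integral_inv_of_pos hu hv0] at h1
  have hlog : 0 ≤ Real.log (v / u) := Real.log_nonneg ((one_le_div hu).2 huv)
  have h2 := mul_le_mul_of_nonneg_left h1 hlam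
  have h3 := mul_le_mul_of_nonneg_right hlam1 hlog
  have h4 : u / v = Real.exp (-Real.log (v / u)) := by
    rw [Real.exp_neg, Real.exp_log (by positivity), inv_div]
  rw [h4, Real.exp_le_exp]
  linarith

set_option maxHeartbeats 1000000 in
/-- Boundary decay of nonnegative harmonic functions along the vertical axis. -/
theorem exists_decay (hd : 2 ≤ d) (hd0 : 0 < d) (hd1 : d - 1 < d) {a : ℝ} (ha : 0 < a) (ha1 : a < 1) :
    ∃ lam C : ℝ, 0 < lam ∧ 1 < C ∧ ∀ R : ℝ, R ∈ Set.Ioc (0 : ℝ) 1 →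
      ∀ h : EuclideanSpace ℝ (Fin d) → ℝ, (∀ x, 0 ≤ h x) →
        AlphaHarmonicOn d (2 * a) h (Dp d hd0 ℓ ∩ ball 0 R) →
        (∀ x ∈ ball (0 : EuclideanSpace ℝ (Fin d)) R \ Dp d hd0 ℓ, h x = 0) →
        ContinuousOn h (ball (0 : EuclideanSpace ℝ (Fin d)) R) →
        ∀ r : ℝ, r ∈ Set.Ioc (0 : ℝ) (R / 2) →
          h (EuclideanSpace.single (⟨d - 1, hd1⟩ : Fin d) r) ≤
            C * (r / R) ^ a * Real.exp (-(lam * ∫ u in r..R, ℓ u / u)) *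
              h (EuclideanSpace.single (⟨d - 1, hd1⟩ : Fin d) (R / 2)) := by
  have : NeZero d := ⟨by omega⟩
  have hℓ1 := H.pos 1 one_pos
  have hne : (⟨0, hd0⟩ : Fin d) ≠ ⟨d - 1, hd1⟩ := by
    rw [Ne, Fin.mk.injEq]; omega
  have hκ₀ : 0 < 1 / (8 * (1 + ℓ 1)) := by positivity
  have hκ₀1 : 1 / (8 * (1 + ℓ 1)) ≤ 1 := by
    rw [div_le_one (by positivity)]; linarith
  obtain ⟨C₁, hC₁, hsup⟩ := exists_sup_bound (d := d) (by linarith : 0 < 2 * a)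
    (by linarith : 2 * a < 2) hκ₀ hκ₀1
  obtain ⟨κ, hκ, hκ1, hκℓ⟩ : ∃ κ : ℝ, 0 < κ ∧ κ ≤ 1 / 2 ∧ ℓ κ ≤ 1 / 4 := by
    have h1 := H.lim.eventually (gt_mem_nhds (by norm_num : (0 : ℝ) < 1 / 4))
    have h2 : ∀ᶠ t : ℝ in nhdsWithin 0 (Set.Ioi 0), t < 1 / 2 :=
      nhdsWithin_le_nhds (gt_mem_nhds (by norm_num))
    obtain ⟨κ, k1, k2, k3⟩ := (h1.and (h2.and self_mem_nhdsWithin)).exists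
    exact ⟨κ, k3, k2.le, k1.le⟩
  obtain ⟨lam₀, M, hlam₀, hM, hcomp⟩ := H.exists_barrier_comparison (d := d) ha ha1 hne hκ₀ hκ₀1 hκ
    hκ1 hC₁
  set lam := min lam₀ (1 / ℓ 1) with hlam
  have hlam0 : 0 < lam := by positivity
  have hlam1 : lam * ℓ 1 ≤ 1 := (le_div_iff₀ hℓ1).1 (min_le_right _ _)
  have hCp : 0 < M * κ ^ (-a) / κ + 16 * C₁ / κ ^ 2 := by positivity
  refine ⟨lam, 1 + (M * κ ^ (-a) / κ + 16 * C₁ / κ ^ 2), hlam0, by linarith, ?_⟩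
  rintro R ⟨hR, hR1⟩ h h0 hh hv hcont r ⟨hr, hrR⟩
  have hball := H.closedBall_single_subset hd hd0 hd1 hR hR1
  set e : ℝ → EuclideanSpace ℝ (Fin d) := EuclideanSpace.single ⟨d - 1, hd1⟩ with he
  have hen : ∀ t : ℝ, 0 ≤ t → ‖e t‖ = t := fun t ht => by
    rw [he, PiLp.norm_single, Real.norm_of_nonneg ht]
  have hnorm : ‖e (R / 2)‖ ≤ R := by rw [hen _ (by linarith)]; linarith
  have hD := H.isOpen_Dp (d := d) hd0
  have hs := hsup R _ h (e (R / 2)) hR hD h0 hh hv hcont hnorm hball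
  have hH := h0 (e (R / 2))
  set W := Real.exp (-(lam * ∫ u in r..R, ℓ u / u)) with hW
  have ht0 : 0 < r / R := by positivity
  have ht1 : r / R ≤ 1 := by rw [div_le_one hR]; linarith
  have hWt : r / R ≤ W := H.div_le_exp_neg_integral hlam0.le hlam1 hr (by linarith) hR1
  have hta : r / R ≤ (r / R) ^ a := by
    simpa using Real.rpow_le_rpow_of_exponent_ge ht0 ht1 ha1.le
  have hsq : (r / R) ^ 2 ≤ (r / R) ^ a * W := by
    rw [sq]; exact mul_le_mul hta hWt ht0.le (by positivity)
  have hX : 0 < (r / R) ^ a * W := by positivity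
  suffices hmain : h (e r) ≤ (M * κ ^ (-a) / κ + 16 * C₁ / κ ^ 2) * ((r / R) ^ a * W) *
      h (e (R / 2)) by
    have := mul_nonneg hX.le hH
    linarith
  rcases le_or_gt r (κ * R / 4) with hrκ | hrκ
  · have hQ0 : 0 < κ * R := by positivity
    have hQκ : κ * R ≤ κ := by nlinarith
    have hQR : κ * R ≤ R := by nlinarith
    have hℓQ := H.mono _ _ hQ0 hQκ
    have hℓQ1 := H.mono _ 1 hQ0 (hQκ.trans (by linarith))
    have hc := hcomp lam R hlam0.le (min_le_left _ _) hR
      ((mul_le_mul_of_nonneg_left hℓQ1 hlam0.le).trans hlam1) (hℓQ.trans hκℓ) _ h (e (R / 2)) hD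
      (H.Dp_subset hd0) h0 hh hv hcont hnorm hball hs (e r) (by rw [hen r hr.le]; exact hrκ)
    have hB : truncBarrier ℓ a lam (κ * R) (⟨0, hd0⟩ : Fin d) ⟨d - 1, hd1⟩ (e r) =
        r ^ a * Real.exp (-(lam * ∫ u in r..(κ * R), ℓ u / u)) := by
      have z1 : e r ⟨0, hd0⟩ = 0 := by rw [he]; simp; omega
      have z2 : e r ⟨d - 1, hd1⟩ = r := by rw [he]; simp
      rw [truncBarrier, hen r hr.le, if_pos (by linarith), z1, z2, modPrim_zero, sub_zero,
        max_eq_left hr.le, modWeight, if_pos hr]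
    have hg : Real.exp (-(lam * ∫ u in r..(κ * R), ℓ u / u)) ≤ W / κ := by
      have k1 := H.div_le_exp_neg_integral hlam0.le hlam1 hQ0 hQR hR1
      rw [mul_div_cancel_right₀ _ hR.ne'] at k1
      have k2 : W = Real.exp (-(lam * ∫ u in r..(κ * R), ℓ u / u)) *
          Real.exp (-(lam * ∫ u in (κ * R)..R, ℓ u / u)) := by
        rw [hW, ← Real.exp_add, ← intervalIntegral.integral_add_adjacent_intervals
          (H.intervalIntegrable_div hr hQ0) (H.intervalIntegrable_div hQ0 hR)]
        ring_nf
      rw [le_div_iff₀ hκ, k2]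
      exact mul_le_mul_of_nonneg_left k1 (Real.exp_pos _).le
    have hp : (κ * R) ^ (-a) * r ^ a = κ ^ (-a) * (r / R) ^ a := by
      rw [Real.mul_rpow hκ.le hR.le, Real.div_rpow hr.le hR.le, Real.rpow_neg hR.le]; ring
    have hq : 16 * C₁ * r ^ 2 / (κ * R) ^ 2 ≤ 16 * C₁ / κ ^ 2 * ((r / R) ^ a * W) := by
      refine le_trans (le_of_eq ?_) (mul_le_mul_of_nonneg_left hsq (by positivity))
      field_simp
    have hB' : M * (κ * R) ^ (-a) * (r ^ a * Real.exp (-(lam * ∫ u in r..(κ * R), ℓ u / u))) ≤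
        M * κ ^ (-a) / κ * ((r / R) ^ a * W) := by
      calc _ = M * (κ ^ (-a) * (r / R) ^ a) *
            Real.exp (-(lam * ∫ u in r..(κ * R), ℓ u / u)) := by rw [← hp]; ring
        _ ≤ M * (κ ^ (-a) * (r / R) ^ a) * (W / κ) :=
            mul_le_mul_of_nonneg_left hg (by positivity)
        _ = _ := by ring
    rw [hB, hen r hr.le] at hc
    refine hc.trans ?_
    have := mul_le_mul_of_nonneg_left (add_le_add hB' hq) hH
    linarith
  · have h1 := hs (e r) (by rw [hen r hr.le]; exact hrR)
    have h2 : κ / 4 ≤ r / R := by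
      rw [le_div_iff₀ hR]; linarith
    have h3 := (pow_le_pow_left₀ (by positivity) h2 2).trans hsq
    have h4 : C₁ ≤ 16 * C₁ / κ ^ 2 * ((r / R) ^ a * W) := by
      refine le_trans (le_of_eq ?_) (mul_le_mul_of_nonneg_left h3 (by positivity))
      field_simp; norm_num
    have h5 : 0 ≤ M * κ ^ (-a) / κ * ((r / R) ^ a * W) := by positivity
    refine h1.trans (mul_le_mul_of_nonneg_right ?_ hH)
    linarith

end RegularModulus

theorem stmt_2 (d : ℕ) (hd : 2 ≤ d) (α : ℝ) (hα : α ∈ Set.Ioo (0 : ℝ) 2) (ℓ : ℝ → ℝ)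
    (hpos : ∀ r : ℝ, 0 < r → 0 < ℓ r)
    (hmono : ∀ s r : ℝ, 0 < s → s ≤ r → ℓ s ≤ ℓ r)
    (hlim : Filter.Tendsto ℓ (nhdsWithin 0 (Set.Ioi 0)) (nhds 0))
    (c : ℝ) (hc : 1 ≤ c)
    (halmost : ∀ s r : ℝ, 0 < s → s ≤ r → ℓ r / r ≤ c * (ℓ s / s))
    (hdiff1 : ∀ r : ℝ, 0 < r → DifferentiableAt ℝ ℓ r)
    (hdiff2 : ∀ r : ℝ, 0 < r → DifferentiableAt ℝ (deriv ℓ) r)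
    (Creg : ℝ) (hCreg : 0 < Creg)
    (hreg : ∀ r : ℝ, 0 < r → r * deriv ℓ r + |r ^ 2 * deriv (deriv ℓ) r| ≤ Creg * ℓ r) :
    ∃ lam C : ℝ, 0 < lam ∧ 1 < C ∧
      ∀ R : ℝ, R ∈ Set.Ioc (0 : ℝ) 1 →
        ∀ h : EuclideanSpace ℝ (Fin d) → ℝ, (∀ x, 0 ≤ h x) →
          AlphaHarmonicOn d α h (Dp d (by omega) ℓ ∩ ball 0 R) →
          (∀ x ∈ ball (0 : EuclideanSpace ℝ (Fin d)) R \ Dp d (by omega) ℓ, h x = 0) →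
          ContinuousOn h (ball (0 : EuclideanSpace ℝ (Fin d)) R) →
          ∀ r : ℝ, r ∈ Set.Ioc (0 : ℝ) (R / 2) →
            h (EuclideanSpace.single (⟨d - 1, by omega⟩ : Fin d) r) ≤
              C * (r / R) ^ (α / 2) * Real.exp (-(lam * ∫ u in r..R, ℓ u / u)) *
                h (EuclideanSpace.single (⟨d - 1, by omega⟩ : Fin d) (R / 2)) := by
  have H : RegularModulus ℓ c Creg := ⟨hpos, hmono, hlim, hc, halmost, hdiff1, hCreg,
    fun r hr => (le_add_of_nonneg_right (abs_nonneg _)).trans (hreg r hr)⟩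
  obtain ⟨a, rfl⟩ : ∃ a, α = 2 * a := ⟨α / 2, by ring⟩
  rw [mul_div_cancel_left₀ a two_ne_zero]
  exact H.exists_decay hd _ _ (by linarith [hα.1]) (by linarith [hα.2])
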